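/- For every integer n ≥ 1, every countable model M of PA⁻ + IΣn, and every a ∈ M, there exists a model N such that: N is a Σ_{n+1}-elementary cofinal extension of M; the initial segments below a coincide, [0,a]^M = [0,a]^N; and N satisfies PA⁻ + IΣn + FRT(Σ_{n+1}). Consequently, PA⁻ + IΣn + FRT(Σ_{n+1}) does not prove WPHP(Σ_{n+1}). -/

import Mathlib

/- Shared development: first-order arithmetic in the language {0,1,+,·,<},
   the arithmetic hierarchy, fragments of arithmetic, and coded finite
   combinatorics inside models. -/

open FirstOrder Language

namespace ArithFC

/-- Function symbols of the language of arithmetic: 0, 1, +, ·. -/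
inductive Func : ℕ → Type
  | zero : Func 0
  | one : Func 0
  | add : Func 2
  | mul : Func 2

/-- Relation symbols of the language of arithmetic: <. -/
inductive Rel : ℕ → Type
  | lt : Rel 2

/-- The first-order language {0, 1, +, ·, <}. -/
def lang : Language :=
  { Functions := Func, Relations := Rel }

section Instances

variable (M : Type) [lang.Structure M]

instance : Zero M := ⟨Structure.funMap (L := lang) Func.zero ![]⟩
instance : One M := ⟨Structure.funMap (L := lang) Func.one ![]⟩
instance : Add M := ⟨fun x y => Structure.funMap (L := lang) Func.add ![x, y]⟩
instance : Mul M := ⟨fun x y => Structure.funMap (L := lang) Func.mul ![x, y]⟩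
instance : LT M := ⟨fun x y => Structure.RelMap (L := lang) Rel.lt ![x, y]⟩
instance : LE M := ⟨fun x y => x < y ∨ x = y⟩

end Instances

/-- The numeral `n` in a model. -/
def numM (M : Type) [lang.Structure M] : ℕ → M
  | 0 => 0
  | n + 1 => numM M n + 1

/-- `b` is nonstandard (greater than every numeral). -/
def Nonstd {M : Type} [lang.Structure M] (b : M) : Prop := ∀ n : ℕ, numM M n < b

/-- The atomic formula `t < u`. -/
def ltFm {α : Type} {n : ℕ} (t u : lang.Term (α ⊕ Fin n)) : lang.BoundedFormula α n :=
  BoundedFormula.rel (Rel.lt : lang.Relations 2) ![t, u]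

/-- Δ₀ formulas: built from atomic formulas by boolean connectives and
bounded universal quantification (this generates, up to logical equivalence,
the usual class of bounded formulas). -/
inductive IsDelta0 {α : Type} : ∀ n : ℕ, lang.BoundedFormula α n → Prop
  | falsum (n : ℕ) : IsDelta0 n BoundedFormula.falsum
  | equal (n : ℕ) (t u : lang.Term (α ⊕ Fin n)) : IsDelta0 n (BoundedFormula.equal t u)
  | rel (n l : ℕ) (R : lang.Relations l) (ts : Fin l → lang.Term (α ⊕ Fin n)) :
      IsDelta0 n (BoundedFormula.rel R ts)
  | imp (n : ℕ) {φ ψ : lang.BoundedFormula α n} :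
      IsDelta0 n φ → IsDelta0 n ψ → IsDelta0 n (φ.imp ψ)
  | bdAll (n : ℕ) (t : lang.Term (α ⊕ Fin n)) {φ : lang.BoundedFormula α (n + 1)} :
      IsDelta0 (n + 1) φ →
      IsDelta0 n
        (BoundedFormula.all ((ltFm (Term.var (Sum.inr (Fin.last n))) (t.liftAt 1 n)).imp φ))

mutual
  /-- Σ_m formulas. -/
  inductive SigmaFm {α : Type} : ℕ → ∀ n : ℕ, lang.BoundedFormula α n → Prop
    | delta0 (m n : ℕ) {φ : lang.BoundedFormula α n} : IsDelta0 n φ → SigmaFm m n φ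
    | ofPi (m n : ℕ) {φ : lang.BoundedFormula α n} : PiFm m n φ → SigmaFm (m + 1) n φ
    | ex (m n : ℕ) {φ : lang.BoundedFormula α (n + 1)} :
        SigmaFm (m + 1) (n + 1) φ → SigmaFm (m + 1) n φ.ex
  /-- Π_m formulas. -/
  inductive PiFm {α : Type} : ℕ → ∀ n : ℕ, lang.BoundedFormula α n → Prop
    | delta0 (m n : ℕ) {φ : lang.BoundedFormula α n} : IsDelta0 n φ → PiFm m n φ
    | ofSigma (m n : ℕ) {φ : lang.BoundedFormula α n} : SigmaFm m n φ → PiFm (m + 1) n φ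
    | all (m n : ℕ) {φ : lang.BoundedFormula α (n + 1)} :
        PiFm (m + 1) (n + 1) φ → PiFm (m + 1) n φ.all
end

/-- A `k`-ary relation on `M` is Σ_m-definable (with parameters from `M`). -/
def IsSigmaDef (m : ℕ) (M : Type) [lang.Structure M] {k : ℕ} (R : (Fin k → M) → Prop) : Prop :=
  ∃ (p : ℕ) (φ : lang.BoundedFormula (Fin k ⊕ Fin p) 0) (w : Fin p → M),
    SigmaFm m 0 φ ∧ ∀ v : Fin k → M, R v ↔ φ.Realize (Sum.elim v w) finZeroElim

/-- A subset of `M` is Σ_m-definable with parameters. -/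
def SigmaDef1 (m : ℕ) (M : Type) [lang.Structure M] (A : Set M) : Prop :=
  IsSigmaDef m M (k := 1) fun v => v 0 ∈ A

/-- A binary relation on `M` is Σ_m-definable with parameters. -/
def SigmaDef2 (m : ℕ) (M : Type) [lang.Structure M] (R : M → M → Prop) : Prop :=
  IsSigmaDef m M (k := 2) fun v => R (v 0) (v 1)

/-- A ternary relation on `M` is Σ_m-definable with parameters. -/
def SigmaDef3 (m : ℕ) (M : Type) [lang.Structure M] (R : M → M → M → Prop) : Prop :=
  IsSigmaDef m M (k := 3) fun v => R (v 0) (v 1) (v 2)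

/-- `M` is a model of PA⁻ (the nonnegative part of a discretely ordered
commutative semiring). -/
structure PAm (M : Type) [lang.Structure M] : Prop where
  add_assoc : ∀ x y z : M, x + y + z = x + (y + z)
  add_comm : ∀ x y : M, x + y = y + x
  mul_assoc : ∀ x y z : M, x * y * z = x * (y * z)
  mul_comm : ∀ x y : M, x * y = y * x
  ldistrib : ∀ x y z : M, x * (y + z) = x * y + x * z
  add_zero : ∀ x : M, x + 0 = x
  mul_zero : ∀ x : M, x * 0 = 0
  mul_one : ∀ x : M, x * 1 = x
  lt_trans : ∀ x y z : M, x < y → y < z → x < z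
  lt_irrefl : ∀ x : M, ¬x < x
  lt_total : ∀ x y : M, x < y ∨ x = y ∨ y < x
  add_lt_add : ∀ x y z : M, x < y → x + z < y + z
  mul_lt_mul : ∀ x y z : M, x < y → 0 < z → x * z < y * z
  sub_exists : ∀ x y : M, x < y → ∃ z, x + z = y
  zero_lt_one : (0 : M) < 1
  discrete : ∀ x : M, 0 < x → (1 : M) ≤ x
  zero_le : ∀ x : M, (0 : M) ≤ x

/-- `M` satisfies the Σ_m-induction scheme (with parameters). -/
def ISig (m : ℕ) (M : Type) [lang.Structure M] : Prop :=
  ∀ A : Set M, SigmaDef1 m M A → (0 : M) ∈ A → (∀ x, x ∈ A → x + 1 ∈ A) → ∀ x, x ∈ A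

/-- `M` satisfies the Σ_m-collection (bounding) scheme (with parameters). -/
def BSig (m : ℕ) (M : Type) [lang.Structure M] : Prop :=
  ∀ R : M → M → Prop, SigmaDef2 m M R → ∀ a : M,
    (∀ x, x < a → ∃ y, R x y) → ∃ b, ∀ x, x < a → ∃ y, y < b ∧ R x y

section Coding

variable {M : Type} [lang.Structure M]

/-- `z` is the Cantor pair `⟨x, y⟩`: `2z = (x+y)(x+y+1) + 2y`. -/
def IsPairC (z x y : M) : Prop := z + z = (x + y) * (x + y + 1) + (y + y)

/-- Gödel's β-function: `x = a mod ((i+1)·b + 1)`. -/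
def BetaC (a b i x : M) : Prop :=
  x < (i + 1) * b + 1 ∧ ∃ q, a = q * ((i + 1) * b + 1) + x

/-- The sequence coded by `s` (via a Cantor pair of β-function data) has value `x`
at place `i`. -/
def SeqAt (s i x : M) : Prop := ∃ a b, IsPairC s a b ∧ BetaC a b i x

/-- `c` codes the M-finite set `X` of cardinality `card`: `c = ⟨card, s⟩` where `s`
codes the strictly increasing enumeration of `X` of length `card`. -/
def CodesFinset (c : M) (X : Set M) (card : M) : Prop :=
  ∃ s, IsPairC c card s ∧
    (∀ i, i < card → ∃ x, x ∈ X ∧ SeqAt s i x) ∧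
    (∀ i j x y, i < j → j < card → SeqAt s i x → SeqAt s j y → x < y) ∧
    (∀ x, x ∈ X ↔ ∃ i, i < card ∧ SeqAt s i x)

/-- `X` is an M-finite (coded) set. -/
def MFinite (X : Set M) : Prop := ∃ c card : M, CodesFinset c X card

/-- `d` codes an `e`-element subset `D` of `[0, y)`, i.e. an element of `[y]^e`. -/
def CodesTupleIn (d e y : M) (D : Set M) : Prop :=
  CodesFinset d D e ∧ ∀ z ∈ D, z < y

/-- `f` codes a (finite) function defined on all of `[0, a)`. -/
def CodesFunOn (f a : M) : Prop :=
  ∀ x, x < a → (∃ y, SeqAt f x y) ∧ ∀ y y', SeqAt f x y → SeqAt f x y' → y = y'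

/-- `X` is an M-coded subset of `[0, a)`. -/
def MCodedSubset (a : M) (X : Set M) : Prop :=
  MFinite X ∧ ∀ x ∈ X, x < a

end Coding

/-- An `M`-ultrafilter on `a`: an ultrafilter of the Boolean algebra of
M-finite subsets of `[0, a)`. -/
structure MUltra (M : Type) [lang.Structure M] (a : M) where
  sets : Set (Set M)
  mem_coded : ∀ X ∈ sets, MCodedSubset a X
  univ_mem : {x : M | x < a} ∈ sets
  superset_mem : ∀ X Y : Set M, X ∈ sets → MCodedSubset a Y → X ⊆ Y → Y ∈ sets
  inter_mem : ∀ X Y : Set M, X ∈ sets → Y ∈ sets → X ∩ Y ∈ sets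
  empty_not_mem : (∅ : Set M) ∉ sets
  ultra : ∀ X : Set M, MCodedSubset a X → X ∈ sets ∨ {x : M | x < a ∧ x ∉ X} ∈ sets

section Principles

variable (M : Type) [lang.Structure M]

/-- `F` is (the graph of) a Σ_m-definable injection from `[0, y)` into `[0, x)`. -/
def SigmaInjRel (m : ℕ) (F : M → M → Prop) (y x : M) : Prop :=
  SigmaDef2 m M F ∧
    (∀ u, u < y → ∃ v, v < x ∧ F u v) ∧
    (∀ u v v', u < y → F u v → F u v' → v = v') ∧
    (∀ u u' v, u < y → u' < y → F u v → F u' v → u = u')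

/-- There exists a Σ_m-definable injection from `[0, y)` into `[0, x)`. -/
def ExSigmaInj (m : ℕ) (y x : M) : Prop := ∃ F : M → M → Prop, SigmaInjRel M m F y x

/-- There exists a Σ_m-definable injection from all of `M` into `[0, a)`. -/
def SigmaInjWhole (m : ℕ) (a : M) : Prop :=
  ∃ F : M → M → Prop, SigmaDef2 m M F ∧
    (∀ u, ∃ v, v < a ∧ F u v) ∧
    (∀ u v v', F u v → F u v' → v = v') ∧
    (∀ u u' v, F u v → F u' v → u = u')

/-- CARD(Σ_m): no Σ_m-definable multivalued map sends `M` injectively below `a`. -/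
def CARD (m : ℕ) : Prop :=
  ∀ F : M → M → Prop, SigmaDef2 m M F → ∀ a : M,
    (∀ x, ∃ y, y < a ∧ F x y) →
      ∃ x0 x1 y, x0 ≠ x1 ∧ y < a ∧ F x0 y ∧ F x1 y

/-- GPHP(Σ_m): for every `x` there is `y` with no Σ_m-definable injection of
`[0,y)` into `[0,x)`. -/
def GPHP (m : ℕ) : Prop := ∀ x : M, ∃ y : M, ¬ExSigmaInj M m y x

/-- WPHP(Σ_m): for `x > 0` there is no Σ_m-definable injection of `[0,2x)` into `[0,x)`. -/
def WPHP (m : ℕ) : Prop := ∀ x : M, 0 < x → ¬ExSigmaInj M m (x + x) x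

/-- `C` is a Σ_m-definable `k`-coloring of `[y]^e` (acting on codes of
`e`-element subsets of `[0,y)`, independently of the chosen code). -/
def IsColoring (m : ℕ) (e y k : M) (C : M → M → Prop) : Prop :=
  SigmaDef2 m M C ∧
    (∀ d D, CodesTupleIn d e y D → ∃ i, i < k ∧ C d i) ∧
    (∀ d d' D i i', CodesTupleIn d e y D → CodesTupleIn d' e y D → C d i → C d' i' → i = i')

/-- FRT^e_k(Σ_m): every Σ_m-definable `k`-coloring of some `[y]^e` has an
M-finite homogeneous set of cardinality `x`, for every `x`. -/
def FRT (m : ℕ) (e k : M) : Prop :=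
  ∀ x : M, ∃ y : M, ∀ C : M → M → Prop, IsColoring M m e y k C →
    ∃ (c : M) (H : Set M), CodesFinset c H x ∧ (∀ z ∈ H, z < y) ∧
      ∃ i, ∀ d D, CodesFinset d D e → D ⊆ H → C d i

/-- fairFRT^e_k(Σ_m): the homogeneous set is required to be given as the range of a
Σ_m-definable injection from `[0,x)` into `[0,y)`. -/
def FairFRT (m : ℕ) (e k : M) : Prop :=
  ∀ x : M, ∃ y : M, ∀ C : M → M → Prop, IsColoring M m e y k C →
    ∃ H : M → M → Prop, SigmaInjRel M m H x y ∧
      ∃ i, ∀ d D, CodesFinset d D e → (∀ z ∈ D, ∃ u, u < x ∧ H u z) → C d i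

/-- `C` is a Σ_m-definable `k`-coloring of `[0, y)`. -/
def IsColoring1 (m : ℕ) (y k : M) (C : M → M → Prop) : Prop :=
  SigmaDef2 m M C ∧
    (∀ z, z < y → ∃ i, i < k ∧ C z i) ∧
    (∀ z i i', z < y → C z i → C z i' → i = i')

/-- FRT¹_k(Σ_m): every Σ_m-definable `k`-coloring of some `[0,y)` has an M-finite
homogeneous set of cardinality `x`, for every `x`. -/
def FRT1 (m : ℕ) (k : M) : Prop :=
  ∀ x : M, ∃ y : M, ∀ C : M → M → Prop, IsColoring1 M m y k C →
    ∃ (c : M) (H : Set M), CodesFinset c H x ∧ (∀ z ∈ H, z < y) ∧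
      ∃ i, ∀ z ∈ H, C z i

/-- fairFRT¹_k(Σ_m). -/
def FairFRT1 (m : ℕ) (k : M) : Prop :=
  ∀ x : M, ∃ y : M, ∀ C : M → M → Prop, IsColoring1 M m y k C →
    ∃ H : M → M → Prop, SigmaInjRel M m H x y ∧
      ∃ i, ∀ u v, u < x → H u v → C v i

end Principles

section Approx

variable {M : Type} [lang.Structure M]

/-- `f` is (the graph of) a partial function. -/
def IsPartialFun (f : M → M → Prop) : Prop := ∀ x y y', f x y → f x y' → y = y'

/-- `s` codes an approximation to the partial function `f` of length `b`. -/
def IsApprox (f : M → M → Prop) (s b : M) : Prop :=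
  (∀ i, i < b → ∃ v, SeqAt s i v) ∧
    (∀ i u v x y, i + 1 < b → SeqAt s i u → SeqAt s (i + 1) v → x ≤ u → f x y → y ≤ v)

/-- `s` codes a `g`-stretched approximation to the partial function `f` of length `b`. -/
def IsStretchedApprox (f g : M → M → Prop) (s b : M) : Prop :=
  (∀ i, i < b → ∃ v, SeqAt s i v) ∧
    (∀ i u w v x y, i + 1 < b → SeqAt s i u → g u w → SeqAt s (i + 1) v →
      x ≤ w → f x y → y ≤ v)

/-- The eventual (limit) value of `fun s => h s ·` is `x`. -/
def EvLim (h : M → M → Prop) (x : M) : Prop := ∃ s : M, ∀ t, s < t → h t x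

end Approx

/-- PΣ_m: every partial Σ_m-definable function admits approximations of every length. -/
def PSig (m : ℕ) (M : Type) [lang.Structure M] : Prop :=
  ∀ f : M → M → Prop, SigmaDef2 m M f → IsPartialFun f → ∀ b : M, ∃ s, IsApprox f s b

section Extensions

variable (M N : Type) [lang.Structure M] [lang.Structure N]

/-- `g : M → N` is Σ_m-elementary: Σ_m formulas with parameters from `M` transfer. -/
def SigmaElem (m : ℕ) (g : M → N) : Prop :=
  ∀ (p : ℕ) (φ : lang.BoundedFormula (Fin p) 0), SigmaFm m 0 φ →
    ∀ v : Fin p → M, (φ.Realize v finZeroElim ↔ φ.Realize (g ∘ v) finZeroElim)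

/-- The extension `g : M → N` is cofinal. -/
def Cofinal (g : M → N) : Prop := ∀ z : N, ∃ x : M, z ≤ g x

/-- `[0,a]^M = [0,a]^N`: every element of `N` below `g a` comes from `M`. -/
def SameBelow (g : M → N) (a : M) : Prop := ∀ z : N, z ≤ g a → ∃ x : M, g x = z

end Extensions

section Ramsey

variable {M : Type} [lang.Structure M]

/-- `f` is an M-coded `k`-coloring of `[y]^e` (assigning colors to codes of
`e`-subsets of `[0,y)`, independently of the code). -/
def CodedColoring (f e y k : M) : Prop :=
  (∀ d D, CodesTupleIn d e y D → ∃ i, i < k ∧ SeqAt f d i) ∧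
    (∀ d d' D i i', CodesTupleIn d e y D → CodesTupleIn d' e y D →
      SeqAt f d i → SeqAt f d' i' → i = i')

/-- The coded coloring `f` of `[y]^e` has an M-coded homogeneous set of cardinality `x`. -/
def CodedHomog (f e y x : M) : Prop :=
  ∃ (c : M) (H : Set M), CodesFinset c H x ∧ (∀ z ∈ H, z < y) ∧
    ∃ i, ∀ d D, CodesFinset d D e → D ⊆ H → SeqAt f d i

/-- `y = r(x, e, k)`: `y` is the least size guaranteeing coded homogeneous sets of
cardinality `x` for all coded `k`-colorings of `e`-subsets. -/
def IsRamsey (x e k y : M) : Prop :=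
  (∀ f, CodedColoring f e y k → CodedHomog f e y x) ∧
    (∀ y', y' < y → ∃ f, CodedColoring f e y' k ∧ ¬CodedHomog f e y' x)

/-- `y = r^(b)(x, e, k)`: the `b`-th iterate of the Ramsey function inside `M`. -/
def IterRamsey (x e k b y : M) : Prop :=
  ∃ s : M, SeqAt s 0 x ∧ SeqAt s b y ∧ (∀ i, i ≤ b → ∃ u, SeqAt s i u) ∧
    (∀ i u v, i < b → SeqAt s i u → SeqAt s (i + 1) v → IsRamsey u e k v)

end Ramsey

end ArithFC

section
open FirstOrder Language
namespace ArithFC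

/-- A structure satisfying PA⁻, as a class. -/
class PAM (M : Type) [lang.Structure M] : Prop where
  out : PAm M

section PAMAlg
variable {M : Type} [lang.Structure M] [PAM M]

noncomputable instance (priority := 50) instLinM : LinearOrder M where
  le := fun x y => x < y ∨ x = y
  lt := fun x y => x < y
  le_refl x := Or.inr rfl
  le_trans x y z h1 h2 := by
    rcases h1 with h1 | rfl
    · rcases h2 with h2 | rfl
      · exact Or.inl (PAM.out.lt_trans _ _ _ h1 h2)
      · exact Or.inl h1
    · exact h2
  lt_iff_le_not_ge x y := by
    constructor
    · intro h
      refine ⟨Or.inl h, ?_⟩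
      rintro (h2 | rfl)
      · exact PAM.out.lt_irrefl _ (PAM.out.lt_trans _ _ _ h h2)
      · exact PAM.out.lt_irrefl _ h
    · rintro ⟨h | rfl, h2⟩
      · exact h
      · exact absurd (Or.inr rfl) h2
  le_antisymm x y h1 h2 := by
    rcases h1 with h1 | rfl
    · rcases h2 with h2 | rfl
      · exact absurd (PAM.out.lt_trans _ _ _ h1 h2) (PAM.out.lt_irrefl _)
      · rfl
    · rfl
  le_total x y := by
    rcases PAM.out.lt_total x y with h | h | h
    · exact Or.inl (Or.inl h)
    · exact Or.inl (Or.inr h)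
    · exact Or.inr (Or.inl h)
  toDecidableLE := Classical.decRel _

noncomputable instance (priority := 50) instSemiM : CommSemiring M where
  add := (· + ·)
  mul := (· * ·)
  zero := 0
  one := 1
  add_assoc := PAM.out.add_assoc
  add_comm := PAM.out.add_comm
  zero_add x := by rw [PAM.out.add_comm]; exact PAM.out.add_zero x
  add_zero := PAM.out.add_zero
  nsmul := nsmulRec
  mul_assoc := PAM.out.mul_assoc
  mul_comm := PAM.out.mul_comm
  one_mul x := by rw [PAM.out.mul_comm]; exact PAM.out.mul_one x
  mul_one := PAM.out.mul_one
  left_distrib := PAM.out.ldistrib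
  right_distrib x y z := by
    rw [PAM.out.mul_comm, PAM.out.ldistrib, PAM.out.mul_comm z x, PAM.out.mul_comm z y]
  zero_mul x := by rw [PAM.out.mul_comm]; exact PAM.out.mul_zero x
  mul_zero := PAM.out.mul_zero

instance (priority := 50) instSOR : IsStrictOrderedRing M where
  add_le_add_left x y h z := by
    rcases h with h | rfl
    · exact Or.inl (PAM.out.add_lt_add x y z h)
    · exact le_rfl
  le_of_add_le_add_left x y z h := by
    by_contra hc
    rw [not_le] at hc
    have h1 : z + x < y + x := PAM.out.add_lt_add z y x hc
    rw [add_comm z x, add_comm y x] at h1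
    exact absurd h (not_le.mpr h1)
  zero_le_one := Or.inl PAM.out.zero_lt_one
  exists_pair_ne := ⟨0, 1, ne_of_lt PAM.out.zero_lt_one⟩
  mul_lt_mul_of_pos_left x hx y z h := by
    have h1 : y * x < z * x := PAM.out.mul_lt_mul y z x h hx
    show x * y < x * z
    rwa [mul_comm x y, mul_comm x z]
  mul_lt_mul_of_pos_right x hx y z h := PAM.out.mul_lt_mul y z x h hx

instance (priority := 50) instCOA : CanonicallyOrderedAdd M where
  exists_add_of_le {x y} h := by
    rcases h with h | rfl
    · obtain ⟨z, hz⟩ := PAM.out.sub_exists _ _ h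
      exact ⟨z, hz.symm⟩
    · exact ⟨0, (add_zero _).symm⟩
  le_self_add x y := by
    have h : (0 : M) ≤ y := PAM.out.zero_le y
    calc x = x + 0 := (add_zero x).symm
      _ ≤ x + y := by gcongr
  le_add_self x y := by
    have h : (0 : M) ≤ y := PAM.out.zero_le y
    calc x = 0 + x := (zero_add x).symm
      _ ≤ y + x := by gcongr

theorem ltS {x y : M} : x < y + 1 ↔ x ≤ y := by
  constructor
  · intro h
    by_contra hc
    rw [not_le] at hc
    obtain ⟨z, rfl⟩ := exists_add_of_le hc.le
    have hz : 0 < z := by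
      rcases eq_or_lt_of_le (zero_le (a := z)) with h0 | h0
      · rw [← h0, add_zero] at hc; exact absurd hc (lt_irrefl _)
      · exact h0
    have h1 : (1 : M) ≤ z := PAM.out.discrete z hz
    exact absurd h (not_lt.mpr (by gcongr))
  · intro h
    exact lt_of_le_of_lt h (lt_add_one y)

theorem Sle {x y : M} : x + 1 ≤ y ↔ x < y := by
  rw [← not_lt, ltS, not_le]

theorem zero_or_succ (x : M) : x = 0 ∨ ∃ y, x = y + 1 := by
  rcases eq_or_lt_of_le (zero_le (a := x)) with h | h
  · exact Or.inl h.symm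
  · right
    have h1 : (1 : M) ≤ x := PAM.out.discrete x h
    obtain ⟨y, hy⟩ := exists_add_of_le h1
    exact ⟨y, by rw [hy, add_comm]⟩

theorem not_lt_zero'' (x : M) : ¬ x < 0 := not_lt.mpr (zero_le (a := x))

end PAMAlg
end ArithFC

end

section
open FirstOrder Language
namespace ArithFC

section FmLevel
variable {α β : Type}

theorem realize_ltFm {M : Type} [lang.Structure M] {n : ℕ} (t u : lang.Term (α ⊕ Fin n))
    (v : α → M) (xs : Fin n → M) :
    (ltFm t u).Realize v xs ↔ t.realize (Sum.elim v xs) < u.realize (Sum.elim v xs) := by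
  show Structure.RelMap (L := lang) Rel.lt _ ↔ Structure.RelMap (L := lang) Rel.lt _
  have : (fun i => Term.realize (Sum.elim v xs) (![t, u] i)) =
      ![t.realize (Sum.elim v xs), u.realize (Sum.elim v xs)] := by
    ext i; fin_cases i <;> rfl
  rw [this]

theorem realize_lift1 {M : Type} [lang.Structure M] {n : ℕ} (t : lang.Term (α ⊕ Fin n))
    (v : α → M) (xs : Fin (n + 1) → M) :
    (t.liftAt 1 n).realize (Sum.elim v xs)
      = t.realize (Sum.elim v (fun i => xs i.castSucc)) := by
  rw [Term.realize_liftAt]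
  congr 1
  ext (a | i)
  · rfl
  · simp
    rfl

theorem realize_bdAll {M : Type} [lang.Structure M] {n : ℕ} (t : lang.Term (α ⊕ Fin n))
    (φ : lang.BoundedFormula α (n + 1)) (v : α → M) (xs : Fin n → M) :
    (BoundedFormula.all ((ltFm (Term.var (Sum.inr (Fin.last n))) (t.liftAt 1 n)).imp φ)).Realize
      v xs ↔ ∀ x, x < t.realize (Sum.elim v xs) → φ.Realize v (Fin.snoc xs x) := by
  rw [BoundedFormula.realize_all]
  refine forall_congr' fun x => ?_
  rw [BoundedFormula.realize_imp, realize_ltFm, realize_lift1]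
  simp

/-- lift a term by one bound variable -/
def tlift {n : ℕ} (t : lang.Term (α ⊕ Fin n)) : lang.Term (α ⊕ Fin (n + 1)) :=
  t.relabel (Sum.map id Fin.castSucc)

theorem realize_tlift {M : Type} [lang.Structure M] {n : ℕ} (t : lang.Term (α ⊕ Fin n))
    (v : α → M) (xs : Fin n → M) (x : M) :
    (tlift t).realize (Sum.elim v (Fin.snoc xs x : Fin (n + 1) → M)) =
      t.realize (Sum.elim v xs) := by
  unfold tlift
  rw [Term.realize_relabel]
  congr 1
  ext (a | i) <;> simp

/-- a substitution lifted under a quantifier -/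
def slift {n m : ℕ} (σ : α ⊕ Fin n → lang.Term (β ⊕ Fin m)) :
    α ⊕ Fin (n + 1) → lang.Term (β ⊕ Fin (m + 1))
  | Sum.inl a => tlift (σ (Sum.inl a))
  | Sum.inr i => Fin.lastCases (motive := fun _ => lang.Term (β ⊕ Fin (m + 1)))
      (Term.var (Sum.inr (Fin.last m))) (fun i => tlift (σ (Sum.inr i))) i

/-- φ' is the substitution instance of φ by σ -/
def IsSubst {n m : ℕ} (σ : α ⊕ Fin n → lang.Term (β ⊕ Fin m)) (φ : lang.BoundedFormula α n)
    (φ' : lang.BoundedFormula β m) : Prop :=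
  ∀ (M : Type) [lang.Structure M] (v : β → M) (xs : Fin m → M),
    φ'.Realize v xs ↔ φ.Realize (fun a => (σ (Sum.inl a)).realize (Sum.elim v xs))
      (fun i => (σ (Sum.inr i)).realize (Sum.elim v xs))

theorem IsSubst.under {n m : ℕ} {σ : α ⊕ Fin n → lang.Term (β ⊕ Fin m)}
    {φ : lang.BoundedFormula α (n + 1)} {φ' : lang.BoundedFormula β (m + 1)}
    (h : IsSubst (slift σ) φ φ') (M : Type) [lang.Structure M] (v : β → M) (xs : Fin m → M)
    (x : M) : φ'.Realize v (Fin.snoc xs x) ↔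
      φ.Realize (fun a => (σ (Sum.inl a)).realize (Sum.elim v xs))
      (Fin.snoc (fun i => (σ (Sum.inr i)).realize (Sum.elim v xs)) x) := by
  rw [h]
  have e1 : (fun a => (slift σ (Sum.inl a)).realize (Sum.elim v (Fin.snoc xs x : Fin (m + 1) → M)))
      = (fun a => (σ (Sum.inl a)).realize (Sum.elim v xs)) := by
    ext a; exact realize_tlift _ _ _ _
  have e2 : (fun i => (slift σ (Sum.inr i)).realize (Sum.elim v (Fin.snoc xs x : Fin (m + 1) → M)))
      = Fin.snoc (fun i => (σ (Sum.inr i)).realize (Sum.elim v xs)) x := by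
    ext i
    refine Fin.lastCases ?_ (fun i => ?_) i
    · simp [slift]
    · simp only [slift, Fin.lastCases_castSucc, Fin.snoc_castSucc]
      exact realize_tlift _ _ _ _
  rw [e1, e2]

theorem realize_subst' {M : Type} [lang.Structure M] {n m : ℕ}
    (σ : α ⊕ Fin n → lang.Term (β ⊕ Fin m)) (t : lang.Term (α ⊕ Fin n))
    (v : β → M) (xs : Fin m → M) :
    (t.subst σ).realize (Sum.elim v xs) =
      t.realize (Sum.elim (fun a => (σ (Sum.inl a)).realize (Sum.elim v xs))
        (fun i => (σ (Sum.inr i)).realize (Sum.elim v xs))) := by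
  rw [Term.realize_subst]
  congr 1
  ext (a | i) <;> rfl

theorem IsDelta0.subst {n : ℕ} {φ : lang.BoundedFormula α n} (h : IsDelta0 n φ) :
    ∀ {m : ℕ} (σ : α ⊕ Fin n → lang.Term (β ⊕ Fin m)),
      ∃ φ' : lang.BoundedFormula β m, IsDelta0 m φ' ∧ IsSubst σ φ φ' := by
  induction h with
  | falsum n => intro m σ; exact ⟨_, .falsum m, fun M _ v xs => Iff.rfl⟩
  | equal n t u =>
    intro m σ
    refine ⟨_, .equal m (t.subst σ) (u.subst σ), fun M _ v xs => ?_⟩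
    show (t.subst σ).realize _ = (u.subst σ).realize _ ↔ t.realize _ = u.realize _
    rw [realize_subst', realize_subst']
  | rel n l R ts =>
    intro m σ
    refine ⟨_, .rel m l R (fun i => (ts i).subst σ), fun M _ v xs => ?_⟩
    show Structure.RelMap R _ ↔ Structure.RelMap R _
    simp only [realize_subst']
  | imp n _ _ ih1 ih2 =>
    intro m σ
    obtain ⟨φ1, h1, e1⟩ := ih1 σ
    obtain ⟨φ2, h2, e2⟩ := ih2 σ
    refine ⟨_, .imp m h1 h2, fun M _ v xs => ?_⟩
    rw [BoundedFormula.realize_imp, BoundedFormula.realize_imp, e1, e2]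
  | bdAll n t _ ih =>
    intro m σ
    obtain ⟨φ1, h1, e1⟩ := ih (slift σ)
    refine ⟨_, .bdAll m (t.subst σ) h1, fun M _ v xs => ?_⟩
    rw [realize_bdAll, realize_bdAll, realize_subst']
    exact forall_congr' fun x => imp_congr Iff.rfl (e1.under M v xs x)

theorem hier_ind {P Q : ∀ (r n : ℕ), lang.BoundedFormula α n → Prop}
    (h1 : ∀ r n φ, IsDelta0 n φ → P r n φ) (h2 : ∀ r n φ, Q r n φ → P (r + 1) n φ)
    (h3 : ∀ r n (φ : lang.BoundedFormula α (n + 1)), P (r + 1) (n + 1) φ → P (r + 1) n φ.ex)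
    (h4 : ∀ r n φ, IsDelta0 n φ → Q r n φ) (h5 : ∀ r n φ, P r n φ → Q (r + 1) n φ)
    (h6 : ∀ r n (φ : lang.BoundedFormula α (n + 1)), Q (r + 1) (n + 1) φ → Q (r + 1) n φ.all) :
    (∀ r n φ, SigmaFm r n φ → P r n φ) ∧ (∀ r n φ, PiFm r n φ → Q r n φ) :=
  ⟨fun _ _ _ h => SigmaFm.rec (motive_1 := fun r n φ _ => P r n φ)
      (motive_2 := fun r n φ _ => Q r n φ) (fun r n φ h => h1 r n φ h) (fun r n φ _ h => h2 r n φ h)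
      (fun r n φ _ h => h3 r n φ h) (fun r n φ h => h4 r n φ h) (fun r n φ _ h => h5 r n φ h)
      (fun r n φ _ h => h6 r n φ h) h,
    fun _ _ _ h => PiFm.rec (motive_1 := fun r n φ _ => P r n φ)
      (motive_2 := fun r n φ _ => Q r n φ) (fun r n φ h => h1 r n φ h) (fun r n φ _ h => h2 r n φ h)
      (fun r n φ _ h => h3 r n φ h) (fun r n φ h => h4 r n φ h) (fun r n φ _ h => h5 r n φ h)
      (fun r n φ _ h => h6 r n φ h) h⟩

theorem hier_subst :
    (∀ r n (φ : lang.BoundedFormula α n), SigmaFm r n φ → ∀ {m : ℕ}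
      (σ : α ⊕ Fin n → lang.Term (β ⊕ Fin m)),
        ∃ φ' : lang.BoundedFormula β m, SigmaFm r m φ' ∧ IsSubst σ φ φ') ∧
    (∀ r n (φ : lang.BoundedFormula α n), PiFm r n φ → ∀ {m : ℕ}
      (σ : α ⊕ Fin n → lang.Term (β ⊕ Fin m)),
        ∃ φ' : lang.BoundedFormula β m, PiFm r m φ' ∧ IsSubst σ φ φ') := by
  apply hier_ind
  · intro r n φ h m σ
    obtain ⟨φ', h1, h2⟩ := h.subst σ
    exact ⟨φ', .delta0 _ _ h1, h2⟩
  · intro r n φ h m σ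
    obtain ⟨φ', h1, h2⟩ := h σ
    exact ⟨φ', .ofPi _ _ h1, h2⟩
  · intro r n φ h m σ
    obtain ⟨φ', h1, h2⟩ := h (slift σ)
    refine ⟨_, .ex _ _ h1, fun M _ v xs => ?_⟩
    rw [BoundedFormula.realize_ex, BoundedFormula.realize_ex]
    exact exists_congr fun x => h2.under M v xs x
  · intro r n φ h m σ
    obtain ⟨φ', h1, h2⟩ := h.subst σ
    exact ⟨φ', .delta0 _ _ h1, h2⟩
  · intro r n φ h m σ
    obtain ⟨φ', h1, h2⟩ := h σ
    exact ⟨φ', .ofSigma _ _ h1, h2⟩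
  · intro r n φ h m σ
    obtain ⟨φ', h1, h2⟩ := h (slift σ)
    refine ⟨_, .all _ _ h1, fun M _ v xs => ?_⟩
    rw [BoundedFormula.realize_all, BoundedFormula.realize_all]
    exact forall_congr' fun x => h2.under M v xs x

theorem SigmaFm.subst {r n : ℕ} {φ : lang.BoundedFormula α n} (h : SigmaFm r n φ)
    {m : ℕ} (σ : α ⊕ Fin n → lang.Term (β ⊕ Fin m)) :
      ∃ φ' : lang.BoundedFormula β m, SigmaFm r m φ' ∧ IsSubst σ φ φ' :=
  hier_subst.1 r n φ h σ

theorem IsDelta0.not {n : ℕ} {φ : lang.BoundedFormula α n} (h : IsDelta0 n φ) :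
    IsDelta0 n φ.not := .imp n h (.falsum n)

/-- φ' is equivalent to the negation of φ -/
def IsNeg {n : ℕ} (φ φ' : lang.BoundedFormula α n) : Prop :=
  ∀ (M : Type) [lang.Structure M] (v : α → M) (xs : Fin n → M),
    φ'.Realize v xs ↔ ¬ φ.Realize v xs

theorem hier_neg :
    (∀ r n (φ : lang.BoundedFormula α n), SigmaFm r n φ →
        ∃ φ' : lang.BoundedFormula α n, PiFm r n φ' ∧ IsNeg φ φ') ∧
    (∀ r n (φ : lang.BoundedFormula α n), PiFm r n φ →
        ∃ φ' : lang.BoundedFormula α n, SigmaFm r n φ' ∧ IsNeg φ φ') := by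
  apply hier_ind
  · intro r n φ h
    exact ⟨_, .delta0 _ _ h.not, fun M _ v xs => by simp⟩
  · intro r n φ h
    obtain ⟨φ', h1, h2⟩ := h
    exact ⟨φ', .ofSigma _ _ h1, h2⟩
  · intro r n φ h
    obtain ⟨φ', h1, h2⟩ := h
    refine ⟨_, .all _ _ h1, fun M _ v xs => ?_⟩
    rw [BoundedFormula.realize_ex, BoundedFormula.realize_all, not_exists]
    exact forall_congr' fun x => h2 M v _
  · intro r n φ h
    exact ⟨_, .delta0 _ _ h.not, fun M _ v xs => by simp⟩
  · intro r n φ h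
    obtain ⟨φ', h1, h2⟩ := h
    exact ⟨φ', .ofPi _ _ h1, h2⟩
  · intro r n φ h
    obtain ⟨φ', h1, h2⟩ := h
    refine ⟨_, .ex _ _ h1, fun M _ v xs => ?_⟩
    rw [BoundedFormula.realize_ex, BoundedFormula.realize_all, not_forall]
    exact exists_congr fun x => h2 M v _

theorem hier_up :
    (∀ r n (φ : lang.BoundedFormula α n), SigmaFm r n φ → SigmaFm (r + 1) n φ) ∧
    (∀ r n (φ : lang.BoundedFormula α n), PiFm r n φ → PiFm (r + 1) n φ) := by
  apply hier_ind
  · intro r n φ h; exact .delta0 _ _ h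
  · intro r n φ h; exact .ofPi _ _ h
  · intro r n φ h; exact .ex _ _ h
  · intro r n φ h; exact .delta0 _ _ h
  · intro r n φ h; exact .ofSigma _ _ h
  · intro r n φ h; exact .all _ _ h

theorem SigmaFm.mono {r s n : ℕ} {φ : lang.BoundedFormula α n} (h : SigmaFm r n φ)
    (hs : r ≤ s) : SigmaFm s n φ := by
  induction hs with
  | refl => exact h
  | step _ ih => exact hier_up.1 _ _ _ ih

theorem SigmaFm.toDelta0 {n : ℕ} {φ : lang.BoundedFormula α n} (h : SigmaFm 0 n φ) :
    IsDelta0 n φ := by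
  cases h with
  | delta0 _ _ h => exact h

/-- finitely many free variables matter -/
theorem finSupp {n : ℕ} (φ : lang.BoundedFormula α n) : ∃ s : Finset α,
    ∀ (M : Type) [lang.Structure M] (v v' : α → M) (xs : Fin n → M),
      (∀ a ∈ s, v a = v' a) → (φ.Realize v xs ↔ φ.Realize v' xs) := by
  classical
  have ht : ∀ {n : ℕ} (t : lang.Term (α ⊕ Fin n)), ∃ s : Finset α,
      ∀ (M : Type) [lang.Structure M] (v v' : α → M) (xs : Fin n → M),
      (∀ a ∈ s, v a = v' a) → t.realize (Sum.elim v xs) = t.realize (Sum.elim v' xs) := by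
    intro n t
    induction t with
    | var x =>
      rcases x with a | i
      · exact ⟨{a}, fun M _ v v' xs h => by simpa using h⟩
      · exact ⟨∅, fun M _ v v' xs h => rfl⟩
    | func f ts ih =>
      choose s hs using ih
      refine ⟨Finset.univ.biUnion s, fun M _ v v' xs h => ?_⟩
      simp only [Term.realize_func]
      congr 1
      ext i
      exact hs i M v v' xs fun a ha => h a (Finset.mem_biUnion.mpr ⟨i, Finset.mem_univ _, ha⟩)
  induction φ with
  | falsum => exact ⟨∅, fun M _ v v' xs h => Iff.rfl⟩
  | equal t u =>
    obtain ⟨s1, h1⟩ := ht t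
    obtain ⟨s2, h2⟩ := ht u
    refine ⟨s1 ∪ s2, fun M _ v v' xs h => ?_⟩
    show t.realize _ = u.realize _ ↔ t.realize _ = u.realize _
    rw [h1 M v v' xs fun a ha => h a (Finset.mem_union_left _ ha),
      h2 M v v' xs fun a ha => h a (Finset.mem_union_right _ ha)]
  | rel R ts =>
    choose s hs using fun i => ht (ts i)
    refine ⟨Finset.univ.biUnion s, fun M _ v v' xs h => ?_⟩
    show Structure.RelMap R _ ↔ Structure.RelMap R _
    have : (fun i => Term.realize (Sum.elim v xs) (ts i)) =
        fun i => Term.realize (Sum.elim v' xs) (ts i) := by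
      ext i
      exact hs i M v v' xs fun a ha => h a (Finset.mem_biUnion.mpr ⟨i, Finset.mem_univ _, ha⟩)
    rw [this]
  | imp _ _ ih1 ih2 =>
    obtain ⟨s1, h1⟩ := ih1
    obtain ⟨s2, h2⟩ := ih2
    refine ⟨s1 ∪ s2, fun M _ v v' xs h => ?_⟩
    rw [BoundedFormula.realize_imp, BoundedFormula.realize_imp,
      h1 M v v' xs fun a ha => h a (Finset.mem_union_left _ ha),
      h2 M v v' xs fun a ha => h a (Finset.mem_union_right _ ha)]
  | all _ ih =>
    obtain ⟨s1, h1⟩ := ih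
    refine ⟨s1, fun M _ v v' xs h => ?_⟩
    rw [BoundedFormula.realize_all, BoundedFormula.realize_all]
    exact forall_congr' fun x => h1 M v v' _ h

/-- Definability by a formula with parameters from `M` as free variables. -/
theorem isSigmaDef_of_fm {r k : ℕ} {M : Type} [lang.Structure M]
    {φ : lang.BoundedFormula M k} (h : SigmaFm r k φ) :
    IsSigmaDef r M (fun v : Fin k → M => φ.Realize id v) := by
  classical
  obtain ⟨s, hs⟩ := finSupp φ
  obtain ⟨φ', h1, h2⟩ := h.subst (β := Fin k ⊕ Fin (s.card + 1)) (m := 0)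
    (Sum.elim (fun a => Term.var (Sum.inl (Sum.inr
      (if ha : a ∈ s then (s.equivFin ⟨a, ha⟩).castSucc else Fin.last _))))
      (fun i => Term.var (Sum.inl (Sum.inl i))))
  refine ⟨s.card + 1, φ', fun i => if hi : i.val < s.card then (s.equivFin.symm ⟨i, hi⟩ : M) else 0,
    h1, fun v => ?_⟩
  rw [h2]
  simp only [Sum.elim_inl, Term.realize_var, Sum.elim_inr]
  apply hs
  intro a ha
  simp [ha]

theorem fm_of_isSigmaDef {r k : ℕ} {M : Type} [lang.Structure M]
    {R : (Fin k → M) → Prop} (h : IsSigmaDef r M R) :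
    ∃ φ : lang.BoundedFormula M k, SigmaFm r k φ ∧ ∀ v, R v ↔ φ.Realize id v := by
  obtain ⟨p, φ, w, h1, h2⟩ := h
  obtain ⟨φ', h3, h4⟩ := h1.subst (β := M) (m := k)
    (Sum.elim (Sum.elim (fun i => Term.var (Sum.inr i)) (fun i => Term.var (Sum.inl (w i))))
      finZeroElim)
  refine ⟨φ', h3, fun v => ?_⟩
  rw [h2, h4]
  have e1 : (Sum.elim v w) = (fun a => Term.realize (Sum.elim id v) ((Sum.elim
      (Sum.elim (fun i => Term.var (Sum.inr i)) (fun i => Term.var (Sum.inl (w i))))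
      finZeroElim : (Fin k ⊕ Fin p) ⊕ Fin 0 → lang.Term (M ⊕ Fin k)) (Sum.inl a))) := by
    ext (a | a) <;> simp
  rw [← e1]
  have : (finZeroElim : Fin 0 → M) = (fun i => Term.realize (Sum.elim id v) ((Sum.elim
      (Sum.elim (fun i => Term.var (Sum.inr i)) (fun i => Term.var (Sum.inl (w i))))
      finZeroElim : (Fin k ⊕ Fin p) ⊕ Fin 0 → lang.Term (M ⊕ Fin k)) (Sum.inr i))) := by
    ext i; exact i.elim0
  rw [← this]

end FmLevel
end ArithFC

end

section
set_option linter.all false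
open FirstOrder Language
namespace ArithFC

/-- Models of PA⁻ + IΣ₁. -/
class AR (M : Type) [lang.Structure M] : Prop extends PAM M where
  isig1 : ISig 1 M

/-- Bundled models of PA⁻ + IΣ₁. -/
structure Mod where
  carrier : Type
  str : lang.Structure carrier
  ar : AR carrier

instance : CoeSort Mod Type := ⟨Mod.carrier⟩
instance (M : Mod) : lang.Structure M := M.str
instance (M : Mod) : AR M := M.ar

/-- uniform relations -/
abbrev URel (k : ℕ) := ∀ M : Mod, (Fin k → M) → Prop
/-- uniform functions -/
abbrev UFun (k : ℕ) := ∀ M : Mod, (Fin k → M) → M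

/-- uniformly Δ₀ relations -/
class D0 {k : ℕ} (R : URel k) : Prop where
  out : ∃ φ : lang.BoundedFormula Empty k, IsDelta0 k φ ∧ ∀ M v, R M v ↔ φ.Realize Empty.elim v

/-- uniformly Δ₀ functions bounded by a term -/
class DF {k : ℕ} (f : UFun k) : Prop where
  bd : ∃ t : lang.Term (Empty ⊕ Fin k), ∀ M v, f M v ≤ t.realize (Sum.elim Empty.elim v)
  graph : D0 (fun M (w : Fin (k + 1) → M) => w (Fin.last k) = f M (fun i => w i.castSucc))

section
variable {M : Type} [lang.Structure M]
/-- locally Δ₀ relations in a model -/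
class LD {k : ℕ} (R : (Fin k → M) → Prop) : Prop where
  out : ∀ u : M, ∃ φ : lang.BoundedFormula M k, IsDelta0 k φ ∧
    ∀ v, (∀ i, v i < u) → (R v ↔ φ.Realize id v)

/-- locally Δ₀, locally bounded functions -/
class LF {k : ℕ} (f : (Fin k → M) → M) : Prop where
  bd : ∀ u : M, ∃ b : M, ∀ v, (∀ i, v i < u) → f v < b
  graph : LD (fun w : Fin (k + 1) → M => w (Fin.last k) = f (fun i => w i.castSucc))
end

/-- term zero -/
def tZero {α : Type} : lang.Term α := Term.func (Func.zero : lang.Functions 0) ![]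
/-- term one -/
def tOne {α : Type} : lang.Term α := Term.func (Func.one : lang.Functions 0) ![]
/-- sum of terms -/
def tAdd {α : Type} (t u : lang.Term α) : lang.Term α :=
  Term.func (Func.add : lang.Functions 2) ![t, u]
/-- product of terms -/
def tMul {α : Type} (t u : lang.Term α) : lang.Term α :=
  Term.func (Func.mul : lang.Functions 2) ![t, u]

theorem realize_zero {α M : Type} [lang.Structure M] (v : α → M) :
    Term.realize v tZero = 0 :=
  congrArg (Structure.funMap (L := lang) (Func.zero : lang.Functions 0)) (Subsingleton.elim _ _)

theorem realize_one {α M : Type} [lang.Structure M] (v : α → M) :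
    Term.realize v tOne = 1 :=
  congrArg (Structure.funMap (L := lang) (Func.one : lang.Functions 0)) (Subsingleton.elim _ _)

theorem realize_add' {α M : Type} [lang.Structure M] (v : α → M) (ts : Fin 2 → lang.Term α) :
    Term.realize v (Term.func (Func.add : lang.Functions 2) ts)
      = (ts 0).realize v + (ts 1).realize v :=
  congrArg (Structure.funMap (L := lang) (Func.add : lang.Functions 2))
    (funext fun i => by fin_cases i <;> rfl)

theorem realize_mul' {α M : Type} [lang.Structure M] (v : α → M) (ts : Fin 2 → lang.Term α) :
    Term.realize v (Term.func (Func.mul : lang.Functions 2) ts)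
      = (ts 0).realize v * (ts 1).realize v :=
  congrArg (Structure.funMap (L := lang) (Func.mul : lang.Functions 2))
    (funext fun i => by fin_cases i <;> rfl)

theorem realize_add {α M : Type} [lang.Structure M] (v : α → M) (t u : lang.Term α) :
    Term.realize v (tAdd t u) = t.realize v + u.realize v := realize_add' v _

theorem realize_mul {α M : Type} [lang.Structure M] (v : α → M) (t u : lang.Term α) :
    Term.realize v (tMul t u) = t.realize v * u.realize v := realize_mul' v _

theorem term_mono {α M : Type} [lang.Structure M] [PAM M] (t : lang.Term α) (v w : α → M)
    (h : ∀ a, v a ≤ w a) : t.realize v ≤ t.realize w := by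
  induction t with
  | var a => exact h a
  | @func l f ts ih =>
    cases f with
    | zero =>
      exact le_of_eq (congrArg (Structure.funMap (L := lang) (Func.zero : lang.Functions 0))
        (Subsingleton.elim _ _))
    | one =>
      exact le_of_eq (congrArg (Structure.funMap (L := lang) (Func.one : lang.Functions 0))
        (Subsingleton.elim _ _))
    | add =>
      refine (le_of_eq (realize_add' v ts)).trans (le_trans ?_ (le_of_eq (realize_add' w ts).symm))
      exact add_le_add (ih 0) (ih 1)
    | mul =>
      refine (le_of_eq (realize_mul' v ts)).trans (le_trans ?_ (le_of_eq (realize_mul' w ts).symm))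
      exact mul_le_mul' (ih 0) (ih 1)

theorem snoc_init' {k : ℕ} {M : Type} (v : Fin k → M) (x : M) :
    (fun i : Fin k => (Fin.snoc v x : Fin (k + 1) → M) i.castSucc) = v := by
  ext i; simp

theorem append_last {k j : ℕ} {M : Type} (v : Fin k → M) (f : Fin (j + 1) → M) :
    (Fin.append v f : Fin (k + (j + 1)) → M)
      = Fin.snoc (Fin.append v (fun i => f i.castSucc)) (f (Fin.last j)) := by
  ext i
  refine Fin.lastCases ?_ (fun i => ?_) i
  · rw [Fin.snoc_last]
    exact Fin.append_right v f (Fin.last j)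
  · rw [Fin.snoc_castSucc]
    refine Fin.addCases (fun i => ?_) (fun i => ?_) i
    · rw [Fin.append_left]
      have : (Fin.castSucc (Fin.castAdd j i)) = (Fin.castAdd (j + 1) i : Fin (k + (j + 1))) := by
        ext; simp
      rw [this]
      exact Fin.append_left v f i
    · rw [Fin.append_right]
      have : (Fin.castSucc (Fin.natAdd k i)) = (Fin.natAdd k i.castSucc : Fin (k + (j + 1))) := by
        ext; simp
      rw [this]
      exact Fin.append_right v f i.castSucc

section D0base
variable {k : ℕ}

theorem D0.congr {R R' : URel k} (h : D0 R) (e : ∀ M v, R' M v ↔ R M v) : D0 R' := by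
  obtain ⟨φ, h1, h2⟩ := h
  exact ⟨φ, h1, fun M v => (e M v).trans (h2 M v)⟩

theorem D0.imp' {R S : URel k} (hR : D0 R) (hS : D0 S) : D0 (fun M v => R M v → S M v) := by
  obtain ⟨φ, h1, h2⟩ := hR
  obtain ⟨ψ, h3, h4⟩ := hS
  refine ⟨φ.imp ψ, .imp _ h1 h3, fun M v => ?_⟩
  rw [BoundedFormula.realize_imp, h2, h4]

theorem D0.false' : D0 (fun M (_ : Fin k → M) => False) :=
  ⟨_, .falsum k, fun _ _ => Iff.rfl⟩

theorem D0.vars {j : ℕ} {R : URel j} (h : D0 R) (σ : Fin j → Fin k) :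
    D0 (fun M v => R M (fun i => v (σ i))) := by
  obtain ⟨φ, h1, h2⟩ := h
  obtain ⟨φ', h3, h4⟩ := h1.subst (β := Empty) (m := k)
    (Sum.elim Empty.elim (fun i => Term.var (Sum.inr (σ i))))
  refine ⟨φ', h3, fun M v => ?_⟩
  rw [h2, h4]
  have : (Empty.elim : Empty → M) = (fun a => Term.realize (Sum.elim Empty.elim v)
    ((Sum.elim Empty.elim (fun i => Term.var (Sum.inr (σ i))) : Empty ⊕ Fin j →
      lang.Term (Empty ⊕ Fin k)) (Sum.inl a))) := by ext a; exact a.elim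
  rw [← this]
  rfl

theorem D0.bdAllT {R : URel (k + 1)} (h : D0 R) (t : lang.Term (Empty ⊕ Fin k)) :
    D0 (fun M v => ∀ x, x < t.realize (Sum.elim Empty.elim v) → R M (Fin.snoc v x)) := by
  obtain ⟨φ, h1, h2⟩ := h
  refine ⟨_, .bdAll _ t h1, fun M v => ?_⟩
  rw [realize_bdAll]
  exact forall_congr' fun x => imp_congr Iff.rfl (h2 _ _)

theorem D0.not' {R : URel k} (hR : D0 R) : D0 (fun M v => ¬ R M v) := hR.imp' D0.false'

theorem D0.and' {R S : URel k} (hR : D0 R) (hS : D0 S) : D0 (fun M v => R M v ∧ S M v) :=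
  (hR.imp' hS.not').not'.congr fun M v => by tauto

theorem D0.bdExT {R : URel (k + 1)} (h : D0 R) (t : lang.Term (Empty ⊕ Fin k)) :
    D0 (fun M v => ∃ x, x < t.realize (Sum.elim Empty.elim v) ∧ R M (Fin.snoc v x)) :=
  (h.not'.bdAllT t).not'.congr fun M v => by push Not; rfl

theorem D0.snocF {R : URel (k + 1)} {f : UFun k} (h : D0 R) (hf : DF f) :
    D0 (fun M v => R M (Fin.snoc v (f M v))) := by
  obtain ⟨t, ht⟩ := hf.bd
  refine ((hf.graph.and' h).bdExT (tAdd t tOne)).congr fun M v => ?_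
  rw [realize_add, realize_one]
  constructor
  · intro h
    exact ⟨f M v, ltS.mpr (ht M v), by simp, h⟩
  · rintro ⟨x, _, h1, h2⟩
    rw [snoc_init', Fin.snoc_last] at h1
    rwa [← h1]

theorem DF.vars {j : ℕ} {f : UFun j} (h : DF f) (σ : Fin j → Fin k) :
    DF (fun M v => f M (fun i => v (σ i))) where
  bd := by
    obtain ⟨t, ht⟩ := h.bd
    refine ⟨t.relabel (Sum.map id σ), fun M v => ?_⟩
    rw [Term.realize_relabel]
    refine (ht M _).trans (le_of_eq ?_)
    congr 1; ext (a | i)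
    · rfl
    · rfl
  graph := by
    refine (h.graph.vars (k := k + 1)
      (Fin.lastCases (motive := fun _ => Fin (k + 1)) (Fin.last k) (fun i => (σ i).castSucc))).congr
      fun M v => ?_
    simp

theorem D0.lt' : D0 (fun M (v : Fin 2 → M) => v 0 < v 1) :=
  ⟨ltFm (Term.var (Sum.inr 0)) (Term.var (Sum.inr 1)), .rel _ _ _ _,
    fun M v => by rw [realize_ltFm]; rfl⟩

theorem D0.termEq (t : lang.Term (Empty ⊕ Fin k)) : D0 (fun M (w : Fin (k + 1) → M) =>
    w (Fin.last k) = t.realize (Sum.elim Empty.elim (fun i => w i.castSucc))) := by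
  refine ⟨_, .equal _ (Term.var (Sum.inr (Fin.last k))) (t.liftAt 1 k), fun M v => ?_⟩
  show _ ↔ Term.realize _ _ = Term.realize _ _
  rw [realize_lift1]; rfl

theorem DF.term (t : lang.Term (Empty ⊕ Fin k)) :
    DF (fun M (v : Fin k → M) => t.realize (Sum.elim Empty.elim v)) :=
  ⟨⟨t, fun _ _ => le_rfl⟩, D0.termEq t⟩

instance DF.proj (i : Fin k) : DF (fun M (v : Fin k → M) => v i) :=
  DF.term (Term.var (Sum.inr i))

instance DF.zero : DF (fun M (_ : Fin k → M) => (0 : M)) := by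
  simpa only [realize_zero] using DF.term (k := k) tZero

instance DF.one : DF (fun M (_ : Fin k → M) => (1 : M)) := by
  simpa only [realize_one] using DF.term (k := k) tOne

theorem DF.add' : DF (fun M (v : Fin 2 → M) => v 0 + v 1) := by
  simpa only [realize_add, Term.realize_var, Sum.elim_inr] using DF.term (k := 2) (tAdd (Term.var (Sum.inr 0)) (Term.var (Sum.inr 1)))

theorem DF.mul' : DF (fun M (v : Fin 2 → M) => v 0 * v 1) := by
  simpa only [realize_mul, Term.realize_var, Sum.elim_inr] using DF.term (k := 2) (tMul (Term.var (Sum.inr 0)) (Term.var (Sum.inr 1)))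

theorem D0.eq' : D0 (fun M (v : Fin 2 → M) => v 0 = v 1) :=
  ⟨_, .equal _ (Term.var (Sum.inr 0)) (Term.var (Sum.inr 1)), fun M v => Iff.rfl⟩

theorem D0.bdExF {R : URel (k + 1)} {f : UFun k} (h : D0 R) (hf : DF f) :
    D0 (fun M v => ∃ x, x < f M v ∧ R M (Fin.snoc v x)) := by
  obtain ⟨t, ht⟩ := hf.bd
  have h1 : D0 (fun M (w : Fin (k + 1) → M) => w (Fin.last k) < f M (fun i => w i.castSucc)) := by
    have h2 : D0 (fun M (w : Fin (k + 2) → M) => w (Fin.castSucc (Fin.last k)) < w (Fin.last _)) :=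
      (D0.lt'.vars ![Fin.castSucc (Fin.last k), Fin.last _])
    exact (h2.snocF (hf.vars Fin.castSucc)).congr fun M v => by simp
  refine ((h1.and' h).bdExT t).congr fun M v => ?_
  constructor
  · rintro ⟨x, h1, h2⟩
    exact ⟨x, h1.trans_le (ht M v), by simpa using h1, h2⟩
  · rintro ⟨x, _, h1, h2⟩
    exact ⟨x, by simpa using h1, h2⟩

theorem D0.appendF {j : ℕ} : ∀ {R : URel (k + j)} {f : Fin j → UFun k}, D0 R → (∀ i, DF (f i)) →
    D0 (fun M v => R M (Fin.append v (fun i => f i M v))) := by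
  induction j with
  | zero =>
    intro R f hR hf
    refine hR.congr fun M v => ?_
    have : (Fin.append v (fun i => f i M v) : Fin (k + 0) → M) = v := by
      ext i; exact Fin.append_left v _ i
    rw [this]
  | succ j ih =>
    intro R f hR hf
    have h1 : D0 (k := k + j) (fun M w => R M (Fin.snoc w (f (Fin.last j) M
        (fun i => w (Fin.castAdd j i))))) :=
      D0.snocF (k := k + j) hR ((hf (Fin.last j)).vars (Fin.castAdd j))
    refine (ih (f := fun i => f i.castSucc) h1 (fun i => hf _)).congr fun M v => ?_
    rw [append_last]
    simp

theorem D0.substF {j : ℕ} {R : URel j} {f : Fin j → UFun k} (h : D0 R) (hf : ∀ i, DF (f i)) :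
    D0 (fun M v => R M (fun i => f i M v)) :=
  (D0.appendF (h.vars (Fin.natAdd k)) hf).congr fun M v => by simp

theorem DF.substF {j : ℕ} {g : UFun j} {f : Fin j → UFun k} (h : DF g) (hf : ∀ i, DF (f i)) :
    DF (fun M v => g M (fun i => f i M v)) where
  bd := by
    obtain ⟨t, ht⟩ := h.bd
    choose s hs using fun i => (hf i).bd
    refine ⟨t.subst (Sum.elim Empty.elim s), fun M v => ?_⟩
    rw [Term.realize_subst]
    refine (ht M _).trans (term_mono _ _ _ ?_)
    rintro (a | i)
    · exact a.elim
    · exact hs i M v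
  graph := by
    have := D0.substF (k := k + 1) (f := Fin.lastCases
      (motive := fun _ => UFun (k + 1)) (fun M v => v (Fin.last k))
      (fun i M v => f i M (fun i => v i.castSucc))) h.graph (fun i => by
        refine Fin.lastCases ?_ (fun i => ?_) i
        · simp only [Fin.lastCases_last]; infer_instance
        · simp only [Fin.lastCases_castSucc]; exact (hf i).vars Fin.castSucc)
    refine this.congr fun M v => ?_
    simp

end D0base

section LDbase
variable {M : Type} [lang.Structure M] [PAM M] {k : ℕ}

theorem LD.local {R : (Fin k → M) → Prop}
    (h : ∀ u : M, ∃ R', LD R' ∧ ∀ v, (∀ i, v i < u) → (R v ↔ R' v)) : LD R := by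
  refine ⟨fun u => ?_⟩
  obtain ⟨R', h1, h2⟩ := h u
  obtain ⟨φ, h3, h4⟩ := h1.out u
  exact ⟨φ, h3, fun v hv => (h2 v hv).trans (h4 v hv)⟩

theorem LD.congr {R R' : (Fin k → M) → Prop} (h : LD R) (e : ∀ v, R' v ↔ R v) : LD R' :=
  LD.local fun _ => ⟨R, h, fun v _ => e v⟩

theorem LD.imp' {R S : (Fin k → M) → Prop} (hR : LD R) (hS : LD S) : LD (fun v => R v → S v) := by
  refine ⟨fun u => ?_⟩
  obtain ⟨φ, h1, h2⟩ := hR.out u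
  obtain ⟨ψ, h3, h4⟩ := hS.out u
  refine ⟨φ.imp ψ, .imp _ h1 h3, fun v hv => ?_⟩
  rw [BoundedFormula.realize_imp, h2 v hv, h4 v hv]

theorem LD.false' : LD (fun (_ : Fin k → M) => False) :=
  ⟨fun _ => ⟨_, .falsum k, fun _ _ => Iff.rfl⟩⟩

theorem LD.vars {j : ℕ} {R : (Fin j → M) → Prop} (h : LD R) (σ : Fin j → Fin k) :
    LD (fun v => R (fun i => v (σ i))) := by
  refine ⟨fun u => ?_⟩
  obtain ⟨φ, h1, h2⟩ := h.out u
  obtain ⟨φ', h3, h4⟩ := h1.subst (β := M) (m := k)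
    (Sum.elim (fun a => Term.var (Sum.inl a)) (fun i => Term.var (Sum.inr (σ i))))
  refine ⟨φ', h3, fun v hv => ?_⟩
  rw [h2 _ (fun i => hv _), h4]
  rfl

theorem LD.bdAllC {R : (Fin (k + 1) → M) → Prop} (h : LD R) (c : M) :
    LD (fun v => ∀ x, x < c → R (Fin.snoc v x)) := by
  refine ⟨fun u => ?_⟩
  obtain ⟨φ, h1, h2⟩ := h.out (max u c)
  refine ⟨_, .bdAll _ (Term.var (Sum.inl c)) h1, fun v hv => ?_⟩
  rw [realize_bdAll]
  refine forall_congr' fun x => imp_congr_right fun hx => h2 _ fun i => ?_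
  refine Fin.lastCases ?_ (fun i => ?_) i
  · rw [Fin.snoc_last]; exact lt_max_of_lt_right hx
  · rw [Fin.snoc_castSucc]; exact lt_max_of_lt_left (hv i)

theorem LD.not' {R : (Fin k → M) → Prop} (hR : LD R) : LD (fun v => ¬ R v) := hR.imp' LD.false'

theorem LD.and' {R S : (Fin k → M) → Prop} (hR : LD R) (hS : LD S) : LD (fun v => R v ∧ S v) :=
  (hR.imp' hS.not').not'.congr fun v => by tauto

theorem LD.bdExC {R : (Fin (k + 1) → M) → Prop} (h : LD R) (c : M) :
    LD (fun v => ∃ x, x < c ∧ R (Fin.snoc v x)) :=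
  (h.not'.bdAllC c).not'.congr fun v => by push Not; rfl

theorem LD.snocF {R : (Fin (k + 1) → M) → Prop} {f : (Fin k → M) → M} (h : LD R) (hf : LF f) :
    LD (fun v => R (Fin.snoc v (f v))) := by
  refine LD.local fun u => ?_
  obtain ⟨b, hb⟩ := hf.bd u
  refine ⟨_, (hf.graph.and' h).bdExC b, fun v hv => ?_⟩
  constructor
  · intro h
    exact ⟨f v, hb v hv, by simp, h⟩
  · rintro ⟨x, _, h1, h2⟩
    rw [snoc_init', Fin.snoc_last] at h1
    rwa [← h1]

theorem LF.vars {j : ℕ} {f : (Fin j → M) → M} (h : LF f) (σ : Fin j → Fin k) :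
    LF (fun v => f (fun i => v (σ i))) where
  bd u := by
    obtain ⟨b, hb⟩ := h.bd u
    exact ⟨b, fun v hv => hb _ fun i => hv _⟩
  graph := by
    refine (h.graph.vars (k := k + 1)
      (Fin.lastCases (motive := fun _ => Fin (k + 1)) (Fin.last k) (fun i => (σ i).castSucc))).congr
      fun v => ?_
    simp

theorem LD.lt' : LD (fun (v : Fin 2 → M) => v 0 < v 1) :=
  ⟨fun _ => ⟨ltFm (Term.var (Sum.inr 0)) (Term.var (Sum.inr 1)), .rel _ _ _ _,
    fun v _ => by rw [realize_ltFm]; rfl⟩⟩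

theorem LF.term (t : lang.Term (M ⊕ Fin k)) :
    LF (fun (v : Fin k → M) => t.realize (Sum.elim id v)) where
  bd u := by
    refine ⟨t.realize (Sum.elim id (fun _ => u)) + 1, fun v hv => ltS.mpr (term_mono _ _ _ ?_)⟩
    rintro (a | i)
    · exact le_rfl
    · exact (hv i).le
  graph := by
    refine ⟨fun _ => ⟨_, .equal _ (Term.var (Sum.inr (Fin.last k))) (t.liftAt 1 k), fun v _ => ?_⟩⟩
    show _ ↔ Term.realize _ _ = Term.realize _ _
    rw [realize_lift1]; rfl

instance LF.proj (i : Fin k) : LF (fun (v : Fin k → M) => v i) :=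
  LF.term (Term.var (Sum.inr i))

instance LF.const (c : M) : LF (fun (_ : Fin k → M) => c) :=
  LF.term (k := k) (Term.var (Sum.inl c))

theorem LF.add' : LF (fun (v : Fin 2 → M) => v 0 + v 1) := by
  simpa only [realize_add, Term.realize_var, Sum.elim_inr] using LF.term (M := M) (k := 2)
    (tAdd (Term.var (Sum.inr 0)) (Term.var (Sum.inr 1)))

theorem LF.mul' : LF (fun (v : Fin 2 → M) => v 0 * v 1) := by
  simpa only [realize_mul, Term.realize_var, Sum.elim_inr] using LF.term (M := M) (k := 2)
    (tMul (Term.var (Sum.inr 0)) (Term.var (Sum.inr 1)))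

theorem LD.eq' : LD (fun (v : Fin 2 → M) => v 0 = v 1) :=
  ⟨fun _ => ⟨_, .equal _ (Term.var (Sum.inr 0)) (Term.var (Sum.inr 1)), fun v _ => Iff.rfl⟩⟩

theorem LD.bdExF {R : (Fin (k + 1) → M) → Prop} {f : (Fin k → M) → M} (h : LD R) (hf : LF f) :
    LD (fun v => ∃ x, x < f v ∧ R (Fin.snoc v x)) := by
  have h1 : LD (fun (w : Fin (k + 1) → M) => w (Fin.last k) < f (fun i => w i.castSucc)) := by
    have h2 : LD (fun (w : Fin (k + 2) → M) => w (Fin.castSucc (Fin.last k)) < w (Fin.last _)) :=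
      (LD.lt'.vars ![Fin.castSucc (Fin.last k), Fin.last _])
    exact (h2.snocF (hf.vars Fin.castSucc)).congr fun v => by simp
  refine LD.local fun u => ?_
  obtain ⟨b, hb⟩ := hf.bd u
  refine ⟨_, (h1.and' h).bdExC b, fun v hv => ?_⟩
  constructor
  · rintro ⟨x, h1, h2⟩
    exact ⟨x, h1.trans (hb v hv), by simpa using h1, h2⟩
  · rintro ⟨x, _, h1, h2⟩
    exact ⟨x, by simpa using h1, h2⟩

theorem LD.appendF {j : ℕ} : ∀ {R : (Fin (k + j) → M) → Prop} {f : Fin j → (Fin k → M) → M},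
    LD R → (∀ i, LF (f i)) → LD (fun v => R (Fin.append v (fun i => f i v))) := by
  induction j with
  | zero =>
    intro R f hR hf
    refine hR.congr fun v => ?_
    have : (Fin.append v (fun i => f i v) : Fin (k + 0) → M) = v := by
      ext i; exact Fin.append_left v _ i
    rw [this]
  | succ j ih =>
    intro R f hR hf
    have h1 : LD (k := k + j) (fun w => R (Fin.snoc w (f (Fin.last j)
        (fun i => w (Fin.castAdd j i))))) :=
      LD.snocF (k := k + j) hR ((hf (Fin.last j)).vars (Fin.castAdd j))
    refine (ih (f := fun i => f i.castSucc) h1 (fun i => hf _)).congr fun v => ?_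
    rw [append_last]
    simp

theorem LD.substF {j : ℕ} {R : (Fin j → M) → Prop} {f : Fin j → (Fin k → M) → M} (h : LD R)
    (hf : ∀ i, LF (f i)) : LD (fun v => R (fun i => f i v)) :=
  (LD.appendF (h.vars (Fin.natAdd k)) hf).congr fun v => by simp

theorem finMax {j : ℕ} (f : Fin j → M) : ∃ b, ∀ i, f i ≤ b := by
  induction j with
  | zero => exact ⟨0, fun i => i.elim0⟩
  | succ j ih =>
    obtain ⟨b, hb⟩ := ih (fun i => f i.castSucc)
    refine ⟨max b (f (Fin.last j)), fun i => Fin.lastCases (le_max_right _ _) (fun i => ?_) i⟩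
    exact (hb i).trans (le_max_left _ _)

theorem LF.substF {j : ℕ} {g : (Fin j → M) → M} {f : Fin j → (Fin k → M) → M} (h : LF g)
    (hf : ∀ i, LF (f i)) : LF (fun v => g (fun i => f i v)) where
  bd u := by
    choose b hb using fun i => (hf i).bd u
    obtain ⟨b', hb'⟩ := finMax b
    obtain ⟨c, hc⟩ := h.bd b'
    exact ⟨c, fun v hv => hc _ fun i => (hb i v hv).trans_le (hb' i)⟩
  graph := by
    have := LD.substF (k := k + 1) (f := Fin.lastCases
      (motive := fun _ => (Fin (k + 1) → M) → M) (fun v => v (Fin.last k))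
      (fun i v => f i (fun i => v i.castSucc))) h.graph (fun i => by
        refine Fin.lastCases ?_ (fun i => ?_) i
        · simp only [Fin.lastCases_last]; infer_instance
        · simp only [Fin.lastCases_castSucc]; exact (hf i).vars Fin.castSucc)
    refine this.congr fun v => ?_
    simp

end LDbase

section D0derived

variable {k : ℕ}

/-- arity 1 version -/
class D01 (P : ∀ M : Mod, M → Prop) : Prop where
  out : D0 (fun M (v : Fin 1 → M) => P M (v 0))

/-- arity 2 version -/
class D02 (P : ∀ M : Mod, M → M → Prop) : Prop where
  out : D0 (fun M (v : Fin 2 → M) => P M (v 0) (v 1))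

/-- arity 3 version -/
class D03 (P : ∀ M : Mod, M → M → M → Prop) : Prop where
  out : D0 (fun M (v : Fin 3 → M) => P M (v 0) (v 1) (v 2))

/-- arity 4 version -/
class D04 (P : ∀ M : Mod, M → M → M → M → Prop) : Prop where
  out : D0 (fun M (v : Fin 4 → M) => P M (v 0) (v 1) (v 2) (v 3))

/-- arity 5 version -/
class D05 (P : ∀ M : Mod, M → M → M → M → M → Prop) : Prop where
  out : D0 (fun M (v : Fin 5 → M) => P M (v 0) (v 1) (v 2) (v 3) (v 4))

/-- arity 6 version -/
class D06 (P : ∀ M : Mod, M → M → M → M → M → M → Prop) : Prop where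
  out : D0 (fun M (v : Fin 6 → M) => P M (v 0) (v 1) (v 2) (v 3) (v 4) (v 5))

/-- arity 7 version -/
class D07 (P : ∀ M : Mod, M → M → M → M → M → M → M → Prop) : Prop where
  out : D0 (fun M (v : Fin 7 → M) => P M (v 0) (v 1) (v 2) (v 3) (v 4) (v 5) (v 6))

/-- arity 1 version -/
class DF1 (f : ∀ M : Mod, M → M) : Prop where
  out : DF (fun M (v : Fin 1 → M) => f M (v 0))

/-- arity 2 version -/
class DF2 (f : ∀ M : Mod, M → M → M) : Prop where
  out : DF (fun M (v : Fin 2 → M) => f M (v 0) (v 1))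

/-- arity 3 version -/
class DF3 (f : ∀ M : Mod, M → M → M → M) : Prop where
  out : DF (fun M (v : Fin 3 → M) => f M (v 0) (v 1) (v 2))

/-- arity 4 version -/
class DF4 (f : ∀ M : Mod, M → M → M → M → M) : Prop where
  out : DF (fun M (v : Fin 4 → M) => f M (v 0) (v 1) (v 2) (v 3))

instance (priority := low) D0.app1 {P : ∀ M : Mod, M → Prop} {f0 : UFun k} [h : D01 P]
    [h0 : DF f0] : D0 (fun M v => P M (f0 M v)) :=
  (h.out.substF (f := ![f0]) (fun i => by fin_cases i <;> assumption)).congr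
    fun M v => Iff.rfl

instance D0.app2 {P : ∀ M : Mod, M → M → Prop} {f0 f1 : UFun k} [h : D02 P]
    [h0 : DF f0] [h1 : DF f1] : D0 (fun M v => P M (f0 M v) (f1 M v)) :=
  (h.out.substF (f := ![f0, f1]) (fun i => by fin_cases i <;> assumption)).congr
    fun M v => Iff.rfl

instance D0.app3 {P : ∀ M : Mod, M → M → M → Prop} {f0 f1 f2 : UFun k} [h : D03 P]
    [h0 : DF f0] [h1 : DF f1] [h2 : DF f2] : D0 (fun M v => P M (f0 M v) (f1 M v) (f2 M v)) :=
  (h.out.substF (f := ![f0, f1, f2]) (fun i => by fin_cases i <;> assumption)).congr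
    fun M v => Iff.rfl

instance D0.app4 {P : ∀ M : Mod, M → M → M → M → Prop} {f0 f1 f2 f3 : UFun k} [h : D04 P]
    [h0 : DF f0] [h1 : DF f1] [h2 : DF f2] [h3 : DF f3] : D0 (fun M v => P M (f0 M v) (f1 M v) (f2 M v) (f3 M v)) :=
  (h.out.substF (f := ![f0, f1, f2, f3]) (fun i => by fin_cases i <;> assumption)).congr
    fun M v => Iff.rfl

instance D0.app5 {P : ∀ M : Mod, M → M → M → M → M → Prop} {f0 f1 f2 f3 f4 : UFun k} [h : D05 P]
    [h0 : DF f0] [h1 : DF f1] [h2 : DF f2] [h3 : DF f3] [h4 : DF f4] : D0 (fun M v => P M (f0 M v) (f1 M v) (f2 M v) (f3 M v) (f4 M v)) :=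
  (h.out.substF (f := ![f0, f1, f2, f3, f4]) (fun i => by fin_cases i <;> assumption)).congr
    fun M v => Iff.rfl

instance D0.app6 {P : ∀ M : Mod, M → M → M → M → M → M → Prop} {f0 f1 f2 f3 f4 f5 : UFun k} [h : D06 P]
    [h0 : DF f0] [h1 : DF f1] [h2 : DF f2] [h3 : DF f3] [h4 : DF f4] [h5 : DF f5] : D0 (fun M v => P M (f0 M v) (f1 M v) (f2 M v) (f3 M v) (f4 M v) (f5 M v)) :=
  (h.out.substF (f := ![f0, f1, f2, f3, f4, f5]) (fun i => by fin_cases i <;> assumption)).congr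
    fun M v => Iff.rfl

instance D0.app7 {P : ∀ M : Mod, M → M → M → M → M → M → M → Prop} {f0 f1 f2 f3 f4 f5 f6 : UFun k} [h : D07 P]
    [h0 : DF f0] [h1 : DF f1] [h2 : DF f2] [h3 : DF f3] [h4 : DF f4] [h5 : DF f5] [h6 : DF f6] : D0 (fun M v => P M (f0 M v) (f1 M v) (f2 M v) (f3 M v) (f4 M v) (f5 M v) (f6 M v)) :=
  (h.out.substF (f := ![f0, f1, f2, f3, f4, f5, f6]) (fun i => by fin_cases i <;> assumption)).congr
    fun M v => Iff.rfl

instance (priority := low) DF.app1 {P : ∀ M : Mod, M → M} {f0 : UFun k} [h : DF1 P]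
    [h0 : DF f0] : DF (fun M v => P M (f0 M v)) :=
  h.out.substF (f := ![f0]) (fun i => by fin_cases i <;> assumption)

instance DF.app2 {P : ∀ M : Mod, M → M → M} {f0 f1 : UFun k} [h : DF2 P]
    [h0 : DF f0] [h1 : DF f1] : DF (fun M v => P M (f0 M v) (f1 M v)) :=
  h.out.substF (f := ![f0, f1]) (fun i => by fin_cases i <;> assumption)

instance DF.app3 {P : ∀ M : Mod, M → M → M → M} {f0 f1 f2 : UFun k} [h : DF3 P]
    [h0 : DF f0] [h1 : DF f1] [h2 : DF f2] : DF (fun M v => P M (f0 M v) (f1 M v) (f2 M v)) :=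
  h.out.substF (f := ![f0, f1, f2]) (fun i => by fin_cases i <;> assumption)

instance DF.app4 {P : ∀ M : Mod, M → M → M → M → M} {f0 f1 f2 f3 : UFun k} [h : DF4 P]
    [h0 : DF f0] [h1 : DF f1] [h2 : DF f2] [h3 : DF f3] : DF (fun M v => P M (f0 M v) (f1 M v) (f2 M v) (f3 M v)) :=
  h.out.substF (f := ![f0, f1, f2, f3]) (fun i => by fin_cases i <;> assumption)

instance D0.and {R S : URel k} [hR : D0 R] [hS : D0 S] : D0 (fun M v => R M v ∧ S M v) := hR.and' hS
instance D0.imp {R S : URel k} [hR : D0 R] [hS : D0 S] : D0 (fun M v => R M v → S M v) := hR.imp' hS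
instance D0.not {R : URel k} [hR : D0 R] : D0 (fun M v => ¬ R M v) := hR.not'
instance D0.or {R S : URel k} [hR : D0 R] [hS : D0 S] : D0 (fun M v => R M v ∨ S M v) :=
  (hR.not'.imp' hS).congr fun M v => by tauto
instance D0.iff {R S : URel k} [hR : D0 R] [hS : D0 S] : D0 (fun M v => R M v ↔ S M v) :=
  ((hR.imp' hS).and' (hS.imp' hR)).congr fun M v => by tauto
instance D0.exLt {Q : ∀ M : Mod, (Fin k → M) → M → Prop} {t : UFun k} [ht : DF t]
    [hQ : D0 (fun M (w : Fin (k + 1) → M) => Q M (fun i => w i.castSucc) (w (Fin.last k)))] :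
    D0 (fun M v => ∃ x, x < t M v ∧ Q M v x) :=
  (hQ.bdExF ht).congr fun M v => by simp
instance D0.exLe {Q : ∀ M : Mod, (Fin k → M) → M → Prop} {t : UFun k} [ht : DF t]
    [hQ : D0 (fun M (w : Fin (k + 1) → M) => Q M (fun i => w i.castSucc) (w (Fin.last k)))] :
    D0 (fun M v => ∃ x, x ≤ t M v ∧ Q M v x) :=
  (hQ.bdExF (f := fun M v => t M v + 1) (DF.add'.substF (f := ![t, fun M _ => 1])
    (fun i => by fin_cases i; exact ht; exact DF.one))).congr fun M v => by simp [ltS]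
instance D0.allLt {Q : ∀ M : Mod, (Fin k → M) → M → Prop} {t : UFun k} [ht : DF t]
    [hQ : D0 (fun M (w : Fin (k + 1) → M) => Q M (fun i => w i.castSucc) (w (Fin.last k)))] :
    D0 (fun M v => ∀ x, x < t M v → Q M v x) :=
  (hQ.not'.bdExF ht).not'.congr fun M v => by simp
instance D0.allLe {Q : ∀ M : Mod, (Fin k → M) → M → Prop} {t : UFun k} [ht : DF t]
    [hQ : D0 (fun M (w : Fin (k + 1) → M) => Q M (fun i => w i.castSucc) (w (Fin.last k)))] :
    D0 (fun M v => ∀ x, x ≤ t M v → Q M v x) :=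
  (hQ.not'.bdExF (f := fun M v => t M v + 1) (DF.add'.substF (f := ![t, fun M _ => 1])
    (fun i => by fin_cases i; exact ht; exact DF.one))).not'.congr fun M v => by simp [ltS]
instance : D02 (fun M (x y : M) => x < y) := ⟨D0.lt'⟩
instance : D02 (fun M (x y : M) => x = y) := ⟨D0.eq'⟩
instance : DF2 (fun M (x y : M) => x + y) := ⟨DF.add'⟩
instance : DF2 (fun M (x y : M) => x * y) := ⟨DF.mul'⟩
instance D0.ltI {f g : UFun k} [DF f] [DF g] : D0 (fun M v => f M v < g M v) :=
  D0.app2 (P := fun M (x y : M) => x < y)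
instance D0.eqI {f g : UFun k} [DF f] [DF g] : D0 (fun M v => f M v = g M v) :=
  D0.app2 (P := fun M (x y : M) => x = y)
instance D0.leI {f g : UFun k} [DF f] [DF g] : D0 (fun M v => f M v ≤ g M v) :=
  (inferInstance : D0 (fun M v => f M v < g M v ∨ f M v = g M v)).congr fun M v => le_iff_lt_or_eq
instance D0.neI {f g : UFun k} [DF f] [DF g] : D0 (fun M v => f M v ≠ g M v) :=
  (inferInstance : D0 (fun M v => ¬ f M v = g M v))
instance DF.addI {f g : UFun k} [DF f] [DF g] : DF (fun M v => f M v + g M v) :=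
  DF.app2 (P := fun M (x y : M) => x + y)
instance DF.mulI {f g : UFun k} [DF f] [DF g] : DF (fun M v => f M v * g M v) :=
  DF.app2 (P := fun M (x y : M) => x * y)

end D0derived

section LDderived
variable {M : Type} [lang.Structure M] [PAM M]
variable {k : ℕ}

/-- arity 1 version -/
class LD1 (P : M → Prop) : Prop where
  out : LD (fun (v : Fin 1 → M) => P (v 0))

/-- arity 2 version -/
class LD2 (P : M → M → Prop) : Prop where
  out : LD (fun (v : Fin 2 → M) => P (v 0) (v 1))

/-- arity 3 version -/
class LD3 (P : M → M → M → Prop) : Prop where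
  out : LD (fun (v : Fin 3 → M) => P (v 0) (v 1) (v 2))

/-- arity 4 version -/
class LD4 (P : M → M → M → M → Prop) : Prop where
  out : LD (fun (v : Fin 4 → M) => P (v 0) (v 1) (v 2) (v 3))

/-- arity 5 version -/
class LD5 (P : M → M → M → M → M → Prop) : Prop where
  out : LD (fun (v : Fin 5 → M) => P (v 0) (v 1) (v 2) (v 3) (v 4))

/-- arity 6 version -/
class LD6 (P : M → M → M → M → M → M → Prop) : Prop where
  out : LD (fun (v : Fin 6 → M) => P (v 0) (v 1) (v 2) (v 3) (v 4) (v 5))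

/-- arity 7 version -/
class LD7 (P : M → M → M → M → M → M → M → Prop) : Prop where
  out : LD (fun (v : Fin 7 → M) => P (v 0) (v 1) (v 2) (v 3) (v 4) (v 5) (v 6))

/-- arity 1 version -/
class LF1 (f : M → M) : Prop where
  out : LF (fun (v : Fin 1 → M) => f (v 0))

/-- arity 2 version -/
class LF2 (f : M → M → M) : Prop where
  out : LF (fun (v : Fin 2 → M) => f (v 0) (v 1))

/-- arity 3 version -/
class LF3 (f : M → M → M → M) : Prop where
  out : LF (fun (v : Fin 3 → M) => f (v 0) (v 1) (v 2))

/-- arity 4 version -/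
class LF4 (f : M → M → M → M → M) : Prop where
  out : LF (fun (v : Fin 4 → M) => f (v 0) (v 1) (v 2) (v 3))

instance (priority := low) LD.app1 {P : M → Prop} {f0 : (Fin k → M) → M} [h : LD1 P]
    [h0 : LF f0] : LD (fun v => P (f0 v)) :=
  (h.out.substF (f := ![f0]) (fun i => by fin_cases i <;> assumption)).congr
    fun v => Iff.rfl

instance LD.app2 {P : M → M → Prop} {f0 f1 : (Fin k → M) → M} [h : LD2 P]
    [h0 : LF f0] [h1 : LF f1] : LD (fun v => P (f0 v) (f1 v)) :=
  (h.out.substF (f := ![f0, f1]) (fun i => by fin_cases i <;> assumption)).congr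
    fun v => Iff.rfl

instance LD.app3 {P : M → M → M → Prop} {f0 f1 f2 : (Fin k → M) → M} [h : LD3 P]
    [h0 : LF f0] [h1 : LF f1] [h2 : LF f2] : LD (fun v => P (f0 v) (f1 v) (f2 v)) :=
  (h.out.substF (f := ![f0, f1, f2]) (fun i => by fin_cases i <;> assumption)).congr
    fun v => Iff.rfl

instance LD.app4 {P : M → M → M → M → Prop} {f0 f1 f2 f3 : (Fin k → M) → M} [h : LD4 P]
    [h0 : LF f0] [h1 : LF f1] [h2 : LF f2] [h3 : LF f3] : LD (fun v => P (f0 v) (f1 v) (f2 v) (f3 v)) :=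
  (h.out.substF (f := ![f0, f1, f2, f3]) (fun i => by fin_cases i <;> assumption)).congr
    fun v => Iff.rfl

instance LD.app5 {P : M → M → M → M → M → Prop} {f0 f1 f2 f3 f4 : (Fin k → M) → M} [h : LD5 P]
    [h0 : LF f0] [h1 : LF f1] [h2 : LF f2] [h3 : LF f3] [h4 : LF f4] : LD (fun v => P (f0 v) (f1 v) (f2 v) (f3 v) (f4 v)) :=
  (h.out.substF (f := ![f0, f1, f2, f3, f4]) (fun i => by fin_cases i <;> assumption)).congr
    fun v => Iff.rfl

instance LD.app6 {P : M → M → M → M → M → M → Prop} {f0 f1 f2 f3 f4 f5 : (Fin k → M) → M} [h : LD6 P]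
    [h0 : LF f0] [h1 : LF f1] [h2 : LF f2] [h3 : LF f3] [h4 : LF f4] [h5 : LF f5] : LD (fun v => P (f0 v) (f1 v) (f2 v) (f3 v) (f4 v) (f5 v)) :=
  (h.out.substF (f := ![f0, f1, f2, f3, f4, f5]) (fun i => by fin_cases i <;> assumption)).congr
    fun v => Iff.rfl

instance LD.app7 {P : M → M → M → M → M → M → M → Prop} {f0 f1 f2 f3 f4 f5 f6 : (Fin k → M) → M} [h : LD7 P]
    [h0 : LF f0] [h1 : LF f1] [h2 : LF f2] [h3 : LF f3] [h4 : LF f4] [h5 : LF f5] [h6 : LF f6] : LD (fun v => P (f0 v) (f1 v) (f2 v) (f3 v) (f4 v) (f5 v) (f6 v)) :=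
  (h.out.substF (f := ![f0, f1, f2, f3, f4, f5, f6]) (fun i => by fin_cases i <;> assumption)).congr
    fun v => Iff.rfl

instance (priority := low) LF.app1 {P : M → M} {f0 : (Fin k → M) → M} [h : LF1 P]
    [h0 : LF f0] : LF (fun v => P (f0 v)) :=
  h.out.substF (f := ![f0]) (fun i => by fin_cases i <;> assumption)

instance LF.app2 {P : M → M → M} {f0 f1 : (Fin k → M) → M} [h : LF2 P]
    [h0 : LF f0] [h1 : LF f1] : LF (fun v => P (f0 v) (f1 v)) :=
  h.out.substF (f := ![f0, f1]) (fun i => by fin_cases i <;> assumption)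

instance LF.app3 {P : M → M → M → M} {f0 f1 f2 : (Fin k → M) → M} [h : LF3 P]
    [h0 : LF f0] [h1 : LF f1] [h2 : LF f2] : LF (fun v => P (f0 v) (f1 v) (f2 v)) :=
  h.out.substF (f := ![f0, f1, f2]) (fun i => by fin_cases i <;> assumption)

instance LF.app4 {P : M → M → M → M → M} {f0 f1 f2 f3 : (Fin k → M) → M} [h : LF4 P]
    [h0 : LF f0] [h1 : LF f1] [h2 : LF f2] [h3 : LF f3] : LF (fun v => P (f0 v) (f1 v) (f2 v) (f3 v)) :=
  h.out.substF (f := ![f0, f1, f2, f3]) (fun i => by fin_cases i <;> assumption)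

instance LD.and {R S : (Fin k → M) → Prop} [hR : LD R] [hS : LD S] : LD (fun v => R v ∧ S v) := hR.and' hS
instance LD.imp {R S : (Fin k → M) → Prop} [hR : LD R] [hS : LD S] : LD (fun v => R v → S v) := hR.imp' hS
instance LD.not {R : (Fin k → M) → Prop} [hR : LD R] : LD (fun v => ¬ R v) := hR.not'
instance LD.or {R S : (Fin k → M) → Prop} [hR : LD R] [hS : LD S] : LD (fun v => R v ∨ S v) :=
  (hR.not'.imp' hS).congr fun v => by tauto
instance LD.iff {R S : (Fin k → M) → Prop} [hR : LD R] [hS : LD S] : LD (fun v => R v ↔ S v) :=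
  ((hR.imp' hS).and' (hS.imp' hR)).congr fun v => by tauto
instance LD.exLt {Q : (Fin k → M) → M → Prop} {t : (Fin k → M) → M} [ht : LF t]
    [hQ : LD (fun (w : Fin (k + 1) → M) => Q (fun i => w i.castSucc) (w (Fin.last k)))] :
    LD (fun v => ∃ x, x < t v ∧ Q v x) :=
  (hQ.bdExF ht).congr fun v => by simp
instance LD.exLe {Q : (Fin k → M) → M → Prop} {t : (Fin k → M) → M} [ht : LF t]
    [hQ : LD (fun (w : Fin (k + 1) → M) => Q (fun i => w i.castSucc) (w (Fin.last k)))] :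
    LD (fun v => ∃ x, x ≤ t v ∧ Q v x) :=
  (hQ.bdExF (f := fun v => t v + 1) (LF.add'.substF (f := ![t, fun _ => 1])
    (fun i => by fin_cases i; exact ht; exact LF.const 1))).congr fun v => by simp [ltS]
instance LD.allLt {Q : (Fin k → M) → M → Prop} {t : (Fin k → M) → M} [ht : LF t]
    [hQ : LD (fun (w : Fin (k + 1) → M) => Q (fun i => w i.castSucc) (w (Fin.last k)))] :
    LD (fun v => ∀ x, x < t v → Q v x) :=
  (hQ.not'.bdExF ht).not'.congr fun v => by simp
instance LD.allLe {Q : (Fin k → M) → M → Prop} {t : (Fin k → M) → M} [ht : LF t]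
    [hQ : LD (fun (w : Fin (k + 1) → M) => Q (fun i => w i.castSucc) (w (Fin.last k)))] :
    LD (fun v => ∀ x, x ≤ t v → Q v x) :=
  (hQ.not'.bdExF (f := fun v => t v + 1) (LF.add'.substF (f := ![t, fun _ => 1])
    (fun i => by fin_cases i; exact ht; exact LF.const 1))).not'.congr fun v => by simp [ltS]
instance : LD2 (fun (x y : M) => x < y) := ⟨LD.lt'⟩
instance : LD2 (fun (x y : M) => x = y) := ⟨LD.eq'⟩
instance : LF2 (fun (x y : M) => x + y) := ⟨LF.add'⟩
instance : LF2 (fun (x y : M) => x * y) := ⟨LF.mul'⟩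
instance LD.ltI {f g : (Fin k → M) → M} [LF f] [LF g] : LD (fun v => f v < g v) :=
  LD.app2 (P := fun (x y : M) => x < y)
instance LD.eqI {f g : (Fin k → M) → M} [LF f] [LF g] : LD (fun v => f v = g v) :=
  LD.app2 (P := fun (x y : M) => x = y)
instance LD.leI {f g : (Fin k → M) → M} [LF f] [LF g] : LD (fun v => f v ≤ g v) :=
  (inferInstance : LD (fun v => f v < g v ∨ f v = g v)).congr fun v => le_iff_lt_or_eq
instance LD.neI {f g : (Fin k → M) → M} [LF f] [LF g] : LD (fun v => f v ≠ g v) :=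
  (inferInstance : LD (fun v => ¬ f v = g v))
instance LF.addI {f g : (Fin k → M) → M} [LF f] [LF g] : LF (fun v => f v + g v) :=
  LF.app2 (P := fun (x y : M) => x + y)
instance LF.mulI {f g : (Fin k → M) → M} [LF f] [LF g] : LF (fun v => f v * g v) :=
  LF.app2 (P := fun (x y : M) => x * y)

end LDderived

end ArithFC

end

section
set_option linter.all false
open FirstOrder Language
namespace ArithFC

section Ind
variable {M : Type} [lang.Structure M] [AR M]

/-- Induction for locally Δ₀ predicates. -/
theorem LD.ind {P : M → Prop} (h : LD (fun v : Fin 1 → M => P (v 0)) := by infer_instance)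
    (h0 : P 0) (hs : ∀ x, P x → P (x + 1)) (x : M) : P x := by
  obtain ⟨φ, h1, h2⟩ := h.out (x + 1)
  have key := AR.isig1 (M := M) {y : M | ¬ y < x + 1 ∨ φ.Realize id (fun _ : Fin 1 => y)} (by
    have := isSigmaDef_of_fm (r := 1) (M := M) (k := 1)
      (φ := (ltFm (Term.var (Sum.inr 0)) (tAdd (Term.var (Sum.inl x)) tOne)).imp φ)
      (.delta0 _ _ (.imp _ (.rel _ _ _ _) h1))
    obtain ⟨p, ψ, w, h3, h4⟩ := this
    refine ⟨p, ψ, w, h3, fun v => ?_⟩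
    rw [← h4]
    beta_reduce
    rw [BoundedFormula.realize_imp, realize_ltFm, realize_add, realize_one]
    have e : v = fun _ => v 0 := by ext i; fin_cases i; rfl
    rw [Set.mem_setOf_eq, ← e]
    simp only [Term.realize_var, Sum.elim_inr, Sum.elim_inl, id]
    exact (imp_iff_not_or).symm) ?_ ?_ x
  · rcases key with h | h
    · exact absurd (lt_add_one x) h
    · exact (h2 _ (fun _ => lt_add_one x)).mpr h
  · right
    exact (h2 _ (fun _ => by show (0:M) < x + 1; rw [ltS]; exact zero_le)).mp h0
  · intro y hy
    by_cases hyx : y + 1 < x + 1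
    · right
      have hy1 : y < x + 1 := (lt_add_one y).trans hyx
      rcases hy with hy | hy
      · exact absurd hy1 hy
      · exact (h2 _ (fun _ => hyx)).mp (hs y ((h2 (fun _ => y) (fun _ => hy1)).mpr hy))
    · exact Or.inl hyx

theorem LD.sind {P : M → Prop} (h : LD (fun v : Fin 1 → M => P (v 0)) := by infer_instance)
    (hs : ∀ x, (∀ y, y < x → P y) → P x) (x : M) : P x := by
  have hi : LD1 P := ⟨h⟩
  have := LD.ind (P := fun x => ∀ y, y < x → P y) inferInstance
    (fun y hy => absurd hy (not_lt_zero'' y)) (fun x hx y hy => by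
      rcases (ltS.mp hy).lt_or_eq with h | rfl
      · exact hx y h
      · exact hs _ hx) (x + 1)
  exact this x (lt_add_one x)

theorem LD.lnp {P : M → Prop} (h : LD (fun v : Fin 1 → M => P (v 0)) := by infer_instance)
    {x : M} (hx : P x) : ∃ y, y ≤ x ∧ P y ∧ ∀ z, z < y → ¬ P z := by
  by_contra hc
  push Not at hc
  have hi : LD1 P := ⟨h⟩
  have := LD.sind (P := fun x => ¬ P x) inferInstance (fun y ih hy => by
    by_cases hyx : y ≤ x
    · obtain ⟨z, hz, hz2⟩ := hc y hyx hy
      exact ih z hz hz2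
    · exact ih x (not_le.mp hyx) hx) x
  exact this hx

/-- greatest element below a bound -/
theorem LD.gnp {P : M → Prop} (h : LD (fun v : Fin 1 → M => P (v 0)) := by infer_instance)
    {x b : M} (hx : P x) (hxb : x ≤ b) : ∃ y, y ≤ b ∧ P y ∧ ∀ z, y < z → z ≤ b → ¬ P z := by
  have hi : LD1 P := ⟨h⟩
  obtain ⟨d, h1, h2, h3⟩ := LD.lnp (P := fun d => ∃ y, y ≤ b ∧ (y + d = b ∧ P y)) inferInstance
    (x := Classical.choose (exists_add_of_le hxb))
    ⟨x, hxb, (Classical.choose_spec (exists_add_of_le hxb)).symm, hx⟩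
  obtain ⟨y, hy, hy2, hy3⟩ := h2
  refine ⟨y, hy, hy3, fun z hz hzb hP => ?_⟩
  obtain ⟨d', hd'⟩ := exists_add_of_le hzb
  refine h3 d' ?_ ⟨z, hzb, hd'.symm, hP⟩
  by_contra hc
  rw [not_lt] at hc
  have : y + d < z + d' := add_lt_add_of_lt_of_le hz hc
  rw [hy2, ← hd'] at this
  exact lt_irrefl _ this

theorem pos_of_ne {x : M} (h : x ≠ 0) : 0 < x := lt_of_le_of_ne zero_le (Ne.symm h)

theorem le_mul_pos {x y : M} (h : 0 < y) : x ≤ x * y := by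
  have h1 : (1 : M) ≤ y := PAM.out.discrete y h
  calc x = x * 1 := (mul_one x).symm
    _ ≤ x * y := mul_le_mul_right h1 x

theorem div_ex (a m : M) (hm : 0 < m) : ∃ q, q ≤ a ∧ ∃ r, r < m ∧ a = q * m + r := by
  refine LD.ind (P := fun a => ∃ q, q ≤ a ∧ ∃ r, r < m ∧ a = q * m + r) inferInstance ?_ ?_ a
  · exact ⟨0, le_rfl, 0, hm, by ring⟩
  · rintro x ⟨q, hq, r, hr, e⟩
    rcases (Sle.mpr hr).lt_or_eq with h | h
    · exact ⟨q, hq.trans (lt_add_one x).le, r + 1, h, by rw [e]; ring⟩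
    · exact ⟨q + 1, by gcongr, 0, hm, by rw [e, ← h]; ring⟩

theorem div_lt {q q' r r' m : M} (hr : r < m) (h : q < q') : q * m + r < q' * m + r' := by
  have h1 : q * m + r < q * m + m := by gcongr
  have h2 : q * m + m ≤ q' * m := by
    have : (q + 1) * m ≤ q' * m := mul_le_mul_left (Sle.mpr h) m
    calc q * m + m = (q + 1) * m := by ring
      _ ≤ _ := this
  exact h1.trans_le (h2.trans (le_self_add))

theorem div_uniq {q q' r r' m : M} (hr : r < m) (hr' : r' < m) (e : q * m + r = q' * m + r') :
    q = q' ∧ r = r' := by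
  rcases lt_trichotomy q q' with h | h | h
  · exact absurd e (div_lt hr h).ne
  · subst h; exact ⟨rfl, add_left_cancel e⟩
  · exact absurd e (div_lt hr' h).ne'

noncomputable def md (a m : M) : M :=
  open Classical in if h : 0 < m then (div_ex a m h).choose_spec.2.choose else a

theorem md_lt {m : M} (a : M) (h : 0 < m) : md a m < m := by
  unfold md; rw [dif_pos h]; exact (div_ex a m h).choose_spec.2.choose_spec.1

theorem md_eq {m : M} (a : M) (h : 0 < m) : ∃ q, q ≤ a ∧ a = q * m + md a m := by
  unfold md; rw [dif_pos h]
  exact ⟨_, (div_ex a m h).choose_spec.1, (div_ex a m h).choose_spec.2.choose_spec.2⟩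

theorem md_zero' (a : M) : md a 0 = a := by
  unfold md; rw [dif_neg (lt_irrefl _)]

theorem md_le (a m : M) : md a m ≤ a := by
  rcases eq_or_ne m 0 with rfl | h
  · rw [md_zero']
  · obtain ⟨q, _, hq⟩ := md_eq a (pos_of_ne h)
    conv_rhs => rw [hq]
    exact le_add_self

theorem md_iff {a m r : M} : r = md a m ↔ (m = 0 ∧ r = a) ∨ (r < m ∧ ∃ q, q ≤ a ∧ a = q * m + r) := by
  rcases eq_or_ne m 0 with rfl | h
  · rw [md_zero']
    constructor
    · intro h; exact Or.inl ⟨rfl, h⟩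
    · rintro (h | h)
      · exact h.2
      · exact absurd h.1 (not_lt_zero'' _)
  · constructor
    · rintro rfl
      exact Or.inr ⟨md_lt a (pos_of_ne h), md_eq a (pos_of_ne h)⟩
    · rintro (h1 | ⟨h1, q, _, h2⟩)
      · exact absurd h1.1 h
      · obtain ⟨q', _, h3⟩ := md_eq a (pos_of_ne h)
        exact (div_uniq h1 (md_lt a (pos_of_ne h)) (h2.symm.trans h3)).2

theorem md_congr {a b m : M} (h : 0 < m) : md a m = md b m ↔ ∃ k k', a + k * m = b + k' * m := by
  obtain ⟨q, _, hq⟩ := md_eq a h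
  obtain ⟨q', _, hq'⟩ := md_eq b h
  constructor
  · intro e
    refine ⟨q', q, ?_⟩
    rw [hq, hq', e]
    ring
  · rintro ⟨k, k', e⟩
    refine (div_uniq (q := q + k) (q' := q' + k') (md_lt a h) (md_lt b h) ?_).2
    calc (q + k) * m + md a m = (q * m + md a m) + k * m := by ring
      _ = (q' * m + md b m) + k' * m := by rw [← hq, ← hq', e]
      _ = _ := by ring

theorem md_of_lt {a m : M} (h : a < m) : md a m = a := by
  symm; rw [md_iff]; exact Or.inr ⟨h, 0, zero_le, by ring⟩

theorem md_add_mul {a m k : M} (h : 0 < m) : md (a + k * m) m = md a m := by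
  rw [md_congr h]; exact ⟨0, k, by ring⟩

theorem md_mul_md {a b m : M} (h : 0 < m) : md (md a m * b) m = md (a * b) m := by
  obtain ⟨q, _, hq⟩ := md_eq a h
  rw [md_congr h]
  refine ⟨q * b, 0, ?_⟩
  conv_rhs => rw [hq]
  ring

theorem md_add_md {a b m : M} (h : 0 < m) : md (md a m + b) m = md (a + b) m := by
  obtain ⟨q, _, hq⟩ := md_eq a h
  rw [md_congr h]
  refine ⟨q, 0, ?_⟩
  conv_rhs => rw [hq]
  ring

theorem dbl_inj {x y : M} (h : x + x = y + y) : x = y := by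
  rcases lt_trichotomy x y with h1 | h1 | h1
  · exact absurd h (add_lt_add h1 h1).ne
  · exact h1
  · exact absurd h (add_lt_add h1 h1).ne'

theorem pair_ex (x y : M) : ∃ z, IsPairC z x y := by
  have key : ∀ s : M, ∃ z, z ≤ s * (s + 1) ∧ z + z = s * (s + 1) := by
    intro s
    refine LD.ind (P := fun s => ∃ z, z ≤ s * (s + 1) ∧ z + z = s * (s + 1)) inferInstance ?_ ?_ s
    · exact ⟨0, zero_le, by ring⟩
    · rintro s ⟨z, hz, e⟩
      refine ⟨z + s + 1, ?_, ?_⟩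
      · have : z + s + 1 ≤ s * (s + 1) + s + 1 := by gcongr
        refine this.trans ?_
        have e2 : (s + 1) * (s + 1 + 1) = (s * (s + 1) + s + 1) + (s + 1) := by ring
        rw [e2]; exact le_self_add
      · calc z + s + 1 + (z + s + 1) = (z + z) + (s + 1) + (s + 1) := by ring
          _ = _ := by rw [e]; ring
  obtain ⟨z, _, hz⟩ := key (x + y)
  refine ⟨z + y, ?_⟩
  unfold IsPairC
  rw [← hz]; ring

theorem pair_lt {x y x' y' z z' : M} (h : IsPairC z x y) (h' : IsPairC z' x' y')
    (hs : x + y < x' + y') : z < z' := by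
  by_contra hc
  rw [not_lt] at hc
  unfold IsPairC at h h'
  have h1 : z' + z' ≤ z + z := add_le_add hc hc
  rw [h, h'] at h1
  obtain ⟨d, hd⟩ := exists_add_of_le (Sle.mpr hs)
  rw [hd] at h1
  have h2 : (x + y) * (x + y + 1) + (y + y) < (x + y + 1) * (x + y + 1 + 1) := by
    have e : (x + y + 1) * (x + y + 1 + 1) = (x + y) * (x + y + 1) + (y + y) + (x + x + 1 + 1) := by
      ring
    rw [e]
    exact lt_add_of_pos_right _ (by positivity)
  have h3 : (x + y + 1) * (x + y + 1 + 1) ≤ (x + y + 1 + d) * (x + y + 1 + d + 1) + (y' + y') := by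
    refine le_trans ?_ le_self_add
    have : x + y + 1 ≤ x + y + 1 + d := le_self_add
    gcongr
  exact absurd (h2.trans_le (h3.trans h1)) (lt_irrefl _)

theorem pair_inj {x y x' y' z : M} (h : IsPairC z x y) (h' : IsPairC z x' y') : x = x' ∧ y = y' := by
  rcases lt_trichotomy (x + y) (x' + y') with hs | hs | hs
  · exact absurd (pair_lt h h' hs) (lt_irrefl _)
  · unfold IsPairC at h h'
    rw [hs, h'] at h
    have hy : y' = y := dbl_inj (add_left_cancel h)
    subst hy
    exact ⟨add_right_cancel hs, rfl⟩
  · exact absurd (pair_lt h' h hs) (lt_irrefl _)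

theorem pair_uniq {x y z z' : M} (h : IsPairC z x y) (h' : IsPairC z' x y) : z = z' :=
  dbl_inj (h.trans h'.symm)

theorem pair_le {x y z : M} (h : IsPairC z x y) : x ≤ z ∧ y ≤ z := by
  unfold IsPairC at h
  have h1 : x + y ≤ (x + y) * (x + y) := by
    rcases eq_or_ne (x + y) 0 with h | h
    · rw [h]; exact zero_le
    · exact le_mul_pos (pos_of_ne h)
  constructor
  · by_contra hc
    rw [not_le] at hc
    have : z + z < x + x := add_lt_add hc hc
    rw [h] at this
    have h3 : x + x ≤ (x + y) * (x + y + 1) + (y + y) := by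
      calc x + x ≤ (x + y) + (x + y) := by gcongr <;> exact le_self_add
        _ ≤ (x + y) * (x + y) + (x + y) := by gcongr
        _ = (x + y) * (x + y + 1) := by ring
        _ ≤ _ := le_self_add
    exact absurd this (not_lt.mpr h3)
  · by_contra hc
    rw [not_le] at hc
    have : z + z < y + y := add_lt_add hc hc
    rw [h] at this
    exact absurd this (not_lt.mpr le_add_self)

theorem unpair_ex (z : M) : ∃ x, x ≤ z ∧ ∃ y, y ≤ z ∧ IsPairC z x y := by
  refine LD.ind (P := fun z => ∃ x, x ≤ z ∧ ∃ y, y ≤ z ∧ IsPairC z x y)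
    (by unfold IsPairC; infer_instance) ?_ ?_ z
  · exact ⟨0, le_rfl, 0, le_rfl, by unfold IsPairC; ring⟩
  · rintro z ⟨x, _, y, _, h⟩
    have : ∃ x y, IsPairC (z + 1) x y := by
      rcases zero_or_succ x with rfl | ⟨x', rfl⟩
      · refine ⟨y + 1, 0, ?_⟩
        unfold IsPairC at h ⊢
        calc z + 1 + (z + 1) = (z + z) + 1 + 1 := by ring
          _ = _ := by rw [h]; ring
      · refine ⟨x', y + 1, ?_⟩
        unfold IsPairC at h ⊢
        calc z + 1 + (z + 1) = (z + z) + 1 + 1 := by ring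
          _ = _ := by rw [h]; ring
    obtain ⟨x, y, h⟩ := this
    exact ⟨x, (pair_le h).1, y, (pair_le h).2, h⟩

/-- pairing -/
noncomputable def pr (x y : M) : M := (pair_ex x y).choose
/-- first projection -/
noncomputable def p1 (z : M) : M := (unpair_ex z).choose
/-- second projection -/
noncomputable def p2 (z : M) : M := (unpair_ex z).choose_spec.2.choose

theorem pr_spec (x y : M) : IsPairC (pr x y) x y := (pair_ex x y).choose_spec
theorem p12_spec (z : M) : IsPairC z (p1 z) (p2 z) := (unpair_ex z).choose_spec.2.choose_spec.2
theorem isPairC_iff {x y z : M} : IsPairC z x y ↔ z = pr x y :=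
  ⟨fun h => pair_uniq h (pr_spec x y), fun h => h ▸ pr_spec x y⟩
@[simp] theorem p1_pr (x y : M) : p1 (pr x y) = x := (pair_inj (p12_spec _) (pr_spec x y)).1
@[simp] theorem p2_pr (x y : M) : p2 (pr x y) = y := (pair_inj (p12_spec _) (pr_spec x y)).2
@[simp] theorem pr_p12 (z : M) : pr (p1 z) (p2 z) = z := (isPairC_iff.mp (p12_spec z)).symm
theorem p1_le (z : M) : p1 z ≤ z := (pair_le (p12_spec z)).1
theorem p2_le (z : M) : p2 z ≤ z := (pair_le (p12_spec z)).2
theorem le_pr1 (x y : M) : x ≤ pr x y := (pair_le (pr_spec x y)).1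
theorem le_pr2 (x y : M) : y ≤ pr x y := (pair_le (pr_spec x y)).2
theorem pr_inj {x y x' y' : M} (h : pr x y = pr x' y') : x = x' ∧ y = y' :=
  pair_inj (pr_spec x y) (h ▸ pr_spec x' y')

theorem pr_bd (x y : M) : pr x y ≤ (x + y) * (x + y + 1) + (y + y) := by
  rw [← pr_spec x y]; exact le_self_add

theorem pr_mono {x y x' y' : M} (h : x ≤ x') (h' : y ≤ y') : pr x y ≤ pr x' y' := by
  rcases (add_le_add h h').lt_or_eq with h1 | h1
  · exact (pair_lt (pr_spec _ _) (pr_spec _ _) h1).le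
  · have hx : x = x' := by
      by_contra hc
      exact absurd h1 (add_lt_add_of_lt_of_le (lt_of_le_of_ne h hc) h').ne
    subst hx
    rw [add_left_cancel h1]

/-- value of the sequence coded by `s` at `i` -/
noncomputable def ev (s i : M) : M := md (p1 s) ((i + 1) * p2 s + 1)

theorem seqAt_iff {s i x : M} : SeqAt s i x ↔ x = ev s i := by
  have hpos : ∀ b : M, 0 < (i + 1) * b + 1 := fun b => by rw [ltS]; exact zero_le
  constructor
  · rintro ⟨a, b, h, h1, q, h2⟩
    obtain ⟨rfl, rfl⟩ := pair_inj h (p12_spec s)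
    refine md_iff.mpr (Or.inr ⟨h1, q, ?_, h2⟩)
    rw [h2]
    exact (le_mul_pos (hpos _)).trans le_self_add
  · rintro rfl
    obtain ⟨q, _, hq⟩ := md_eq (p1 s) (hpos (p2 s))
    exact ⟨p1 s, p2 s, p12_spec s, md_lt _ (hpos _), q, hq⟩

theorem ev_le (s i : M) : ev s i ≤ s := (md_le _ _).trans (p1_le s)

end Ind

theorem DF.of_le {k : ℕ} {f g : UFun k} (hg : DF g)
    (h : D0 (fun M (w : Fin (k + 1) → M) => w (Fin.last k) = f M (fun i => w i.castSucc)))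
    (hle : ∀ M v, f M v ≤ g M v) : DF f := by
  obtain ⟨t, ht⟩ := hg.bd
  exact ⟨⟨t, fun M v => (hle M v).trans (ht M v)⟩, h⟩

instance : D03 (fun M : Mod => IsPairC (M := M)) := ⟨by unfold IsPairC; infer_instance⟩

instance : DF2 (fun M : Mod => md (M := M)) := ⟨DF.of_le (DF.proj 0)
  (D0.congr (k := 3) (R := fun M (w : Fin 3 → M) => (w 1 = 0 ∧ w 2 = w 0) ∨ (w 2 < w 1 ∧ ∃ q, q ≤ w 0 ∧ w 0 = q * w 1 + w 2))
    inferInstance fun M w => md_iff) fun M v => md_le _ _⟩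

instance : DF2 (fun M : Mod => pr (M := M)) := ⟨DF.of_le (g := fun M v =>
    (v 0 + v 1) * (v 0 + v 1 + 1) + (v 1 + v 1)) inferInstance
  (D0.congr (k := 3) (R := fun M (w : Fin 3 → M) => IsPairC (w 2) (w 0) (w 1))
    inferInstance fun M w => isPairC_iff.symm) fun M v => pr_bd _ _⟩

instance : DF1 (fun M : Mod => p1 (M := M)) := ⟨DF.of_le (g := fun M v => v 0) inferInstance
  (D0.congr (k := 2) (R := fun M (w : Fin 2 → M) => ∃ y, y ≤ w 0 ∧ IsPairC (w 0) (w 1) y)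
    inferInstance fun M w => by
      constructor
      · intro h
        exact ⟨p2 (w 0), p2_le _, by rw [show w 1 = p1 (w 0) from h]; exact p12_spec _⟩
      · rintro ⟨y, _, h⟩
        exact (pair_inj h (p12_spec _)).1) fun M v => p1_le _⟩

instance : DF1 (fun M : Mod => p2 (M := M)) := ⟨DF.of_le (g := fun M v => v 0) inferInstance
  (D0.congr (k := 2) (R := fun M (w : Fin 2 → M) => ∃ y, y ≤ w 0 ∧ IsPairC (w 0) y (w 1))
    inferInstance fun M w => by
      constructor
      · intro h
        exact ⟨p1 (w 0), p1_le _, by rw [show w 1 = p2 (w 0) from h]; exact p12_spec _⟩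
      · rintro ⟨y, _, h⟩
        exact (pair_inj h (p12_spec _)).2) fun M v => p2_le _⟩

instance : DF2 (fun M : Mod => ev (M := M)) := ⟨by unfold ev; infer_instance⟩

section toLD
variable {M : Type} [lang.Structure M] [AR M]

theorem D0.toLD {k : ℕ} {R : URel k} (h : D0 R) : LD (R ⟨M, inferInstance, inferInstance⟩) := by
  obtain ⟨φ, h1, h2⟩ := h
  obtain ⟨φ', h3, h4⟩ := h1.subst (β := M) (m := k)
    (Sum.elim Empty.elim (fun i => Term.var (Sum.inr i)))
  refine ⟨fun u => ⟨φ', h3, fun v _ => ?_⟩⟩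
  rw [h2, h4]
  have : (Empty.elim : Empty → M) = (fun a => Term.realize (Sum.elim id v)
    ((Sum.elim Empty.elim (fun i => Term.var (Sum.inr i)) : Empty ⊕ Fin k →
      lang.Term (M ⊕ Fin k)) (Sum.inl a))) := by ext a; exact a.elim
  erw [← this]
  rfl

theorem DF.toLF {k : ℕ} {f : UFun k} (h : DF f) : LF (f ⟨M, inferInstance, inferInstance⟩) where
  bd u := by
    obtain ⟨t, ht⟩ := h.bd
    refine ⟨t.realize (Sum.elim Empty.elim (fun _ => u)) + 1, fun v hv => ltS.mpr
      ((ht _ v).trans (term_mono _ _ _ ?_))⟩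
    rintro (a | i)
    · exact a.elim
    · exact (hv i).le
  graph := h.graph.toLD

theorem D01.toLD {P : ∀ M : Mod, M → Prop} (h : D01 P) :
    LD1 (P ⟨M, inferInstance, inferInstance⟩) := ⟨h.out.toLD⟩
theorem D02.toLD {P : ∀ M : Mod, M → M → Prop} (h : D02 P) :
    LD2 (P ⟨M, inferInstance, inferInstance⟩) := ⟨h.out.toLD⟩
theorem D03.toLD {P : ∀ M : Mod, M → M → M → Prop} (h : D03 P) :
    LD3 (P ⟨M, inferInstance, inferInstance⟩) := ⟨h.out.toLD⟩
theorem D04.toLD {P : ∀ M : Mod, M → M → M → M → Prop} (h : D04 P) :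
    LD4 (P ⟨M, inferInstance, inferInstance⟩) := ⟨h.out.toLD⟩
theorem D05.toLD {P : ∀ M : Mod, M → M → M → M → M → Prop} (h : D05 P) :
    LD5 (P ⟨M, inferInstance, inferInstance⟩) := ⟨h.out.toLD⟩
theorem D06.toLD {P : ∀ M : Mod, M → M → M → M → M → M → Prop} (h : D06 P) :
    LD6 (P ⟨M, inferInstance, inferInstance⟩) := ⟨h.out.toLD⟩
theorem D07.toLD {P : ∀ M : Mod, M → M → M → M → M → M → M → Prop} (h : D07 P) :
    LD7 (P ⟨M, inferInstance, inferInstance⟩) := ⟨h.out.toLD⟩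
theorem DF1.toLF {P : ∀ M : Mod, M → M} (h : DF1 P) :
    LF1 (P ⟨M, inferInstance, inferInstance⟩) := ⟨h.out.toLF⟩
theorem DF2.toLF {P : ∀ M : Mod, M → M → M} (h : DF2 P) :
    LF2 (P ⟨M, inferInstance, inferInstance⟩) := ⟨h.out.toLF⟩
theorem DF3.toLF {P : ∀ M : Mod, M → M → M → M} (h : DF3 P) :
    LF3 (P ⟨M, inferInstance, inferInstance⟩) := ⟨h.out.toLF⟩
theorem DF4.toLF {P : ∀ M : Mod, M → M → M → M → M} (h : DF4 P) :
    LF4 (P ⟨M, inferInstance, inferInstance⟩) := ⟨h.out.toLF⟩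
instance : LD3 (IsPairC (M := M)) := D03.toLD (P := fun M => IsPairC) inferInstance
instance : LF2 (md (M := M)) := DF2.toLF (P := fun M => md) inferInstance
instance : LF2 (pr (M := M)) := DF2.toLF (P := fun M => pr) inferInstance
instance : LF1 (p1 (M := M)) := DF1.toLF (P := fun M => p1) inferInstance
instance : LF1 (p2 (M := M)) := DF1.toLF (P := fun M => p2) inferInstance
instance : LF2 (ev (M := M)) := DF2.toLF (P := fun M => ev) inferInstance
end toLD

end ArithFC

end

section
set_option linter.all false
open FirstOrder Language
namespace ArithFC

/-- vectors of uniformly Δ₀ functions -/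
class DFv {j k : ℕ} (f : ∀ M : Mod, (Fin k → M) → Fin j → M) : Prop where
  out : ∀ i, DF (fun M v => f M v i)

section
variable {k j : ℕ}
instance DFv.nil : DFv (j := 0) (fun M (v : Fin k → M) => ![]) := ⟨fun i => i.elim0⟩
instance DFv.cons {a : UFun k} {f : ∀ M : Mod, (Fin k → M) → Fin j → M} [ha : DF a] [hf : DFv f] :
    DFv (fun M v => Matrix.vecCons (a M v) (f M v)) :=
  ⟨fun i => by
    refine Fin.cases ?_ (fun i => ?_) i
    · simpa using ha
    · simpa using hf.out i⟩
instance DFv.vars {σ : Fin j → Fin k} : DFv (fun M (v : Fin k → M) i => v (σ i)) := ⟨fun i => DF.proj _⟩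
instance DFv.all : DFv (fun M (v : Fin k → M) => v) := ⟨fun i => DF.proj _⟩
theorem DFv.fn {f : ∀ M : Mod, (Fin k → M) → Fin j → M} (hf : ∀ i, DF (fun M v => f M v i)) : DFv f := ⟨hf⟩
instance DFv.snoc {a : UFun k} {f : ∀ M : Mod, (Fin k → M) → Fin j → M} [ha : DF a] [hf : DFv f] :
    DFv (j := j + 1) (fun M v => Fin.snoc (f M v) (a M v)) :=
  ⟨fun i => by
    refine Fin.lastCases ?_ (fun i => ?_) i
    · simpa using ha
    · simpa using hf.out i⟩
instance DFv.comp {f : ∀ M : Mod, (Fin k → M) → Fin j → M} [hf : DFv f] {l : ℕ} {σ : Fin l → Fin j} :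
    DFv (fun M v i => f M v (σ i)) := ⟨fun i => hf.out _⟩
end

/-- semantic Σ_m relations, uniformly in models of IΣ_n -/
def SigR (n : ℕ) : ℕ → ∀ {k : ℕ}, URel k → Prop
  | 0, k, R => ∃ S : URel k, D0 S ∧ ∀ M : Mod, ISig n M → ∀ v, R M v ↔ S M v
  | m + 1, k, R => ∃ S : URel (k + 1), SigR n m S ∧ ∀ M : Mod, ISig n M → ∀ v,
      R M v ↔ ∃ w, ¬ S M (Fin.snoc v w)

/-- Σ_m as a class -/
class Sg (n m : ℕ) {k : ℕ} (R : URel k) : Prop where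
  out : SigR n m R
/-- Π_m as a class -/
class Pg (n m : ℕ) {k : ℕ} (R : URel k) : Prop where
  out : SigR n m (fun M v => ¬ R M v)

section
variable {n m k j : ℕ}

theorem SigR.congr {R R' : URel k} (h : SigR n m R)
    (e : ∀ M : Mod, ISig n M → ∀ v, R' M v ↔ R M v) : SigR n m R' := by
  cases m with
  | zero => obtain ⟨S, h1, h2⟩ := h; exact ⟨S, h1, fun M hM v => (e M hM v).trans (h2 M hM v)⟩
  | succ m => obtain ⟨S, h1, h2⟩ := h; exact ⟨S, h1, fun M hM v => (e M hM v).trans (h2 M hM v)⟩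

theorem SigR.substF {R : URel j} (h : SigR n m R) (f : ∀ M : Mod, (Fin k → M) → Fin j → M)
    [hf : DFv f] : SigR n m (fun M v => R M (f M v)) := by
  induction m generalizing j k with
  | zero =>
    obtain ⟨S, h1, h2⟩ := h
    exact ⟨_, D0.substF (f := fun i M v => f M v i) h1 hf.out, fun M hM v => h2 M hM _⟩
  | succ m ih =>
    obtain ⟨S, h1, h2⟩ := h
    have := ih h1 (k := k + 1) (fun M w => Fin.snoc (f M (fun i => w i.castSucc)) (w (Fin.last k)))
      (hf := by
        have : DFv (k := k + 1) (fun M w => f M (fun i => w i.castSucc)) :=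
          ⟨fun i => (hf.out i).vars Fin.castSucc⟩
        infer_instance)
    refine ⟨_, this, fun M hM v => ?_⟩
    beta_reduce
    rw [h2 M hM]
    simp [snoc_init']

theorem SigR.neg {R : URel k} (h : SigR n m R) : SigR n (m + 1) (fun M v => ¬ R M v) :=
  ⟨_, h.substF (k := k + 1) (fun M w i => w i.castSucc), fun M hM v => by simp [snoc_init']⟩

theorem SigR.d0 {R : URel k} (h : D0 R) : SigR n m R := by
  induction m generalizing k with
  | zero => exact ⟨R, h, fun _ _ _ => Iff.rfl⟩
  | succ m ih =>
    refine ⟨_, ih (h.not'.vars (k := k + 1) Fin.castSucc), fun M hM v => by simp [snoc_init']⟩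

theorem SigR.up {R : URel k} (h : SigR n m R) : SigR n (m + 1) R := by
  induction m generalizing k with
  | zero =>
    obtain ⟨S, h1, h2⟩ := h
    exact (SigR.d0 h1).congr h2
  | succ m ih =>
    obtain ⟨S, h1, h2⟩ := h
    exact ⟨S, ih h1, h2⟩

theorem SigR.mono {m' : ℕ} {R : URel k} (h : SigR n m R) (hm : m ≤ m') : SigR n m' R := by
  induction hm with
  | refl => exact h
  | step _ ih => exact ih.up

theorem SigR.ex {R : URel (k + 1)} (h : SigR n (m + 1) R) :
    SigR n (m + 1) (fun M v => ∃ x, R M (Fin.snoc v x)) := by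
  obtain ⟨S, h1, h2⟩ := h
  refine ⟨_, h1.substF (k := k + 1) (fun M w => Fin.snoc (Fin.snoc (fun i => w (Fin.castSucc i))
    (p1 (w (Fin.last k)))) (p2 (w (Fin.last k)))), fun M hM v => ?_⟩
  simp only [snoc_init', Fin.snoc_last]
  constructor
  · rintro ⟨x, hx⟩
    rw [h2 M hM] at hx
    obtain ⟨w, hw⟩ := hx
    exact ⟨pr x w, by simpa using hw⟩
  · rintro ⟨z, hz⟩
    exact ⟨p1 z, by rw [h2 M hM]; exact ⟨_, hz⟩⟩

theorem SigR.andor {R R' : URel k} (h : SigR n m R) (h' : SigR n m R') :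
    SigR n m (fun M v => R M v ∧ R' M v) ∧ SigR n m (fun M v => R M v ∨ R' M v) := by
  induction m generalizing k with
  | zero =>
    obtain ⟨S, h1, h2⟩ := h
    obtain ⟨S', h1', h2'⟩ := h'
    exact ⟨⟨_, h1.and' h1', fun M hM v => by beta_reduce; rw [h2 M hM, h2' M hM]⟩,
      ⟨_, (inferInstance : D0 (fun M v => S M v ∨ S' M v)), fun M hM v => by beta_reduce; rw [h2 M hM, h2' M hM]⟩⟩
  | succ m ih =>
    obtain ⟨S, h1, h2⟩ := h
    obtain ⟨S', h1', h2'⟩ := h'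
    have a := h1.substF (k := k + 1) (fun M w => Fin.snoc (fun i => w (Fin.castSucc i))
      (p1 (w (Fin.last k))))
    have a' := h1'.substF (k := k + 1) (fun M w => Fin.snoc (fun i => w (Fin.castSucc i))
      (p2 (w (Fin.last k))))
    refine ⟨⟨_, (ih a a').2, fun M hM v => ?_⟩, ⟨_, (ih h1 h1').1, fun M hM v => ?_⟩⟩
    · beta_reduce
      rw [h2 M hM, h2' M hM]
      simp only [snoc_init', Fin.snoc_last]
      constructor
      · rintro ⟨⟨x, hx⟩, ⟨y, hy⟩⟩
        exact ⟨pr x y, by simpa using ⟨hx, hy⟩⟩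
      · rintro ⟨z, hz⟩
        rw [not_or] at hz
        exact ⟨⟨_, hz.1⟩, ⟨_, hz.2⟩⟩
    · beta_reduce
      rw [h2 M hM, h2' M hM, ← exists_or]
      simp only [not_and_or]

theorem Sg.congr {R R' : URel k} (h : Sg n m R) (e : ∀ M : Mod, ISig n M → ∀ v, R' M v ↔ R M v) :
    Sg n m R' := ⟨h.out.congr e⟩
theorem Pg.congr {R R' : URel k} (h : Pg n m R) (e : ∀ M : Mod, ISig n M → ∀ v, R' M v ↔ R M v) :
    Pg n m R' := ⟨h.out.congr fun M hM v => not_congr (e M hM v)⟩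

instance (priority := 20) Sg.ofD0 {R : URel k} [h : D0 R] : Sg n m R := ⟨SigR.d0 h⟩
instance (priority := 20) Pg.ofD0 {R : URel k} [h : D0 R] : Pg n m R := ⟨SigR.d0 h.not'⟩
instance (priority := 10) Sg.ofPg {R : URel k} [h : Pg n m R] : Sg n (m + 1) R :=
  ⟨h.out.neg.congr fun M _ v => not_not.symm⟩
instance (priority := 10) Pg.ofSg {R : URel k} [h : Sg n m R] : Pg n (m + 1) R := ⟨h.out.neg⟩
instance (priority := 10) Sg.up {R : URel k} [h : Sg n m R] : Sg n (m + 1) R := ⟨h.out.up⟩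
instance (priority := 10) Pg.up {R : URel k} [h : Pg n m R] : Pg n (m + 1) R := ⟨h.out.up⟩
instance Sg.not {R : URel k} [h : Pg n m R] : Sg n m (fun M v => ¬ R M v) := ⟨h.out⟩
instance Pg.not {R : URel k} [h : Sg n m R] : Pg n m (fun M v => ¬ R M v) :=
  ⟨h.out.congr fun M _ v => not_not⟩
instance Sg.and {R S : URel k} [hR : Sg n m R] [hS : Sg n m S] : Sg n m (fun M v => R M v ∧ S M v) :=
  ⟨(hR.out.andor hS.out).1⟩
instance Sg.or {R S : URel k} [hR : Sg n m R] [hS : Sg n m S] : Sg n m (fun M v => R M v ∨ S M v) :=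
  ⟨(hR.out.andor hS.out).2⟩
instance Pg.and {R S : URel k} [hR : Pg n m R] [hS : Pg n m S] : Pg n m (fun M v => R M v ∧ S M v) :=
  ⟨(hR.out.andor hS.out).2.congr fun M _ v => not_and_or⟩
instance Pg.or {R S : URel k} [hR : Pg n m R] [hS : Pg n m S] : Pg n m (fun M v => R M v ∨ S M v) :=
  ⟨(hR.out.andor hS.out).1.congr fun M _ v => not_or⟩
instance Sg.imp {R S : URel k} [hR : Pg n m R] [hS : Sg n m S] : Sg n m (fun M v => R M v → S M v) :=
  ⟨(hR.out.andor hS.out).2.congr fun M _ v => imp_iff_not_or⟩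
instance Pg.imp {R S : URel k} [hR : Sg n m R] [hS : Pg n m S] : Pg n m (fun M v => R M v → S M v) :=
  ⟨(hR.out.andor hS.out).1.congr fun M _ v => Classical.not_imp⟩
instance Sg.ex {Q : ∀ M : Mod, (Fin k → M) → M → Prop}
    [h : Sg n (m + 1) (fun M (w : Fin (k + 1) → M) => Q M (fun i => w i.castSucc) (w (Fin.last k)))] :
    Sg n (m + 1) (fun M v => ∃ x, Q M v x) :=
  ⟨h.out.ex.congr fun M _ v => by simp [snoc_init']⟩
instance Pg.all {Q : ∀ M : Mod, (Fin k → M) → M → Prop}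
    [h : Pg n (m + 1) (fun M (w : Fin (k + 1) → M) => Q M (fun i => w i.castSucc) (w (Fin.last k)))] :
    Pg n (m + 1) (fun M v => ∀ x, Q M v x) :=
  ⟨h.out.ex.congr fun M _ v => by simp [snoc_init']⟩
instance Sg.subst {R : URel j} {f : ∀ M : Mod, (Fin k → M) → Fin j → M} [h : Sg n m R] [hf : DFv f] :
    Sg n m (fun M v => R M (f M v)) := ⟨h.out.substF f⟩
instance Pg.subst {R : URel j} {f : ∀ M : Mod, (Fin k → M) → Fin j → M} [h : Pg n m R] [hf : DFv f] :
    Pg n m (fun M v => R M (f M v)) := ⟨h.out.substF f⟩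


/-- the bridge from formulas -/
theorem SigR.of_fm : (∀ r k (φ : lang.BoundedFormula Empty k), SigmaFm r k φ →
      SigR n r (fun M v => φ.Realize Empty.elim v)) ∧
    (∀ r k (φ : lang.BoundedFormula Empty k), PiFm r k φ →
      SigR n r (fun M v => ¬ φ.Realize Empty.elim v)) := by
  apply hier_ind
  · intro r k φ h; exact SigR.d0 ⟨φ, h, fun _ _ => Iff.rfl⟩
  · intro r k φ h; exact h.neg.congr fun M _ v => not_not.symm
  · intro r k φ h; exact h.ex.congr fun M _ v => by simp
  · intro r k φ h; exact SigR.d0 (D0.not' ⟨φ, h, fun _ _ => Iff.rfl⟩)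
  · intro r k φ h; exact h.neg
  · intro r k φ h; exact h.ex.congr fun M _ v => by simp

theorem SigR.to_fm {R : URel k} (h : SigR n m R) : ∃ φ : lang.BoundedFormula Empty k, SigmaFm m k φ ∧
    ∀ M : Mod, ISig n M → ∀ v, R M v ↔ φ.Realize Empty.elim v := by
  induction m generalizing k with
  | zero =>
    obtain ⟨S, ⟨φ, h1, h2⟩, h3⟩ := h
    exact ⟨φ, .delta0 _ _ h1, fun M hM v => (h3 M hM v).trans (h2 M v)⟩
  | succ m ih =>
    obtain ⟨S, h1, h2⟩ := h
    obtain ⟨φ, h3, h4⟩ := ih h1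
    obtain ⟨φ', h5, h6⟩ := hier_neg.1 _ _ _ h3
    refine ⟨φ'.ex, .ex _ _ (.ofPi _ _ h5), fun M hM v => ?_⟩
    rw [h2 M hM, BoundedFormula.realize_ex]
    refine exists_congr fun w => ?_
    rw [h6, h4 M hM]

/-- parametric definability -/
theorem SigR.def {R : URel (j + k)} (h : SigR n m R) (M : Mod) (hM : ISig n M) (p : Fin k → M) :
    IsSigmaDef m M (fun v : Fin j → M => R M (Fin.append v p)) := by
  obtain ⟨φ, h1, h2⟩ := h.to_fm
  obtain ⟨φ', h3, h4⟩ := h1.subst (β := M) (m := j)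
    (Sum.elim Empty.elim (Fin.append (fun i => Term.var (Sum.inr i)) (fun i => Term.var (Sum.inl (p i)))))
  obtain ⟨q, ψ, w, h5, h6⟩ := isSigmaDef_of_fm h3
  refine ⟨q, ψ, w, h5, fun v => ?_⟩
  rw [← h6]
  beta_reduce
  rw [h2 M hM, h4]
  have : (Empty.elim : Empty → M) = (fun a => Term.realize (Sum.elim id v)
    ((Sum.elim Empty.elim (Fin.append (fun i => Term.var (Sum.inr i)) (fun i => Term.var (Sum.inl (p i)))) : Empty ⊕ Fin (j + k) →
      lang.Term (M ⊕ Fin j)) (Sum.inl a))) := by ext a; exact a.elim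
  rw [← this]
  have e : (Fin.append v p) = fun i => Term.realize (Sum.elim id v)
    ((Sum.elim Empty.elim (Fin.append (fun i => Term.var (Sum.inr i)) (fun i => Term.var (Sum.inl (p i)))) : Empty ⊕ Fin (j + k) →
      lang.Term (M ⊕ Fin j)) (Sum.inr i)) := by
    ext i
    refine Fin.addCases (fun i => ?_) (fun i => ?_) i <;> simp
  rw [e]

theorem SigR.of_def {M : Mod} {R : (Fin j → M) → Prop} (h : IsSigmaDef m M R) (n : ℕ) :
    ∃ (k : ℕ) (R' : URel (j + k)) (p : Fin k → M), SigR n m R' ∧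
      ∀ v, R v ↔ R' M (Fin.append v p) := by
  obtain ⟨k, φ, w, h1, h2⟩ := h
  obtain ⟨φ', h3, h4⟩ := h1.subst (β := Empty) (m := j + k)
    (Sum.elim (Sum.elim (fun i => Term.var (Sum.inr (Fin.castAdd k i)))
      (fun i => Term.var (Sum.inr (Fin.natAdd j i)))) finZeroElim)
  refine ⟨k, _, w, (SigR.of_fm (n := n)).1 _ _ _ h3, fun v => ?_⟩
  rw [h2, h4]
  have e1 : Sum.elim v w = fun a => Term.realize (Sum.elim Empty.elim (Fin.append v w))
    ((Sum.elim (Sum.elim (fun i => Term.var (Sum.inr (Fin.castAdd k i)))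
      (fun i => Term.var (Sum.inr (Fin.natAdd j i)))) finZeroElim :
        (Fin j ⊕ Fin k) ⊕ Fin 0 → lang.Term (Empty ⊕ Fin (j + k))) (Sum.inl a)) := by
    ext (a | a) <;> simp
  rw [← e1]
  exact iff_of_eq (congrArg _ (Subsingleton.elim _ _))

/-- Σ_m induction, semantic -/
theorem Sg.ind {R : URel (1 + k)} [h : Sg n m R] (hm : m ≤ n) (M : Mod) (hM : ISig n M)
    (p : Fin k → M) (h0 : R M (Fin.append ![0] p))
    (hs : ∀ x, R M (Fin.append ![x] p) → R M (Fin.append ![x + 1] p)) (x : M) :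
    R M (Fin.append ![x] p) := by
  have key : ∀ v : Fin 1 → M, v = ![v 0] := fun v => by ext i; fin_cases i; rfl
  refine hM {x | R M (Fin.append ![x] p)} ?_ h0 hs x
  obtain ⟨q, φ, w, h1, h2⟩ := h.out.def M hM p (j := 1)
  exact ⟨q, φ, w, h1.mono hm, fun v => by
    rw [← h2]
    show R M (Fin.append ![v 0] p) ↔ R M (Fin.append v p)
    rw [← key v]⟩

/-- Transfer -/
theorem SigR.elem {R : URel k} (h : SigR n m R) {M N : Mod} (hM : ISig n M) (hN : ISig n N) {g : M → N}
    (hg : SigmaElem M N m g) (v : Fin k → M) : R M v ↔ R N (g ∘ v) := by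
  obtain ⟨φ, h1, h2⟩ := h.to_fm
  rw [h2 M hM, h2 N hN]
  obtain ⟨φ', h3, h4⟩ := h1.subst (β := Fin k) (m := 0)
    (Sum.elim Empty.elim (fun i => Term.var (Sum.inl i)))
  have e : ∀ (M : Type) [lang.Structure M] (v : Fin k → M),
      φ'.Realize v finZeroElim ↔ φ.Realize Empty.elim v := by
    intro M _ v
    rw [h4]
    have : (Empty.elim : Empty → M) = (fun a => Term.realize (Sum.elim v finZeroElim)
      ((Sum.elim Empty.elim (fun i => Term.var (Sum.inl i)) : Empty ⊕ Fin k →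
      lang.Term (Fin k ⊕ Fin 0)) (Sum.inl a))) := by ext a; exact a.elim
    rw [← this]
    rfl
  rw [← e, ← e]
  exact hg k φ' h3 v
end

end ArithFC

end

section
set_option linter.all false
open FirstOrder Language
namespace ArithFC

section
variable {n m k : ℕ}
theorem Sg.indQ {Q : ∀ M : Mod, (Fin k → M) → M → Prop}
    [h : Sg n m (fun M (w : Fin (k + 1) → M) => Q M (fun i => w i.castSucc) (w (Fin.last k)))]
    (hm : m ≤ n) (M : Mod) (hM : ISig n M) (p : Fin k → M) (h0 : Q M p 0)
    (hs : ∀ x, Q M p x → Q M p (x + 1)) (x : M) : Q M p x := by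
  have h' : Sg n m (fun M (w : Fin (1 + k) → M) => Q M (fun i => w (Fin.natAdd 1 i)) (w (Fin.castAdd k 0))) := by
    have := h.out.substF (k := 1 + k) (fun M w => Fin.snoc (fun i => w (Fin.natAdd 1 i)) (w (Fin.castAdd k 0)))
    exact ⟨this.congr fun M hM v => by simp [snoc_init']⟩
  have := Sg.ind (h := h') hm M hM p (by simpa using h0) (fun x hx => by simpa using hs x (by simpa using hx)) x
  simpa using this

theorem sigma1_ind {Q : ∀ M : Mod, (Fin k → M) → M → Prop}
    [h : Sg 1 1 (fun M (w : Fin (k + 1) → M) => Q M (fun i => w i.castSucc) (w (Fin.last k)))]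
    (M : Mod) (p : Fin k → M) (h0 : Q M p 0)
    (hs : ∀ x, Q M p x → Q M p (x + 1)) (x : M) : Q M p x :=
  Sg.indQ (h := h) le_rfl M AR.isig1 p h0 hs x
end

section
variable {M : Type} [lang.Structure M] [AR M]

theorem dvd_iff_md {x y : M} : x ∣ y ↔ md y x = 0 := by
  rcases eq_or_ne x 0 with rfl | h
  · rw [md_zero', zero_dvd_iff]
  · constructor
    · rintro ⟨c, rfl⟩
      symm; rw [md_iff]
      exact Or.inr ⟨pos_of_ne h, c, by rw [mul_comm]; exact le_mul_pos (pos_of_ne h), by ring⟩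
    · intro e
      obtain ⟨q, _, hq⟩ := md_eq y (pos_of_ne h)
      rw [e] at hq
      exact ⟨q, by rw [hq]; ring⟩

/-- invertible modulo m -/
def Inv (x m : M) : Prop := ∃ p, p < m ∧ md (p * x) m = 1

/-- β moduli -/
def mm (b i : M) : M := (i + 1) * b + 1

theorem mm_pos (b i : M) : 0 < mm b i := by unfold mm; rw [ltS]; exact zero_le

theorem one_lt_mm {b : M} (i : M) (hb : 0 < b) : 1 < mm b i := by
  unfold mm
  have : 0 < (i + 1) * b := by positivity
  grind

theorem inv_of {x m p q : M} (hm : 1 < m) (h : p * x = q * m + 1) : Inv x m := by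
  have hm0 : 0 < m := zero_lt_one.trans hm
  refine ⟨md p m, md_lt _ hm0, ?_⟩
  rw [md_mul_md hm0, h, add_comm, md_add_mul hm0, md_of_lt hm]

theorem Inv.spec {x m : M} (hm : 0 < m) (h : Inv x m) : ∃ p q, p * x = q * m + 1 := by
  obtain ⟨p, _, h⟩ := h
  obtain ⟨q, _, hq⟩ := md_eq (p * x) hm
  exact ⟨p, q, by rw [hq, h]⟩

theorem Inv.mul {x y m : M} (hm : 1 < m) (h : Inv x m) (h' : Inv y m) : Inv (x * y) m := by
  obtain ⟨p, q, e⟩ := h.spec (zero_lt_one.trans hm)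
  obtain ⟨p', q', e'⟩ := h'.spec (zero_lt_one.trans hm)
  refine inv_of (p := p * p') (q := q * q' * m + q + q') hm ?_
  calc p * p' * (x * y) = (p * x) * (p' * y) := by ring
    _ = _ := by rw [e, e']; ring

theorem Inv.symm {x m : M} (hm : 1 < m) (hx : 1 < x) (h : Inv x m) : Inv m x := by
  obtain ⟨p, q, e⟩ := h.spec (zero_lt_one.trans hm)
  obtain ⟨x', rfl⟩ : ∃ x', x = x' + 1 := by
    rcases zero_or_succ x with rfl | h
    · exact absurd hx (not_lt_zero'' _)
    · exact h
  have hx' : 0 < x' := by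
    rcases eq_or_ne x' 0 with rfl | h
    · simp at hx
    · exact pos_of_ne h
  have hp : 0 < p := by
    rcases eq_or_ne p 0 with rfl | h
    · rw [zero_mul] at e
      have := e.symm
      have h2 : 0 < q * m + 1 := by rw [ltS]; exact zero_le
      rw [this] at h2; exact absurd h2 (lt_irrefl _)
    · exact pos_of_ne h
  have hxp : 0 < x' * p := by positivity
  obtain ⟨j, hj⟩ : ∃ j, x' * p = j + 1 := by
    rcases zero_or_succ (x' * p) with h | h
    · rw [h] at hxp; exact absurd hxp (lt_irrefl _)
    · exact h
  refine inv_of (p := x' * q) (q := j) hx ?_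
  have : x' * q * m + (x' + 1) = (j * (x' + 1) + 1) + (x' + 1) := by
    calc x' * q * m + (x' + 1) = x' * (q * m + 1) + 1 := by ring
      _ = x' * p * (x' + 1) + 1 := by rw [← e]; ring
      _ = _ := by rw [hj]; ring
  exact add_right_cancel this

theorem Inv.dvd {x y m : M} (hm : 1 < m) (h : Inv x m) (hd : m ∣ x * y) : m ∣ y := by
  have hm0 := zero_lt_one.trans hm
  obtain ⟨p, q, e⟩ := h.spec hm0
  have : m ∣ p * (x * y) := Dvd.dvd.mul_left hd p
  rw [dvd_iff_md] at this ⊢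
  have e2 : p * (x * y) = y + (q * y) * m := by
    calc p * (x * y) = (p * x) * y := by ring
      _ = _ := by rw [e]; ring
  rwa [e2, md_add_mul hm0] at this

theorem inv_mm {b l : M} (hb : 0 < b) (hd : ∀ i, i < l → (i + 1) ∣ b) {i j : M} (hi : i ≤ l) (hj : j ≤ l)
    (hij : i ≠ j) : Inv (mm b i) (mm b j) := by
  have key : ∀ i j : M, i < j → j ≤ l → Inv (mm b j) (mm b i) := by
    intro i j hij hj
    obtain ⟨d, hd'⟩ := exists_add_of_le (Sle.mpr hij)
    have hdl : d < l := by
      refine lt_of_lt_of_le ?_ hj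
      rw [hd']
      have : d < i + d + 1 := by rw [ltS]; exact le_add_self
      calc d < i + d + 1 := this
        _ = _ := by ring
    obtain ⟨c, hc⟩ := hd d hdl
    have ht : 0 < (i + 1) * b := by positivity
    obtain ⟨t', ht'⟩ : ∃ t', (i + 1) * b = t' + 1 := by
      rcases zero_or_succ ((i + 1) * b) with h | h
      · rw [h] at ht; exact absurd ht (lt_irrefl _)
      · exact h
    refine inv_of (p := c * (i + 1) * (i + 1)) (q := c * (i + 1) * (i + 1) + t') (one_lt_mm i hb) ?_
    have e1 : c * (i + 1) * (i + 1) * mm b j = c * (i + 1) * (i + 1) * mm b i + ((i + 1) * b) * ((i + 1) * b) := by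
      unfold mm
      rw [hd']
      calc c * (i + 1) * (i + 1) * ((i + 1 + d + 1) * b + 1)
          = c * (i + 1) * (i + 1) * ((i + 1) * b + 1) + (i + 1) * (i + 1) * b * ((d + 1) * c) := by ring
        _ = _ := by rw [← hc]; ring
    rw [e1]
    have e2 : ((i + 1) * b) * ((i + 1) * b) = t' * mm b i + 1 := by
      unfold mm; rw [ht']; ring
    rw [e2]; ring
  rcases lt_or_gt_of_ne hij with h | h
  · exact (key i j h hj).symm (one_lt_mm _ hb) (one_lt_mm _ hb)
  · exact key j i h hi
end

instance : D02 (fun M : Mod => fun x y : M => x ∣ y) :=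
  ⟨(inferInstance : D0 (fun M (v : Fin 2 → M) => md (v 1) (v 0) = 0)).congr fun M v => dvd_iff_md⟩
instance D0.dvdI {k : ℕ} {f g : UFun k} [DF f] [DF g] : D0 (fun M v => f M v ∣ g M v) :=
  (inferInstance : D0 (fun M v => md (g M v) (f M v) = 0)).congr fun M v => dvd_iff_md
instance LD.dvdI {M : Type} [lang.Structure M] [AR M] {k : ℕ} {f g : (Fin k → M) → M} [LF f] [LF g] : LD (fun v => f v ∣ g v) :=
  (inferInstance : LD (fun v => md (g v) (f v) = 0)).congr fun v => dvd_iff_md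
instance : D02 (fun M : Mod => Inv (M := M)) := ⟨by unfold Inv; infer_instance⟩
instance : DF2 (fun M : Mod => mm (M := M)) := ⟨by unfold mm; infer_instance⟩
instance {M : Type} [lang.Structure M] [AR M] : LD2 (Inv (M := M)) := D02.toLD (P := fun M => Inv) inferInstance
instance {M : Type} [lang.Structure M] [AR M] : LF2 (mm (M := M)) := DF2.toLF (P := fun M => mm) inferInstance

section
variable {M : Type} [lang.Structure M] [AR M]

theorem ex_b (l u : M) : ∃ b, u ≤ b ∧ 0 < b ∧ ∀ i, i < l → (i + 1) ∣ b := by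
  refine sigma1_ind (k := 1) (Q := fun M p x => ∃ b, p 0 ≤ b ∧ 0 < b ∧ ∀ i, i < x → (i + 1) ∣ b)
    ⟨M, inferInstance, inferInstance⟩ ![u] ?_ ?_ l
  · exact ⟨u + 1, (lt_add_one u).le, by positivity, fun i hi => absurd hi (not_lt_zero'' i)⟩
  · rintro (x : M) ⟨(b : M), h1, h2, h3⟩
    have h2' : (0 : M) < b := h2
    refine ⟨b * (x + 1), le_trans h1 (le_mul_pos (by positivity)), ?_, fun (i : M) hi => ?_⟩
    · show (0 : M) < b * (x + 1)
      positivity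
    · rcases (ltS.mp hi).lt_or_eq with h | rfl
      · exact Dvd.dvd.mul_right (h3 i h) _
      · exact Dvd.intro_left b rfl

theorem ex_A {b l : M} (hb : 0 < b) (hd : ∀ i, i < l → (i + 1) ∣ b) : ∃ A, 0 < A ∧ (∀ i, i < l → mm b i ∣ A) ∧
    (∀ t, t < l → ∃ B, B ≤ A ∧ (0 < B ∧ (∀ i, i < t → mm b i ∣ B) ∧ Inv B (mm b t))) := by
  have := sigma1_ind (k := 2) (Q := fun M p x => x ≤ p 1 → ∃ A, 0 < A ∧ (∀ i, i < x → mm (p 0) i ∣ A) ∧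
    (∀ j, j ≤ p 1 → x ≤ j → Inv A (mm (p 0) j)) ∧
    (∀ t, t < x → ∃ B, B ≤ A ∧ (0 < B ∧ (∀ i, i < t → mm (p 0) i ∣ B) ∧ Inv B (mm (p 0) t))))
    ⟨M, inferInstance, inferInstance⟩ ![b, l] ?_ ?_ l
  · obtain ⟨A, h1, h2, _, h4⟩ := this le_rfl
    exact ⟨A, h1, h2, h4⟩
  · intro _
    refine ⟨(1 : M), zero_lt_one, fun i hi => absurd hi (not_lt_zero'' i), fun j _ _ => ?_,
      fun i hi => absurd hi (not_lt_zero'' i)⟩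
    exact inv_of (p := 1) (q := 0) (one_lt_mm j hb) (by ring)
  · intro (x : M) ih (hx : x + 1 ≤ l)
    have hxl : x < l := Sle.mp hx
    obtain ⟨(A : M), h1, h2, h3, h4⟩ := ih hxl.le
    have h1' : 0 < A := h1
    have hle : A ≤ A * mm b x := le_mul_pos (mm_pos _ _)
    refine ⟨A * mm b x, lt_of_lt_of_le h1 hle, fun (i : M) hi => ?_, fun (j : M) hj hxj => ?_, fun (t : M) ht => ?_⟩
    · rcases (ltS.mp hi).lt_or_eq with h | rfl
      · exact Dvd.dvd.mul_right (h2 i h) _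
      · exact Dvd.intro_left A rfl
    · have hxj' : x < j := Sle.mp hxj
      exact Inv.mul (one_lt_mm j hb) (h3 j hj hxj'.le) (inv_mm hb hd hxl.le hj hxj'.ne)
    · rcases (ltS.mp ht).lt_or_eq with h | rfl
      · obtain ⟨B, hB, hB2⟩ := h4 t h
        exact ⟨B, le_trans hB hle, hB2⟩
      · exact ⟨A, hle, h1, h2, h3 t hxl.le le_rfl⟩

/-- `w` bounds codes of sequences of length `l` with values below `u` -/
def Bnd (l u w : M) : Prop := ∃ b, b < w ∧ ∃ A, A < w ∧ (pr A b ≤ w ∧ u ≤ b ∧ 0 < b ∧ 0 < A ∧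
  (∀ i, i < l → mm b i ∣ A) ∧
  (∀ t, t < l → ∃ B, B ≤ A ∧ (0 < B ∧ (∀ i, i < t → mm b i ∣ B) ∧ Inv B (mm b t))))

theorem ex_bnd (l u : M) : ∃ w, Bnd l u w := by
  obtain ⟨b, h1, h2, h3⟩ := ex_b l u
  obtain ⟨A, h4, h5, h6⟩ := ex_A h2 h3
  exact ⟨pr A b + 1, b, ltS.mpr (le_pr2 _ _), A, ltS.mpr (le_pr1 _ _), (lt_add_one _).le, h1, h2, h4, h5, h6⟩

theorem ev_pr (a b i : M) : ev (pr a b) i = md a (mm b i) := by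
  unfold ev mm; simp

theorem pr_lt_left {a A b : M} (h : a < A) : pr a b < pr A b := by
  refine lt_of_le_of_ne (pr_mono h.le le_rfl) fun e => ?_
  exact h.ne (pr_inj e).1

theorem dvd_md {a A m : M} (hA : 0 < A) (hm : 0 < m) (h : m ∣ A) : md (md a A) m = md a m := by
  obtain ⟨q, _, hq⟩ := md_eq a hA
  obtain ⟨c, hc⟩ := h
  rw [md_congr hm]
  refine ⟨q * c, 0, ?_⟩
  conv_rhs => rw [hq]
  rw [hc]; ring

theorem coding {l u w : M} (R : M → M → Prop) [LD2 R] (hB : Bnd l u w)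
    (h : ∀ i, i < l → ∃ x, x < u ∧ R i x) : ∃ s, s < w ∧ ∀ i, i < l → R i (ev s i) ∧ ev s i < u := by
  obtain ⟨b, _, A, _, hw, hu, hb, hA, h1, h2⟩ := hB
  have := LD.ind (P := fun t => t ≤ l → ∃ a, a < A ∧ ∀ i, i < t → (R i (md a (mm b i)) ∧ md a (mm b i) < u)) inferInstance ?_ ?_ l le_rfl
  · obtain ⟨a, ha, ha2⟩ := this
    refine ⟨pr a b, lt_of_lt_of_le (pr_lt_left ha) hw, fun i hi => ?_⟩
    rw [ev_pr]; exact ha2 i hi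
  · intro _
    exact ⟨0, hA, fun i hi => absurd hi (not_lt_zero'' i)⟩
  · intro t ih ht
    have htl := Sle.mp ht
    obtain ⟨a, ha, ha2⟩ := ih htl.le
    obtain ⟨B, _, hB0, hB1, hB2⟩ := h2 t htl
    obtain ⟨x, hx, hx2⟩ := h t htl
    have hm := mm_pos b t
    obtain ⟨p, q, e⟩ := hB2.spec hm
    have hxm : x < mm b t := by
      refine (hx.trans_le hu).trans_le ?_
      unfold mm
      calc b ≤ b * (t + 1) := le_mul_pos (by positivity)
        _ = (t + 1) * b := by ring
        _ ≤ _ := le_self_add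
    have key : ∀ i, i < t → md (md (a + B * p * (x + ((t + 1) * b) * a)) A) (mm b i) = md a (mm b i) := by
      intro i hi
      rw [dvd_md hA (mm_pos b i) (h1 i (hi.trans htl))]
      obtain ⟨c, hc⟩ := hB1 i hi
      rw [hc]
      have : a + mm b i * c * p * (x + (t + 1) * b * a) = a + (c * p * (x + (t + 1) * b * a)) * mm b i := by ring
      rw [this, md_add_mul (mm_pos b i)]
    have key2 : md (md (a + B * p * (x + ((t + 1) * b) * a)) A) (mm b t) = x := by
      rw [dvd_md hA hm (h1 t htl)]
      have : a + B * p * (x + ((t + 1) * b) * a) = x + (a + q * (x + ((t + 1) * b) * a)) * mm b t := by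
        calc a + B * p * (x + ((t + 1) * b) * a) = a + (p * B) * (x + ((t + 1) * b) * a) := by ring
          _ = _ := by rw [e]; unfold mm; ring
      rw [this, md_add_mul hm, md_of_lt hxm]
    refine ⟨_, md_lt (a + B * p * (x + ((t + 1) * b) * a)) hA, fun i hi => ?_⟩
    rcases (ltS.mp hi).lt_or_eq with h | rfl
    · rw [key i h]; exact ha2 i h
    · rw [key2]; exact ⟨hx2, hx⟩

end

instance : D03 (fun M : Mod => Bnd (M := M)) := ⟨by unfold Bnd; infer_instance⟩
instance {M : Type} [lang.Structure M] [AR M] : LD3 (Bnd (M := M)) := D03.toLD (P := fun M => Bnd) inferInstance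

end ArithFC

end

section
set_option linter.all false
open FirstOrder Language
namespace ArithFC

section
variable {n m k : ℕ}

theorem SigR.bdEx {R : URel (k + 1)} (h : SigR n m R) (f : UFun k) [hf : DF f] :
    SigR n m (fun M v => ∃ x, x < f M v ∧ R M (Fin.snoc v x)) := by
  cases m with
  | zero =>
    obtain ⟨S, h1, h2⟩ := h
    exact ⟨_, h1.bdExF hf, fun M hM v => by simp only [h2 M hM]⟩
  | succ m =>
    have h' : Sg n (m + 1) R := ⟨h⟩
    have hf' : DF (fun M (w : Fin (k + 1) → M) => f M (fun i => w i.castSucc)) := hf.vars _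
    exact (inferInstance : Sg n (m + 1) (fun M v => ∃ x, x < f M v ∧ R M (Fin.snoc v x))).out

/-- local collection from induction -/
theorem coll_aux {S : URel (k + 2)} (hm : m + 1 ≤ n)
    (hb : ∀ {k : ℕ} {R : URel (k + 1)} (f : UFun k) [hf : DF f], SigR n m R →
      SigR n m (fun M v => ∀ x, x < f M v → R M (Fin.snoc v x)))
    (h : SigR n m (fun M v => ¬ S M v)) (M : Mod) (hM : ISig n M) (p : Fin k → M) (u : M)
    (hu : ∀ x, x < u → ∃ w, S M (Fin.snoc (Fin.snoc p x) w)) :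
    ∃ b, ∀ x, x < u → ∃ w, w < b ∧ S M (Fin.snoc (Fin.snoc p x) w) := by
  have h1 : SigR n m (k := k + 2) (fun M v => ¬ ∃ w, w < v (Fin.last _).castSucc ∧
      S M (Fin.snoc (Fin.snoc (fun i => v i.castSucc.castSucc) (v (Fin.last _))) w)) := by
    have h2 := h.substF (k := k + 3) (fun M v => Fin.snoc (Fin.snoc (fun i => v i.castSucc.castSucc.castSucc)
      (v (Fin.last _).castSucc)) (v (Fin.last _)))
    refine (hb (fun M v => v (Fin.last _).castSucc) h2).congr fun M _ v => ?_
    simp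
  have h3 := h1.bdEx (k := k + 1) (fun M v => v (Fin.last _))
  have h4 : Pg n m (k := k + 2) (fun M v => ∀ x, x < v (Fin.last (k + 1)) → ∃ w, w < v (Fin.last k).castSucc ∧ S M (Fin.snoc (Fin.snoc (fun i => v i.castSucc.castSucc) x) w)) := by
    constructor
    have h5 := (h1.substF (k := k + 3) (fun M v => Fin.snoc (fun i => v i.castSucc.castSucc) (v (Fin.last _)))).bdEx
      (fun M v => v (Fin.last _))
    refine h5.congr fun M _ v => ?_
    push Not
    have e : ∀ (x : M), ((fun i : Fin (k + 1) => v (Fin.castSucc i)) (Fin.last k)) = v (Fin.last k).castSucc := fun _ => rfl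
    simp
  have h6 : Pg n m (k := k + 2) (fun M v => ∀ x, x < v (Fin.last k).castSucc → ∃ w, w < v (Fin.last _) ∧ S M (Fin.snoc (Fin.snoc (fun i => v i.castSucc.castSucc) x) w)) := by
    have := h4.out.substF (k := k + 2) (fun M v => Fin.snoc (Fin.snoc (fun i => v i.castSucc.castSucc) (v (Fin.last _))) (v (Fin.last _).castSucc))
    exact ⟨this.congr fun M _ v => by simp⟩
  have := Sg.indQ (Q := fun M p y => y ≤ p (Fin.last k) → ∃ b, ∀ x, x < y → ∃ w, w < b ∧ S M (Fin.snoc (Fin.snoc (fun i => p i.castSucc) x) w))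
    (h := by
      have a1 : D0 (k := k + 2) (fun M v => v (Fin.last _) ≤ v (Fin.castSucc (Fin.last k))) := inferInstance
      have h7 := h6.out.substF (k := k + 3) (fun M v => Fin.snoc (Fin.snoc (fun i => v i.castSucc.castSucc.castSucc) (v (Fin.last _).castSucc)) (v (Fin.last _)))
      have h8 : Pg n m (k := k + 3) (fun M v => ∀ x, x < v (Fin.last _).castSucc → ∃ w, w < v (Fin.last _) ∧ S M (Fin.snoc (Fin.snoc (fun i => v i.castSucc.castSucc.castSucc) x) w)) :=
        ⟨h7.congr fun M _ v => by simp⟩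
      have h9 : Sg n (m + 1) (k := k + 2) (fun M v => ∃ b, ∀ x, x < v (Fin.last _) → ∃ w, w < b ∧ S M (Fin.snoc (Fin.snoc (fun i => v i.castSucc.castSucc) x) w)) := by
        have := (Sg.ofPg (h := h8)).out.ex
        exact ⟨this.congr fun M _ v => by simp⟩
      exact Sg.imp (hR := Pg.ofD0 (h := a1)) (hS := h9)) hm M hM (Fin.snoc p u) ?_ ?_ u (by simp)
  · simpa [snoc_init'] using this
  · intro _
    exact ⟨0, fun x hx => absurd hx (not_lt_zero'' x)⟩
  · intro y ih hy
    simp only [Fin.snoc_last, snoc_init'] at ih hy ⊢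
    have hy' := Sle.mp hy
    obtain ⟨b, hb⟩ := ih hy'.le
    obtain ⟨w, hw⟩ := hu y hy'
    refine ⟨max b (w + 1), fun x hx => ?_⟩
    rcases (ltS.mp hx).lt_or_eq with h | rfl
    · obtain ⟨w', h1, h2⟩ := hb x h
      exact ⟨w', lt_of_lt_of_le h1 (le_max_left _ _), h2⟩
    · exact ⟨w, lt_of_lt_of_le (lt_add_one w) (le_max_right _ _), hw⟩

theorem SigR.bdAll (hm : m ≤ n) {R : URel (k + 1)} (f : UFun k) [hf : DF f] (h : SigR n m R) :
    SigR n m (fun M v => ∀ x, x < f M v → R M (Fin.snoc v x)) := by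
  induction m generalizing k with
  | zero =>
    obtain ⟨S, h1, h2⟩ := h
    refine SigR.congr (SigR.d0 (m := 0) ((h1.not'.bdExF hf).not')) fun M hM v => ?_
    simp only [h2 M hM]
    push Not
    rfl
  | succ m ih =>
    obtain ⟨S, h1, h2⟩ := h
    have hb : ∀ {k : ℕ} {R : URel (k + 1)} (f : UFun k) [hf : DF f], SigR n m R →
      SigR n m (fun M v => ∀ x, x < f M v → R M (Fin.snoc v x)) := fun f _ h => ih (by omega) f h
    have h3 := h1.substF (k := k + 3) (fun M v => Fin.snoc (Fin.snoc (fun i => v i.castSucc.castSucc.castSucc)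
      (v (Fin.last _).castSucc)) (v (Fin.last _)))
    have hf' : DF (k := k + 1) (fun M v => f M (fun i => v i.castSucc)) := hf.vars _
    have h4 := (hb (fun M v => v (Fin.last _).castSucc) h3).bdEx (fun M v => f M (fun i => v i.castSucc))
    refine ⟨_, h4, fun M hM v => ?_⟩
    simp only [Fin.snoc_last, snoc_init', Fin.snoc_castSucc]
    push Not
    constructor
    · intro hv
      obtain ⟨b, hb⟩ := coll_aux (S := fun M v => ¬ S M v) hm hb (h1.congr fun M _ v => not_not) M hM v (f M v)
        (fun x hx => (h2 M hM _).mp (hv x hx))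
      exact ⟨b, hb⟩
    · rintro ⟨b, hb⟩ x hx
      obtain ⟨w, _, hw⟩ := hb x hx
      exact (h2 M hM _).mpr ⟨w, hw⟩

instance Sg.exLt {Q : ∀ M : Mod, (Fin k → M) → M → Prop} {t : UFun k} [ht : DF t]
    [h : Sg n m (fun M (w : Fin (k + 1) → M) => Q M (fun i => w i.castSucc) (w (Fin.last k)))] :
    Sg n m (fun M v => ∃ x, x < t M v ∧ Q M v x) :=
  ⟨(h.out.bdEx t).congr fun M _ v => by simp [snoc_init']⟩
instance Sg.allLt [hm : Fact (m ≤ n)] {Q : ∀ M : Mod, (Fin k → M) → M → Prop} {t : UFun k} [ht : DF t]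
    [h : Sg n m (fun M (w : Fin (k + 1) → M) => Q M (fun i => w i.castSucc) (w (Fin.last k)))] :
    Sg n m (fun M v => ∀ x, x < t M v → Q M v x) :=
  ⟨(h.out.bdAll hm.out t).congr fun M _ v => by simp [snoc_init']⟩
instance Pg.allLt {Q : ∀ M : Mod, (Fin k → M) → M → Prop} {t : UFun k} [ht : DF t]
    [h : Pg n m (fun M (w : Fin (k + 1) → M) => Q M (fun i => w i.castSucc) (w (Fin.last k)))] :
    Pg n m (fun M v => ∀ x, x < t M v → Q M v x) :=
  ⟨(h.out.bdEx t).congr fun M _ v => by simp [snoc_init']⟩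
instance Pg.exLt [hm : Fact (m ≤ n)] {Q : ∀ M : Mod, (Fin k → M) → M → Prop} {t : UFun k} [ht : DF t]
    [h : Pg n m (fun M (w : Fin (k + 1) → M) => Q M (fun i => w i.castSucc) (w (Fin.last k)))] :
    Pg n m (fun M v => ∃ x, x < t M v ∧ Q M v x) :=
  ⟨(h.out.bdAll hm.out t).congr fun M _ v => by simp [snoc_init']⟩

theorem le_iff_lt_add_one' {M : Type} [lang.Structure M] [PAM M] {x y : M} : x ≤ y ↔ x < y + 1 := ltS.symm

instance Sg.exLe {Q : ∀ M : Mod, (Fin k → M) → M → Prop} {t : UFun k} [ht : DF t]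
    [h : Sg n m (fun M (w : Fin (k + 1) → M) => Q M (fun i => w i.castSucc) (w (Fin.last k)))] :
    Sg n m (fun M v => ∃ x, x ≤ t M v ∧ Q M v x) :=
  (inferInstance : Sg n m (fun M v => ∃ x, x < t M v + 1 ∧ Q M v x)).congr fun M _ v => by simp only [ltS]
instance Sg.allLe [hm : Fact (m ≤ n)] {Q : ∀ M : Mod, (Fin k → M) → M → Prop} {t : UFun k} [ht : DF t]
    [h : Sg n m (fun M (w : Fin (k + 1) → M) => Q M (fun i => w i.castSucc) (w (Fin.last k)))] :
    Sg n m (fun M v => ∀ x, x ≤ t M v → Q M v x) :=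
  (inferInstance : Sg n m (fun M v => ∀ x, x < t M v + 1 → Q M v x)).congr fun M _ v => by simp only [ltS]
instance Pg.allLe {Q : ∀ M : Mod, (Fin k → M) → M → Prop} {t : UFun k} [ht : DF t]
    [h : Pg n m (fun M (w : Fin (k + 1) → M) => Q M (fun i => w i.castSucc) (w (Fin.last k)))] :
    Pg n m (fun M v => ∀ x, x ≤ t M v → Q M v x) :=
  (inferInstance : Pg n m (fun M v => ∀ x, x < t M v + 1 → Q M v x)).congr fun M _ v => by simp only [ltS]
instance Pg.exLe [hm : Fact (m ≤ n)] {Q : ∀ M : Mod, (Fin k → M) → M → Prop} {t : UFun k} [ht : DF t]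
    [h : Pg n m (fun M (w : Fin (k + 1) → M) => Q M (fun i => w i.castSucc) (w (Fin.last k)))] :
    Pg n m (fun M v => ∃ x, x ≤ t M v ∧ Q M v x) :=
  (inferInstance : Pg n m (fun M v => ∃ x, x < t M v + 1 ∧ Q M v x)).congr fun M _ v => by simp only [ltS]

instance : Fact (n ≤ n) := ⟨le_rfl⟩

/-- least number principle for Π_n -/
theorem Pg.lnp {Q : ∀ M : Mod, (Fin k → M) → M → Prop}
    [h : Pg n n (fun M (w : Fin (k + 1) → M) => Q M (fun i => w i.castSucc) (w (Fin.last k)))]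
    (M : Mod) (hM : ISig n M) (p : Fin k → M) {x : M} (hx : Q M p x) :
    ∃ y, Q M p y ∧ ∀ z, z < y → ¬ Q M p z := by
  by_contra hc
  push Not at hc
  have := Sg.indQ (n := n) (m := n) (Q := fun M p x => ∀ y, y < x → ¬ Q M p y)
    (h := by
      have h2 : Pg n n (k := k + 2) (fun M w => Q M (fun i => w i.castSucc.castSucc) (w (Fin.last _))) := by
        have := h.out.substF (k := k + 2) (fun M v => Fin.snoc (fun i => v i.castSucc.castSucc) (v (Fin.last _)))
        exact ⟨this.congr fun M _ v => by simp [snoc_init']⟩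
      exact Sg.allLt (Q := fun M (v : Fin (k + 1) → M) y => ¬ Q M (fun i => v i.castSucc) y)) le_rfl M hM p
    (fun y hy => absurd hy (not_lt_zero'' y)) (fun y ih z hz hq => by
      rcases (ltS.mp hz).lt_or_eq with h | rfl
      · exact ih z h hq
      · obtain ⟨z', h1, h2⟩ := hc z hq
        exact ih z' h1 h2) (x + 1)
  exact this x (lt_add_one x) hx

/-- Σ_n sets are coded locally -/
theorem Sg.code {R : URel (k + 1)} [h : Sg n n R] (M : Mod) (hM : ISig n M) (p : Fin k → M) (u : M) :
    ∃ b c : M, ∀ x, x < u → (R M (Fin.snoc p x) ↔ mm b x ∣ c) := by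
  obtain ⟨b, _, hb, hd⟩ := ex_b u 0
  obtain ⟨A, hA, hA1, _⟩ := ex_A hb hd
  obtain ⟨c, ⟨hc0, hc1⟩, hc2⟩ := Pg.lnp (n := n) (k := k + 2) (Q := fun M q c => 0 < c ∧
    ∀ x, x < q (Fin.natAdd k 0) → R M (Fin.snoc (fun i => q (Fin.castAdd 2 i)) x) → mm (q (Fin.natAdd k 1)) x ∣ c)
    M hM (Fin.append p ![u, b]) (x := A) ⟨hA, fun x hx _ => by
      simp only [Fin.append_right] at hx ⊢; exact hA1 x hx⟩
  simp only [Fin.append_left, Fin.append_right] at hc1 hc2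
  refine ⟨b, c, fun x hx => ⟨hc1 x hx, fun hdv => ?_⟩⟩
  by_contra hR
  obtain ⟨c', rfl⟩ := hdv
  have hc' : 0 < c' := by
    refine pos_of_ne fun h => ?_
    rw [h, mul_zero] at hc0; exact lt_irrefl _ hc0
  refine hc2 c' ?_ ⟨hc', fun z hz hRz => ?_⟩
  · calc c' = 1 * c' := (one_mul _).symm
      _ < mm b x * c' := mul_lt_mul_of_pos_right (one_lt_mm x hb) hc'
  · have hne : x ≠ z := by rintro rfl; exact hR hRz
    exact (inv_mm hb hd (le_of_lt hx) (le_of_lt hz) hne).dvd (one_lt_mm _ hb) (hc1 z hz hRz)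
end

/-- encode tuples -/
noncomputable def enc : ∀ k : ℕ, UFun k
  | 0 => fun M v => 0
  | k + 1 => fun M v => pr (enc k M (fun i => v i.castSucc)) (v (Fin.last k))
/-- decode tuples -/
noncomputable def dec : ∀ (k : ℕ) (M : Mod), M → Fin k → M
  | 0, M, z => ![]
  | k + 1, M, z => Fin.snoc (dec k M (p1 z)) (p2 z)

theorem dec_enc {k : ℕ} (M : Mod) (v : Fin k → M) : dec k M (enc k M v) = v := by
  induction k with
  | zero => exact Subsingleton.elim _ _
  | succ k ih =>
    simp only [enc, dec, p1_pr, p2_pr, ih]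
    ext i
    refine Fin.lastCases ?_ (fun i => ?_) i <;> simp

instance enc.df {k : ℕ} : DF (enc k) := by
  induction k with
  | zero => exact DF.zero
  | succ k ih =>
    have := ih.vars (k := k + 1) Fin.castSucc
    exact (inferInstance : DF (fun M (v : Fin (k + 1) → M) => pr (enc k M (fun i => v i.castSucc)) (v (Fin.last k))))

theorem dec.df {k j : ℕ} (f : UFun j) [hf : DF f] : DFv (fun M v => dec k M (f M v)) := by
  induction k generalizing f with
  | zero => exact ⟨fun i => i.elim0⟩
  | succ k ih =>
    have := ih (fun M v => p1 (f M v))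
    exact (inferInstance : DFv (fun M v => (Fin.snoc (dec k M (p1 (f M v))) (p2 (f M v)) : Fin (k + 1) → M)))
instance dec.dfi {k j : ℕ} {f : UFun j} [hf : DF f] : DFv (fun M v => dec k M (f M v)) := dec.df f

section
variable {n k : ℕ}
/-- Σ_n relations are locally Δ₀ in models of IΣ_n -/
theorem Sg.toLD {R : URel k} (h : Sg n n R) (M : Mod) (hM : ISig n M) : LD (R M) := by
  have h1 : Sg n n (fun M (w : Fin 1 → M) => R M (dec k M (w 0))) := inferInstance
  have h2 : LD1 (fun x : M => R M (dec k M x)) := by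
    constructor
    refine LD.local fun u => ?_
    obtain ⟨b, c, hbc⟩ := Sg.code (h := h1) M hM ![] u
    refine ⟨fun v => mm b (v 0) ∣ c, inferInstance, fun v hv => ?_⟩
    exact hbc (v 0) (hv 0)
  have h3 : LF (enc k M) := (enc.df (k := k)).toLF
  exact (LD.app1 (P := fun x : M => R M (dec k M x)) (f0 := enc k M)).congr fun v => by
    simp only [dec_enc]

theorem Pg.toLD {R : URel k} (h : Pg n n R) (M : Mod) (hM : ISig n M) : LD (R M) :=
  (Sg.toLD (n := n) (R := fun M v => ¬ R M v) ⟨h.out⟩ M hM).not'.congr fun v => not_not.symm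

/-- strong collection for Σ_n -/
theorem strong_coll {R : URel (k + 2)} [h : Sg n n R] (hn : 1 ≤ n) (M : Mod) (hM : ISig n M) (p : Fin k → M) (u : M) :
    ∃ b, ∀ x, x < u → (∃ w, R M (Fin.snoc (Fin.snoc p x) w)) →
      ∃ w, w < b ∧ R M (Fin.snoc (Fin.snoc p x) w) := by
  obtain ⟨m, rfl⟩ : ∃ m, n = m + 1 := ⟨n - 1, by omega⟩
  obtain ⟨S, hS, hS2⟩ := h.out
  have hE : Sg (m + 1) (m + 1) (k := k + 1) (fun M v => ∃ w, R M (Fin.snoc v w)) := ⟨h.out.ex⟩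
  obtain ⟨b, c, hbc⟩ := Sg.code (h := hE) M hM p u
  have hS' : Sg (m + 1) m S := ⟨hS⟩
  have hT : Pg (m + 1) m (k := (k + 2) + 2) (fun M v => mm (v ((Fin.natAdd k 0 : Fin (k + 2)).castSucc.castSucc)) (v (Fin.last _).castSucc) ∣ v ((Fin.natAdd k 1 : Fin (k + 2)).castSucc.castSucc)
      → ¬ S M (Fin.snoc (Fin.snoc (Fin.snoc (fun i : Fin k => v ((Fin.castAdd 2 i).castSucc.castSucc)) (v (Fin.last _).castSucc)) (p1 (v (Fin.last _)))) (p2 (v (Fin.last _))))) := inferInstance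
  obtain ⟨B, hB⟩ := coll_aux (n := m + 1) (m := m) (k := k + 2) le_rfl (fun f _ h => SigR.bdAll (by omega) f h)
    hT.out M hM (Fin.append p ![b, c]) u (by
      intro x hx
      by_cases hd : mm b x ∣ c
      · obtain ⟨w, hw⟩ := (hbc x hx).mpr hd
        rw [hS2 M hM] at hw
        obtain ⟨z, hz⟩ := hw
        refine ⟨pr w z, fun _ => ?_⟩
        simpa only [Fin.snoc_castSucc, Fin.snoc_last, Fin.append_right, Fin.append_left, Matrix.cons_val_zero, Matrix.cons_val_one, p1_pr, p2_pr, not_not] using hz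
      · exact ⟨0, fun h => absurd (by simpa only [Fin.snoc_castSucc, Fin.snoc_last, Fin.append_right, Fin.append_left, Matrix.cons_val_zero, Matrix.cons_val_one, p1_pr, p2_pr, not_not] using h) hd⟩)
  refine ⟨B, fun x hx hw => ?_⟩
  obtain ⟨z, hz, hz2⟩ := hB x hx
  refine ⟨p1 z, (p1_le z).trans_lt hz, ?_⟩
  rw [hS2 M hM]
  exact ⟨p2 z, by simpa only [Fin.snoc_castSucc, Fin.snoc_last, Fin.append_right, Fin.append_left, Matrix.cons_val_zero, Matrix.cons_val_one, p1_pr, p2_pr, not_not] using hz2 (by simpa only [Fin.snoc_castSucc, Fin.snoc_last, Fin.append_right, Fin.append_left, Matrix.cons_val_zero, Matrix.cons_val_one, p1_pr, p2_pr, not_not] using (hbc x hx).mp hw)⟩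
end

end ArithFC

end

section
set_option linter.all false
open FirstOrder Language
set_option synthInstance.maxHeartbeats 400000
set_option synthInstance.maxSize 2000
set_option maxHeartbeats 1000000
namespace ArithFC

section
variable {M : Type} [lang.Structure M] [AR M]

theorem codingL {l u w : M} (R : M → M → Prop) (hB : Bnd l u w)
    (h : ∀ i, i < l → ∃ x, x < u ∧ R i x)
    (hR : LD (fun v : Fin 2 → M => R (v 0) (v 1)) := by infer_instance) :
    ∃ s, s < w ∧ ∀ i, i < l → R i (ev s i) ∧ ev s i < u :=
  have : LD2 R := ⟨hR⟩
  coding R hB h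

/-- pigeonhole principle -/
theorem php {A B : M} (R : M → M → Prop) (hR : LD (fun v : Fin 2 → M => R (v 0) (v 1))) (hAB : B < A)
    (h : ∀ x, x < A → ∃ y, y < B ∧ R x y) :
    ∃ x y z, x < y ∧ y < A ∧ R x z ∧ R y z := by
  have h01 : (0 : M) < 1 := zero_lt_one
  have hR2 : LD2 R := ⟨hR⟩
  obtain ⟨w, hw⟩ := ex_bnd (A + 1) (A + 1)
  have key := LD.ind (P := fun C => C < A → ∀ s, s < w → (∀ i, i ≤ C → ev s i < C) →
    ∃ y, y ≤ C ∧ ∃ x, x < y ∧ ev s x = ev s y) inferInstance ?_ ?_ B hAB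
  · obtain ⟨s, hs, hs2⟩ := codingL (l := A + 1) (u := A + 1) (fun x y => (x < A ∧ y < B ∧ R x y) ∨ (¬ x < A ∧ y = 0)) hw (by
      intro i hi
      by_cases hA : i < A
      · obtain ⟨y, hy, hR⟩ := h i hA
        exact ⟨y, by grind, Or.inl ⟨hA, hy, hR⟩⟩
      · exact ⟨0, by positivity, Or.inr ⟨hA, rfl⟩⟩)
    have h3 : ∀ i, i < A → ev s i < B ∧ R i (ev s i) := by
      intro i hi
      rcases (hs2 i (by grind)).1 with h | h
      · exact h.2
      · exact absurd hi h.1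
    obtain ⟨y, hy, x, hx, hxy⟩ := key s hs (fun i hi => (h3 i (by grind)).1)
    exact ⟨x, y, ev s y, hx, by grind, hxy ▸ (h3 x (by grind)).2, (h3 y (by grind)).2⟩
  · intro _ s _ h
    exact absurd (h 0 le_rfl) (not_lt_zero'' _)
  · intro C ih hC s hs hv
    by_contra hc
    push Not at hc
    have hle : ∀ i : M, i ≤ C → i ≤ C + 1 := fun i hi => hi.trans (lt_add_one C).le
    clear h
    obtain ⟨s', hs', hs2⟩ := codingL (l := A + 1) (u := A + 1) (fun x y => (x ≤ C ∧ ((ev s x ≠ C ∧ y = ev s x) ∨ (ev s x = C ∧ y = ev s (C + 1)))) ∨ (¬ x ≤ C ∧ y = 0)) hw (by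
      intro i hi
      by_cases hA : i ≤ C
      · by_cases h2 : ev s i = C
        · exact ⟨ev s (C + 1), by have := hv (C+1) le_rfl; grind, Or.inl ⟨hA, Or.inr ⟨h2, rfl⟩⟩⟩
        · exact ⟨ev s i, by have := hv i (by grind); grind, Or.inl ⟨hA, Or.inl ⟨h2, rfl⟩⟩⟩
      · exact ⟨0, by positivity, Or.inr ⟨hA, rfl⟩⟩)
    have hCA : C < A := (lt_add_one C).trans hC
    have e1 : ∀ i, i ≤ C → (ev s i ≠ C ∧ ev s' i = ev s i) ∨ (ev s i = C ∧ ev s' i = ev s (C + 1)) := by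
      intro i hi
      rcases (hs2 i ((hi.trans_lt hCA).trans (lt_add_one A))).1 with h | h
      · exact h.2
      · exact absurd hi h.1
    obtain ⟨y, hy, x, hx, hxy⟩ := ih hCA s' hs' (by
      intro i hi
      have h2 := hc (C + 1) le_rfl i (ltS.mpr hi)
      have h3 := ltS.mp (hv i (hle i hi))
      have h4 := ltS.mp (hv (C + 1) le_rfl)
      rcases e1 i hi with ⟨h5, h6⟩ | ⟨h5, h6⟩
      · rw [h6]; exact lt_of_le_of_ne h3 h5
      · rw [h6]; rw [h5] at h2; exact lt_of_le_of_ne h4 h2.symm)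
    have h1 := e1 x (hx.le.trans hy)
    have h2 := e1 y hy
    have h3 := hc y (hle y hy) x hx
    have h4 := hc (C + 1) le_rfl x (ltS.mpr (hx.le.trans hy))
    have h5 := hc (C + 1) le_rfl y (ltS.mpr hy)
    clear hc e1 hs2 ih hv hle
    grind

variable (Γ : M → M → M → M → Prop) [LD4 Γ] (j K w0 : M)

/-- agreement -/
def Agree (p t x z : M) : Prop := ∀ u, u < w0 → (∀ i, i < j → ev u i ≤ t) → ∀ c, c < K → (Γ p u x c ↔ Γ p u z c)
instance : LD4 (Agree Γ j K w0) := ⟨by unfold Agree; infer_instance⟩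

/-- path in the Erdős–Rado tree -/
def Path (p L z : M) : Prop := ev p 0 = 0 ∧ ∀ t, t < L → (ev p t < ev p (t + 1) ∧ ev p (t + 1) ≤ z ∧
  Agree Γ j K w0 p t (ev p (t + 1)) z ∧ ∀ x, x < ev p (t + 1) → ev p t < x → ¬ Agree Γ j K w0 p t x z)
instance : LD3 (Path Γ j K w0) := ⟨by unfold Path; infer_instance⟩

variable {Γ j K w0}
theorem Agree.congr (hloc : ∀ p p' u x c, (∀ i, i < j → ev p (ev u i) = ev p' (ev u i)) → (Γ p u x c ↔ Γ p' u x c))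
    {p p' t x z : M} (h : ∀ i, i ≤ t → ev p i = ev p' i) : Agree Γ j K w0 p t x z ↔ Agree Γ j K w0 p' t x z := by
  unfold Agree
  refine forall_congr' fun u => forall_congr' fun hu => forall_congr' fun hi => forall_congr' fun c => forall_congr' fun hc => ?_
  rw [hloc p p' u x c fun i hij => h _ (hi i hij), hloc p p' u z c fun i hij => h _ (hi i hij)]

theorem path_exists (hloc : ∀ p p' u x c, (∀ i, i < j → ev p (ev u i) = ev p' (ev u i)) → (Γ p u x c ↔ Γ p' u x c))
    (hun : ∀ p u x c c', Γ p u x c → Γ p u x c' → c = c') {m m' w1 : M}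
    (hB : Bnd w0 (K + 1) w1) (hm : w1 * m < m') : ∃ p z, z < m' ∧ Path Γ j K w0 p m z := by
  by_contra hc
  push Not at hc
  have h01 : (0 : M) < 1 := zero_lt_one
  obtain ⟨wp, hwp⟩ := ex_bnd (m + 1) m'
  have hm'0 : 0 < m' := lt_of_le_of_lt (by positivity) hm
  -- maximal paths
  have hmax : ∀ z, z < m' → ∃ L, L < m ∧ ∃ p, p < wp ∧ (Path Γ j K w0 p L z ∧ ev p L = z) := by
    intro z hz
    have h0 : ∃ p, p < wp ∧ (Path Γ j K w0 p 0 z ∧ ev p 0 ≤ z) := by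
      obtain ⟨p, hp, hp2⟩ := codingL (fun _ y => y = 0) hwp (fun i _ => ⟨0, hm'0, rfl⟩)
      have := (hp2 0 (by positivity)).1
      exact ⟨p, hp, ⟨this, fun t ht => absurd ht (not_lt_zero'' t)⟩, by rw [this]; positivity⟩
    obtain ⟨L, hL, ⟨p, hp, hpath, hpz⟩, hLm⟩ := LD.gnp (P := fun L => ∃ p, p < wp ∧ (Path Γ j K w0 p L z ∧ ev p L ≤ z)) inferInstance
      h0 (b := m) (by positivity)
    have hLm' : L < m := lt_of_le_of_ne hL (by rintro rfl; exact hc p z hz hpath)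
    refine ⟨L, hLm', p, hp, hpath, ?_⟩
    by_contra hne
    have hlt : ev p L < z := lt_of_le_of_ne hpz hne
    obtain ⟨x, hx, ⟨hx1, hx2⟩, hx3⟩ := LD.lnp (P := fun x => ev p L < x ∧ Agree Γ j K w0 p L x z) inferInstance (x := z)
      ⟨hlt, fun _ _ _ _ _ => Iff.rfl⟩
    obtain ⟨p', hp', hp2⟩ := codingL (fun i y => (i ≤ L ∧ y = ev p i) ∨ (¬ i ≤ L ∧ y = x)) hwp (by
      intro i hi
      by_cases hiL : i ≤ L
      · refine ⟨ev p i, ?_, Or.inl ⟨hiL, rfl⟩⟩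
        rcases eq_or_ne i L with rfl | h
        · exact hlt.trans hz
        · have := (hpath.2 i (lt_of_le_of_ne hiL h)).1
          rcases zero_or_succ i with rfl | ⟨i', rfl⟩
          · rw [hpath.1]; exact hm'0
          · exact ((hpath.2 i' (by grind)).2.1).trans_lt hz
      · exact ⟨x, hx.trans_lt hz, Or.inr ⟨hiL, rfl⟩⟩)
    have e1 : ∀ i, i ≤ L → ev p' i = ev p i := fun i hi => by
      have := (hp2 i (by grind)).1; grind
    have e2 : ev p' (L + 1) = x := by
      have := (hp2 (L + 1) (by grind)).1; grind
    refine hLm (L + 1) (lt_add_one L) (Sle.mpr hLm') ⟨p', hp', ⟨?_, ?_⟩, e2 ▸ hx⟩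
    · rw [e1 0 (by positivity)]; exact hpath.1
    · intro t ht
      have ht' := ltS.mp ht
      have ea : ∀ x, Agree Γ j K w0 p' t x z ↔ Agree Γ j K w0 p t x z := fun x =>
        Agree.congr hloc fun i hi => e1 i (hi.trans ht')
      simp only [ea]
      rcases ht'.lt_or_eq with h | rfl
      · rw [e1 t ht', e1 (t + 1) (Sle.mpr h)]
        exact hpath.2 t h
      · rw [e2, e1 t le_rfl]
        exact ⟨hx1, hx, hx2, fun y hy h1 h2 => hx3 y hy ⟨h1, h2⟩⟩
  have htab : ∀ p z, ∃ c, c < w1 ∧ ∀ u, u < w0 → ((ev c u < K ∧ Γ p u z (ev c u)) ∨ (ev c u = K ∧ ∀ γ, γ < K → ¬ Γ p u z γ)) := by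
    intro p z
    obtain ⟨c, hc, hc2⟩ := codingL (fun u y => (y < K ∧ Γ p u z y) ∨ (y = K ∧ ∀ γ, γ < K → ¬ Γ p u z γ)) hB (by
      intro u hu
      by_cases h : ∃ γ, γ < K ∧ Γ p u z γ
      · obtain ⟨γ, h1, h2⟩ := h
        exact ⟨γ, by grind, Or.inl ⟨h1, h2⟩⟩
      · push Not at h
        exact ⟨K, by grind, Or.inr ⟨rfl, h⟩⟩)
    exact ⟨c, hc, fun u hu => (hc2 u hu).1⟩
  obtain ⟨x, y, z, hxy, hy, hx1, hy1⟩ := php (A := m') (B := w1 * m) (fun z v => ∃ L, L < m ∧ ∃ c, c < w1 ∧ (v = c * m + L ∧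
    ∃ p, p < wp ∧ (Path Γ j K w0 p L z ∧ ev p L = z ∧
      ∀ u, u < w0 → ((ev c u < K ∧ Γ p u z (ev c u)) ∨ (ev c u = K ∧ ∀ γ, γ < K → ¬ Γ p u z γ))))) inferInstance hm (by
    intro z hz
    obtain ⟨L, hL, p, hp, h1, h2⟩ := hmax z hz
    obtain ⟨c, hc, h3⟩ := htab p z
    refine ⟨c * m + L, ?_, L, hL, c, hc, rfl, p, hp, h1, h2, h3⟩
    calc c * m + L < c * m + m := by grind
      _ = (c + 1) * m := by ring
      _ ≤ w1 * m := by have := Sle.mpr hc; gcongr)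
  obtain ⟨L, hL, c, hcw, hz, p, hp, h1, h2, h3⟩ := hx1
  obtain ⟨L', hL', c', hcw', hz', p', hp', h1', h2', h3'⟩ := hy1
  have hcc : c = c' ∧ L = L' := by
    have key : ∀ a b r s : M, r < m → s < m → a * m + r = b * m + s → a ≤ b := by
      intro a b r s hr hs e
      by_contra h
      have h' := Sle.mpr (not_le.mp h)
      have : (b + 1) * m ≤ a * m := by gcongr
      have e2 : (b + 1) * m = b * m + m := by ring
      clear hc hmax htab hloc hun h3 h3' hB
      have h5 : b * m + m ≤ a * m + r := by rw [← e2]; exact le_trans this (le_add_of_nonneg_right (by positivity))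
      rw [e] at h5
      exact absurd hs (not_lt.mpr (le_of_add_le_add_left h5))
    have e := hz.symm.trans hz'
    have : c = c' := le_antisymm (key _ _ _ _ hL hL' e) (key _ _ _ _ hL' hL e.symm)
    subst this
    exact ⟨rfl, add_left_cancel e⟩
  obtain ⟨rfl, rfl⟩ := hcc
  have hpp : ∀ t, t ≤ L → ∀ i, i ≤ t → ev p i = ev p' i := by
    intro t
    refine LD.ind (P := fun t => t ≤ L → ∀ i, i ≤ t → ev p i = ev p' i) inferInstance ?_ ?_ t
    · intro _ i hi
      have : i = 0 := le_antisymm hi (by positivity)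
      rw [this, h1.1, h1'.1]
    · intro t ih ht
      have ht' := Sle.mp ht
      have ih := ih ht'.le
      have ag : ∀ v, Agree Γ j K w0 p t v x ↔ Agree Γ j K w0 p' t v y := by
        intro v
        rw [Agree.congr hloc ih]
        refine forall_congr' fun u => forall_congr' fun hu => forall_congr' fun hi => forall_congr' fun γ => forall_congr' fun hγ => ?_
        have hG : Γ p' u x γ ↔ Γ p' u y γ := by
          have hl : Γ p' u x γ ↔ Γ p u x γ := (hloc p p' u x γ fun i hij => ih _ (hi i hij)).symm
          rw [hl]
          have a1 := h3 u hu
          have a2 := h3' u hu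
          constructor
          · intro h
            rcases a1 with ⟨b1, b2⟩ | ⟨b1, b2⟩
            · have := hun _ _ _ _ _ b2 h
              rcases a2 with ⟨b3, b4⟩ | ⟨b3, b4⟩
              · exact this ▸ b4
              · grind
            · exact absurd h (b2 _ hγ)
          · intro h
            rcases a2 with ⟨b1, b2⟩ | ⟨b1, b2⟩
            · have := hun _ _ _ _ _ b2 h
              rcases a1 with ⟨b3, b4⟩ | ⟨b3, b4⟩
              · exact this ▸ b4
              · grind
            · exact absurd h (b2 _ hγ)
        rw [hG]
      intro i hi
      rcases hi.lt_or_eq with h | rfl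
      · exact ih i (ltS.mp h)
      · obtain ⟨a1, a2, a3, a4⟩ := h1.2 t ht'
        obtain ⟨b1, b2, b3, b4⟩ := h1'.2 t ht'
        have e := ih t le_rfl
        rcases lt_trichotomy (ev p (t + 1)) (ev p' (t + 1)) with h | h | h
        · exact absurd ((ag _).mp a3) (b4 _ h (e ▸ a1))
        · exact h
        · exact absurd ((ag _).mpr b3) (a4 _ h (e ▸ b1))
  have := hpp L le_rfl L le_rfl
  rw [h2, h2'] at this
  exact hxy.ne this
end

end ArithFC

end

section
set_option linter.all false
open FirstOrder Language
set_option synthInstance.maxHeartbeats 400000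
set_option synthInstance.maxSize 2000
set_option maxHeartbeats 1000000
namespace ArithFC

section
variable {M : Type} [lang.Structure M] [AR M]
/-- the first `m` values of `q` increase -/
def Inc (q m : M) : Prop := ∀ j, j < m → ∀ i, i < j → ev q i < ev q j
/-- `s` is the least code of its first `e` values -/
def Can (e s : M) : Prop := ∀ t, t < s → ∃ i, i < e ∧ ev t i ≠ ev s i
/-- `s` is a canonical increasing `e`-tuple from `q` -/
def Tup (s e q m : M) : Prop := Can e s ∧ Inc s e ∧ ∀ i, i < e → ∃ k, k < m ∧ ev s i = ev q k
/-- subsequence -/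
def Sub (q' m' q m : M) : Prop := ∀ i, i < m' → ∃ k, k < m ∧ ev q' i = ev q k
/-- colour depends only on the first `j` entries -/
def Dep (V e g q m j : M) : Prop := ∀ s, s < V → ∀ s', s' < V → (Tup s e q m ∧ Tup s' e q m ∧
  ∀ i, i < j → ev s i = ev s' i) → ev g s = ev g s'
def Big (e K m m' : M) : Prop := ∃ w0, w0 < m' ∧ ∃ w1, w1 < m' ∧ (Bnd e (m + 1) w0 ∧ Bnd w0 (K + 1) w1 ∧
  w1 * m < m' ∧ m < m')
end

instance : D02 (fun M : Mod => Inc (M := M)) := ⟨by unfold Inc; infer_instance⟩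
instance {M : Type} [lang.Structure M] [AR M] : LD2 (Inc (M := M)) := D02.toLD (P := fun M => Inc) inferInstance
instance : D02 (fun M : Mod => Can (M := M)) := ⟨by unfold Can; infer_instance⟩
instance {M : Type} [lang.Structure M] [AR M] : LD2 (Can (M := M)) := D02.toLD (P := fun M => Can) inferInstance
instance : D04 (fun M : Mod => Tup (M := M)) := ⟨by unfold Tup; infer_instance⟩
instance {M : Type} [lang.Structure M] [AR M] : LD4 (Tup (M := M)) := D04.toLD (P := fun M => Tup) inferInstance
instance : D04 (fun M : Mod => Sub (M := M)) := ⟨by unfold Sub; infer_instance⟩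
instance {M : Type} [lang.Structure M] [AR M] : LD4 (Sub (M := M)) := D04.toLD (P := fun M => Sub) inferInstance
instance : D04 (fun M : Mod => Big (M := M)) := ⟨by unfold Big; infer_instance⟩
instance {M : Type} [lang.Structure M] [AR M] : LD4 (Big (M := M)) := D04.toLD (P := fun M => Big) inferInstance

section
variable {M : Type} [lang.Structure M] [AR M]

theorem Inc.mono {q m i j : M} (h : Inc q m) (hj : j < m) (hij : i ≤ j) : ev q i ≤ ev q j := by
  rcases hij.lt_or_eq with h' | rfl
  · exact (h j hj i h').le
  · exact le_rfl

theorem Inc.lt_of {q m i j : M} (h : Inc q m) (hi : i < m) (hij : ev q i < ev q j) : i < j := by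
  by_contra hc
  exact absurd (h.mono hi (not_lt.mp hc)) (not_le.mpr hij)

theorem can_exists (e s : M) : ∃ s', s' ≤ s ∧ Can e s' ∧ ∀ i, i < e → ev s' i = ev s i := by
  obtain ⟨s', h1, h2, h3⟩ := LD.lnp (P := fun s' => ∀ i, i < e → ev s' i = ev s i) inferInstance (x := s) (fun _ _ => rfl)
  refine ⟨s', h1, fun t ht => ?_, h2⟩
  have := h3 t ht
  push Not at this
  obtain ⟨i, hi, h⟩ := this
  exact ⟨i, hi, by rwa [h2 i hi]⟩

theorem Can.le {e s s' : M} (h : Can e s) (he : ∀ i, i < e → ev s i = ev s' i) : s ≤ s' := by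
  by_contra hc
  obtain ⟨i, hi, hne⟩ := h s' (not_le.mp hc)
  exact hne (he i hi).symm

theorem Can.uniq {e s s' : M} (h : Can e s) (h' : Can e s') (he : ∀ i, i < e → ev s i = ev s' i) : s = s' :=
  le_antisymm (h.le he) (h'.le fun i hi => (he i hi).symm)

theorem Tup.lt {s e q m U V : M} (h : Tup s e q m) (hU : ∀ k, k < m → ev q k < U) (hV : Bnd e U V) : s < V := by
  obtain ⟨s', h1, h2⟩ := codingL (fun i y => y = ev s i) hV (by
    intro i hi
    obtain ⟨k, hk, e⟩ := h.2.2 i hi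
    exact ⟨ev s i, e ▸ hU k hk, rfl⟩)
  exact (h.1.le fun i hi => ((h2 i hi).1).symm).trans_lt h1

theorem Tup.sub {s e q' m' q m : M} (h : Tup s e q' m') (hs : Sub q' m' q m) : Tup s e q m := by
  refine ⟨h.1, h.2.1, fun i hi => ?_⟩
  obtain ⟨k, hk, e⟩ := h.2.2 i hi
  obtain ⟨k', hk', e'⟩ := hs k hk
  exact ⟨k', hk', e.trans e'⟩

theorem Sub.trans {a b c d e f : M} (h : Sub a b c d) (h' : Sub c d e f) : Sub a b e f := by
  intro i hi
  obtain ⟨k, hk, e⟩ := h i hi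
  obtain ⟨k', hk', e'⟩ := h' k hk
  exact ⟨k', hk', e.trans e'⟩

theorem er_step {e g q m m' K j w0 w1 U V W l : M} (hq : Inc q m') (hj : j < e)
    (hU : ∀ k, k < m' → ev q k < U) (hV : Bnd e U V) (hW : Bnd l U W) (hl : m ≤ l)
    (hcol : ∀ s, Tup s e q m' → ev g s < K) (hdep : Dep V e g q m' (j + 1))
    (hw0 : Bnd e (m + 1) w0) (hw1 : Bnd w0 (K + 1) w1) (hm : w1 * m < m') :
    ∃ q', q' < W ∧ Inc q' m ∧ Sub q' m q m' ∧ Dep V e g q' m j := by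
  have hm'0 : 0 < m' := lt_of_le_of_lt (by positivity) hm
  have hU0 : 0 < U := lt_of_le_of_lt (by positivity) (hU 0 hm'0)
  have iΓ : LD4 (fun p u x c => ∃ s, s < V ∧ (Tup s e q m' ∧ (∀ i, i < j → ev s i = ev q (ev p (ev u i))) ∧
      ev s j = ev q x ∧ ev g s = c)) := ⟨inferInstance⟩
  obtain ⟨p, z, hz, hp0, hp⟩ := path_exists (j := j) (K := K) (w0 := w0) (m := m) (m' := m') (w1 := w1)
    (Γ := fun p u x c => ∃ s, s < V ∧ (Tup s e q m' ∧ (∀ i, i < j → ev s i = ev q (ev p (ev u i))) ∧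
      ev s j = ev q x ∧ ev g s = c)) (by
      intro p p' u x c h
      refine exists_congr fun s => and_congr_right fun _ => and_congr_right fun _ => and_congr_left fun _ => ?_
      exact forall_congr' fun i => forall_congr' fun hi => by rw [h i hi]) (by
      rintro p u x c c' ⟨s, hs, h1, h2, h3, rfl⟩ ⟨s', hs', h1', h2', h3', rfl⟩
      refine hdep s hs s' hs' ⟨h1, h1', fun i hi => ?_⟩
      rcases (ltS.mp hi).lt_or_eq with h | rfl
      · rw [h2 i h, h2' i h]
      · rw [h3, h3']) hw1 hm
  have hmono : ∀ j, j ≤ m → ∀ i, i < j → ev p i < ev p j := by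
    intro j
    refine LD.ind (P := fun j => j ≤ m → ∀ i, i < j → ev p i < ev p j) inferInstance ?_ ?_ j
    · intro _ i hi; exact absurd hi (not_lt_zero'' i)
    · intro j ih hj i hi
      have h1 := (hp j (Sle.mp hj)).1
      rcases (ltS.mp hi).lt_or_eq with h | rfl
      · exact (ih (Sle.mp hj).le i h).trans h1
      · exact h1
  have hpz : ∀ i, i < m → ev p (i + 1) < m' := fun i hi => ((hp i hi).2.1).trans_lt hz
  obtain ⟨q', hq'W, hq'⟩ := codingL (fun i y => (i < m ∧ y = ev q (ev p (i + 1))) ∨ (¬ i < m ∧ y = 0)) hW (by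
    intro i hi
    by_cases h : i < m
    · exact ⟨_, hU _ (hpz i h), Or.inl ⟨h, rfl⟩⟩
    · exact ⟨0, hU0, Or.inr ⟨h, rfl⟩⟩)
  have e1 : ∀ i, i < m → ev q' i = ev q (ev p (i + 1)) := by
    intro i hi
    rcases (hq' i (hi.trans_le hl)).1 with h | h
    · exact h.2
    · exact absurd hi h.1
  have hinc : Inc q' m := by
    intro j hj i hi
    rw [e1 j hj, e1 i (hi.trans hj)]
    exact hq _ (hpz j hj) _ (hmono _ (Sle.mpr hj) _ (by gcongr))
  have hsub : Sub q' m q m' := fun i hi => ⟨_, hpz i hi, e1 i hi⟩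
  refine ⟨q', hq'W, hinc, hsub, ?_⟩
  rintro s hs s' hs' ⟨ht, ht', hag⟩
  obtain ⟨α, hα, eα⟩ := ht.2.2 j hj
  obtain ⟨β, hβ, eβ⟩ := ht'.2.2 j hj
  obtain ⟨u, hu, hu2⟩ := codingL (fun i y => (i < j ∧ ∃ k, k < m ∧ (y = k + 1 ∧ ev s i = ev q' k)) ∨ (¬ i < j ∧ y = 0)) hw0 (by
    intro i hi
    by_cases h : i < j
    · obtain ⟨k, hk, ek⟩ := ht.2.2 i hi
      exact ⟨k + 1, by gcongr, Or.inl ⟨h, k, hk, rfl, ek⟩⟩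
    · exact ⟨0, by positivity, Or.inr ⟨h, rfl⟩⟩)
  have hu3 : ∀ i, i < j → ∃ k, k < m ∧ ev u i = k + 1 ∧ ev s i = ev q' k := by
    intro i hi
    rcases (hu2 i (hi.trans hj)).1 with h | h
    · exact h.2
    · exact absurd hi h.1
  have hua : ∀ i, i < j → ev u i ≤ α := by
    intro i hi
    obtain ⟨k, hk, h1, h2⟩ := hu3 i hi
    rw [h1]
    refine Sle.mpr (hinc.lt_of hk ?_)
    rw [← h2, ← eα]; exact ht.2.1 j hj i hi
  have hub : ∀ i, i < j → ev u i ≤ β := by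
    intro i hi
    obtain ⟨k, hk, h1, h2⟩ := hu3 i hi
    rw [h1]
    refine Sle.mpr (hinc.lt_of hk ?_)
    rw [← h2, ← eβ, hag i hi]; exact ht'.2.1 j hj i hi
  have hK := hcol s (ht.sub hsub)
  have a1 := ((hp α hα).2.2.1 u hu hua _ hK).mp ⟨s, hs, ht.sub hsub, fun i hi => by
    obtain ⟨k, hk, h1, h2⟩ := hu3 i hi
    rw [h2, e1 k hk, h1], by rw [eα, e1 α hα], rfl⟩
  obtain ⟨s2, hs2, b1, b2, b3, b4⟩ := ((hp β hβ).2.2.1 u hu hub _ hK).mpr a1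
  rw [← b4]
  refine hdep s2 hs2 s' hs' ⟨b1, ht'.sub hsub, fun i hi => ?_⟩
  rcases (ltS.mp hi).lt_or_eq with h | rfl
  · obtain ⟨k, hk, h1, h2⟩ := hu3 i h
    rw [b2 i h, ← hag i h, h2, e1 k hk, h1]
  · rw [b3, eβ, e1 β hβ]

theorem big_mono {e K S a b : M} (hS : ∀ t, t < b → Big e K (ev S (a + t)) (ev S (a + t + 1))) {t t' : M}
    (h : t ≤ t') (h' : t' ≤ b) : ev S (a + t) ≤ ev S (a + t') := by
  obtain ⟨d, rfl⟩ := exists_add_of_le h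
  clear h
  revert h'
  refine LD.ind (P := fun d => t + d ≤ b → ev S (a + t) ≤ ev S (a + (t + d))) inferInstance ?_ ?_ d
  · intro _; rw [add_zero]
  · intro d ih hd
    have hd' : t + d < b := Sle.mp (by rw [add_assoc]; exact hd)
    obtain ⟨_, _, _, _, _, _, _, h⟩ := hS _ hd'
    rw [← add_assoc, ← add_assoc]
    exact (ih hd'.le).trans (by rw [add_assoc a t d]; exact h.le)

theorem ramsey {e K S a g q : M} (hS : ∀ t, t < e → Big e K (ev S (a + t)) (ev S (a + t + 1)))
    (hq : Inc q (ev S (a + e))) (hcol : ∀ s, Tup s e q (ev S (a + e)) → ev g s < K) :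
    ∃ q', Inc q' (ev S a) ∧ Sub q' (ev S a) q (ev S (a + e)) ∧
      ∀ s s', Tup s e q' (ev S a) → Tup s' e q' (ev S a) → ev g s = ev g s' := by
  have hU : ∀ k, k < ev S (a + e) → ev q k < q + 1 := fun k _ => ltS.mpr (ev_le q k)
  obtain ⟨V, hV⟩ := ex_bnd e (q + 1)
  obtain ⟨W, hW⟩ := ex_bnd (ev S (a + e)) (q + 1)
  have key := LD.ind (P := fun j => ∀ r, r < e + 1 → r + j = e → ∃ q', q' < W + q + 1 ∧ (Inc q' (ev S (a + r)) ∧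
    Sub q' (ev S (a + r)) q (ev S (a + e)) ∧ Dep V e g q' (ev S (a + r)) r)) (by unfold Dep; infer_instance) ?_ ?_ e 0 (by positivity) (zero_add e)
  · rw [add_zero] at key
    obtain ⟨q', _, h1, h2, h3⟩ := key
    exact ⟨q', h1, h2, fun s s' hs hs' => h3 s ((hs.sub h2).lt hU hV) s' ((hs'.sub h2).lt hU hV) ⟨hs, hs', fun i hi => absurd hi (not_lt_zero'' i)⟩⟩
  · intro r _ hr
    rw [add_zero] at hr
    subst hr
    refine ⟨q, by rw [ltS]; exact le_add_of_nonneg_left (by positivity), hq, fun i hi => ⟨i, hi, rfl⟩, ?_⟩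
    rintro s _ s' _ ⟨h1, h2, h3⟩
    rw [h1.1.uniq h2.1 h3]
  · intro j ih r hr hrj
    have hre : r < e := by rw [← hrj]; exact lt_add_of_pos_right _ (by positivity)
    obtain ⟨q', hq', h1, h2, h3⟩ := ih (r + 1) (by gcongr) (by rw [← hrj]; ring)
    obtain ⟨w0, _, w1, _, b1, b2, b3, b4⟩ := hS r hre
    rw [← add_assoc] at h1 h2 h3
    obtain ⟨q2, c1, c2, c3, c4⟩ := er_step (U := q + 1) (V := V) (W := W) (l := ev S (a + e)) (j := r) (K := K) h1 hre (by
        intro k hk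
        obtain ⟨k', hk', e'⟩ := h2 k hk
        rw [e']; exact hU k' hk') hV hW (big_mono hS hre.le le_rfl) (fun s hs => hcol s (hs.sub h2)) h3 b1 b2 b3
    exact ⟨q2, by rw [add_assoc]; exact c1.trans_le (le_add_of_nonneg_right (by positivity)), c2, c3.trans h2, c4⟩

/-- towers exist -/
theorem tower (e K m0 b : M) : ∃ S, ev S 0 = m0 ∧ ∀ t, t < b → Big e K (ev S t) (ev S (t + 1)) := by
  refine sigma1_ind (k := 3) (Q := fun M p x => ∃ S, ev S 0 = p 2 ∧ ∀ t, t < x → Big (p 0) (p 1) (ev S t) (ev S (t + 1)))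
    ⟨M, inferInstance, inferInstance⟩ ![e, K, m0] ?_ ?_ b
  · obtain ⟨w, hw⟩ := ex_bnd (1 : M) (m0 + 1)
    obtain ⟨s, _, hs⟩ := codingL (fun i y => y = m0) hw (fun i _ => ⟨m0, lt_add_one m0, rfl⟩)
    exact ⟨s, (hs 0 (by positivity)).1, fun t ht => absurd ht (not_lt_zero'' t)⟩
  · rintro x ⟨S, h0, hS⟩
    change ev S 0 = m0 at h0
    change ∀ t, t < x → Big e K (ev S t) (ev S (t + 1)) at hS
    obtain ⟨w0, hw0⟩ := ex_bnd e (ev S x + 1)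
    obtain ⟨w1, hw1⟩ := ex_bnd w0 (K + 1)
    have hbig : Big e K (ev S x) (w0 + w1 + w1 * ev S x + ev S x + 1) := by
      refine ⟨w0, ltS.mpr ?_, w1, ltS.mpr ?_, hw0, hw1, ltS.mpr ?_, ltS.mpr ?_⟩
      · rw [add_assoc, add_assoc]; exact le_add_of_nonneg_right (by positivity)
      · rw [add_comm w0, add_assoc, add_assoc]; exact le_add_of_nonneg_right (by positivity)
      · rw [add_comm _ (w1 * ev S x), add_assoc]; exact le_add_of_nonneg_right (by positivity)
      · exact le_add_of_nonneg_left (by positivity)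
    generalize w0 + w1 + w1 * ev S x + ev S x + 1 = y at hbig
    obtain ⟨w, hw⟩ := ex_bnd (x + 1 + 1) (S + y + 1)
    obtain ⟨S', _, hS'⟩ := codingL (fun i v => (i ≤ x ∧ v = ev S i) ∨ (¬ i ≤ x ∧ v = y)) hw (by
      intro i hi
      by_cases h : i ≤ x
      · exact ⟨ev S i, ltS.mpr ((ev_le S i).trans (le_add_of_nonneg_right (by positivity))), Or.inl ⟨h, rfl⟩⟩
      · exact ⟨y, ltS.mpr (le_add_of_nonneg_left (by positivity)), Or.inr ⟨h, rfl⟩⟩)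
    have e1 : ∀ i, i ≤ x → ev S' i = ev S i := by
      intro i hi
      rcases (hS' i ((ltS.mpr hi).trans (lt_add_one _))).1 with h | h
      · exact h.2
      · exact absurd hi h.1
    have e2 : ev S' (x + 1) = y := by
      rcases (hS' (x + 1) (lt_add_one _)).1 with h | h
      · exact absurd h.1 (not_le.mpr (lt_add_one x))
      · exact h.2
    refine ⟨S', by rw [e1 0 (by positivity)]; exact h0, fun t ht => ?_⟩
    change Big e K _ _
    rcases (ltS.mp ht).lt_or_eq with h | rfl
    · rw [e1 t h.le, e1 (t + 1) (Sle.mpr h)]; exact hS t h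
    · rw [e1 t le_rfl, e2]; exact hbig
end

end ArithFC

end

section
set_option linter.all false
open FirstOrder Language
namespace ArithFC

/-- Skolem hypothesis for a restricted ultrapower -/
structure SkH (n : ℕ) (A : Mod) {I : Type} (U : Ultrafilter I) (G : Set (I → A)) : Prop where
  const : ∀ a : A, (fun _ => a) ∈ G
  sk : ∀ {k : ℕ} (R : URel (k + 1)), SigR n n R → ∀ f : Fin k → I → A, (∀ i, f i ∈ G) →
    ∃ g ∈ G, ∀ᶠ d in (U : Filter I), (∃ x, R A (Fin.snoc (fun i => f i d) x)) →
      R A (Fin.snoc (fun i => f i d) (g d)) ∧ ∀ x, x < g d → ¬ R A (Fin.snoc (fun i => f i d) x)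

section RU
variable {n : ℕ} {A : Mod} {I : Type} {U : Ultrafilter I} {G : Set (I → A)}

abbrev UP (A : Mod) {I : Type} (U : Ultrafilter I) : Type := (U : Filter I).Product (fun _ => (A : Type))

def toUP (U : Ultrafilter I) (f : I → A) : UP A U := (f : (U : Filter I).Product (fun _ => (A : Type)))

theorem toUP_eq {f g : I → A} : toUP U f = toUP U g ↔ ∀ᶠ d in (U : Filter I), f d = g d := Quotient.eq''

theorem toUP_realize {k : ℕ} (φ : lang.BoundedFormula Empty k) (v : Fin k → I → A) :
    φ.Realize (M := UP A U) Empty.elim (fun i => toUP U (v i)) ↔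
      ∀ᶠ d in (U : Filter I), φ.Realize (M := A) Empty.elim (fun i => v i d) := by
  haveI : ∀ a : I, Nonempty ((fun _ => (A : Type)) a) := fun _ => ⟨(0 : A)⟩
  have := Ultraproduct.boundedFormula_realize_cast (u := U) (M := fun _ : I => (A : Type)) φ
    (fun e => Empty.elim e) v
  have e1 : (fun i : Empty => ((Empty.elim i : I → A) : (U : Filter I).Product (fun _ => (A : Type)))) = Empty.elim := by
    ext i; exact i.elim
  have e2 : ∀ d, (fun i : Empty => (Empty.elim i : I → A) d) = Empty.elim := by
    intro d; ext i; exact i.elim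
  rw [e1] at this
  simp only [e2] at this
  exact this

theorem SkH.func (h : SkH n A U G) {k : ℕ} (f : lang.Functions k) (v : Fin k → I → A) (hv : ∀ i, v i ∈ G) :
    ∃ g ∈ G, ∀ᶠ d in (U : Filter I), g d = Structure.funMap f (fun i => v i d) := by
  have key : D0 (k := k + 1) (fun M w => w (Fin.last k) = Structure.funMap f (fun i => w (Fin.castSucc i))) := by
    cases f with
    | zero =>
      refine (inferInstance : D0 (k := 1) (fun M w => w (Fin.last 0) = 0)).congr fun M v => ?_
      rw [show (fun i : Fin 0 => v i.castSucc) = ![] from by ext i; exact i.elim0]; rfl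
    | one =>
      refine (inferInstance : D0 (k := 1) (fun M w => w (Fin.last 0) = 1)).congr fun M v => ?_
      rw [show (fun i : Fin 0 => v i.castSucc) = ![] from by ext i; exact i.elim0]; rfl
    | add =>
      refine (inferInstance : D0 (k := 3) (fun M w => w (Fin.last 2) = w 0 + w 1)).congr fun M v => ?_
      rw [show (fun i : Fin 2 => v i.castSucc) = ![v 0, v 1] from by ext i; fin_cases i <;> rfl]; rfl
    | mul =>
      refine (inferInstance : D0 (k := 3) (fun M w => w (Fin.last 2) = w 0 * w 1)).congr fun M v => ?_
      rw [show (fun i : Fin 2 => v i.castSucc) = ![v 0, v 1] from by ext i; fin_cases i <;> rfl]; rfl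
  obtain ⟨g, hg, h1⟩ := h.sk _ (SigR.d0 key) v hv
  refine ⟨g, hg, h1.mono fun d hd => ?_⟩
  simp only [Fin.snoc_last, Fin.snoc_castSucc, exists_eq, true_imp_iff] at hd
  exact hd.1

/-- restricted ultrapower -/
def RU (h : SkH n A U G) : lang.Substructure (UP A U) where
  carrier := {x | ∃ f ∈ G, toUP U f = x}
  fun_mem := by
    intro k f xs hxs
    choose v hv hvx using hxs
    obtain ⟨g, hg, hgv⟩ := h.func f v hv
    refine ⟨g, hg, ?_⟩
    have := Ultraproduct.funMap_cast (u := U) (M := fun _ : I => (A : Type)) f v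
    have e : xs = fun i => toUP U (v i) := by ext i; exact (hvx i).symm
    rw [e]
    refine Eq.trans ?_ this.symm
    exact toUP_eq.2 hgv

def RU.mk (h : SkH n A U G) (f : I → A) (hf : f ∈ G) : RU h := ⟨toUP U f, f, hf, rfl⟩

theorem RU.mk_eq {h : SkH n A U G} {f g : I → A} {hf : f ∈ G} {hg : g ∈ G} :
    RU.mk h f hf = RU.mk h g hg ↔ ∀ᶠ d in (U : Filter I), f d = g d := by
  rw [← toUP_eq]; exact Subtype.ext_iff

theorem RU.ind' {h : SkH n A U G} (x : RU h) : ∃ f hf, x = RU.mk h f hf := by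
  obtain ⟨x, f, hf, e⟩ := x
  exact ⟨f, hf, Subtype.ext e.symm⟩

theorem RU.exMk {h : SkH n A U G} {k : ℕ} (v : Fin k → RU h) :
    ∃ (f : Fin k → I → A) (hf : ∀ i, f i ∈ G), v = fun i => RU.mk h (f i) (hf i) := by
  choose f hf e using fun i => RU.ind' (v i)
  exact ⟨f, hf, funext e⟩

/-- truth of φ in the ultrapower and in the restricted ultrapower coincide -/
def TV (h : SkH n A U G) {k : ℕ} (φ : lang.BoundedFormula Empty k) : Prop :=
  ∀ v : Fin k → RU h, φ.Realize (M := RU h) Empty.elim v ↔ φ.Realize (M := UP A U) Empty.elim (fun i => (v i).1)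

theorem TV.term {h : SkH n A U G} {k : ℕ} (t : lang.Term (Empty ⊕ Fin k)) (v : Fin k → RU h) :
    t.realize (M := UP A U) (Sum.elim Empty.elim (fun i => (v i).1)) =
      (t.realize (M := RU h) (Sum.elim Empty.elim v)).1 := by
  have := HomClass.realize_term (RU h).subtype (t := t) (v := Sum.elim Empty.elim v)
  rw [← show (RU h).subtype ∘ Sum.elim Empty.elim v = Sum.elim Empty.elim (fun i => (v i).1) from by
    ext (x | x)
    · exact x.elim
    · rfl]
  exact this

theorem TV.equal {h : SkH n A U G} {k : ℕ} (t u : lang.Term (Empty ⊕ Fin k)) :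
    TV h (BoundedFormula.equal t u) := by
  intro v
  simp only [BoundedFormula.Realize, TV.term]
  exact Subtype.ext_iff

theorem TV.rel {h : SkH n A U G} {k l : ℕ} (R : lang.Relations l) (ts : Fin l → lang.Term (Empty ⊕ Fin k)) :
    TV h (BoundedFormula.rel R ts) := by
  intro v
  simp only [BoundedFormula.Realize, TV.term]
  rfl

theorem TV.imp {h : SkH n A U G} {k : ℕ} {φ ψ : lang.BoundedFormula Empty k} (h1 : TV h φ) (h2 : TV h ψ) :
    TV h (φ.imp ψ) := fun v => by
  rw [BoundedFormula.realize_imp, BoundedFormula.realize_imp, h1, h2]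

theorem TV.all {h : SkH n A U G} {k : ℕ} {φ : lang.BoundedFormula Empty (k + 1)} (h1 : TV h φ)
    (hs : SigR n n (fun M v => ¬ φ.Realize (M := M) Empty.elim v)) : TV h φ.all := by
  intro v
  rw [BoundedFormula.realize_all, BoundedFormula.realize_all]
  obtain ⟨f, hf, rfl⟩ := RU.exMk v
  have e : ∀ x : RU h, (fun i => ((Fin.snoc (fun i => RU.mk h (f i) (hf i)) x : Fin (k+1) → RU h) i).1) =
      Fin.snoc (fun i => toUP U (f i)) x.1 := by
    intro x; ext i
    refine Fin.lastCases ?_ (fun i => ?_) i <;> simp [RU.mk]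
  have e2 : ∀ g : I → A, (Fin.snoc (fun i => toUP U (f i)) (toUP U g) : Fin (k+1) → UP A U) =
      fun i => toUP U ((Fin.snoc f g : Fin (k+1) → I → A) i) := by
    intro x; ext i
    refine Fin.lastCases ?_ (fun i => ?_) i <;> simp
  have e3 : ∀ (g : I → A) d, (fun i => (Fin.snoc f g : Fin (k+1) → I → A) i d) = Fin.snoc (fun i => f i d) (g d) := by
    intro g d; ext i
    refine Fin.lastCases ?_ (fun i => ?_) i <;> simp
  constructor
  · intro hall x
    by_contra hx
    obtain ⟨g0, rfl⟩ : ∃ g, toUP U g = x := Quotient.exists_rep x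
    have hx : ¬ φ.Realize (M := UP A U) Empty.elim (Fin.snoc (fun i => toUP U (f i)) (toUP U g0)) := hx
    rw [e2, toUP_realize, ← Ultrafilter.eventually_not] at hx
    obtain ⟨g, hg, h3⟩ := h.sk _ hs f hf
    have := hall (RU.mk h g hg)
    rw [h1, e] at this
    have this : φ.Realize (M := UP A U) Empty.elim (Fin.snoc (fun i => toUP U (f i)) (toUP U g)) := this
    rw [e2, toUP_realize] at this
    obtain ⟨d, h4, h5, h6⟩ := (h3.and (hx.and this)).exists
    simp only [e3] at h5 h6
    exact (h4 ⟨_, h5⟩).1 h6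
  · intro hall x
    rw [h1, e]
    exact hall _


theorem TV.not {h : SkH n A U G} {k : ℕ} {φ : lang.BoundedFormula Empty k} (h1 : TV h φ) : TV h φ.not := fun v => by
  rw [BoundedFormula.realize_not, BoundedFormula.realize_not, h1]

theorem TV.d0 {h : SkH n A U G} {k : ℕ} {φ : lang.BoundedFormula Empty k} (hφ : IsDelta0 k φ) : TV h φ := by
  induction hφ with
  | falsum n => exact fun v => Iff.rfl
  | equal => exact TV.equal _ _
  | rel => exact TV.rel _ _
  | imp _ _ _ h1 h2 => exact h1.imp h2
  | bdAll k t hφ ih =>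
    have : TV h ((ltFm (Term.var (Sum.inr (Fin.last k))) (t.liftAt 1 k))) := TV.rel _ _
    refine (this.imp ih).all ?_
    exact SigR.d0 (D0.not' ⟨_, .imp _ (.rel _ _ _ _) hφ, fun _ _ => Iff.rfl⟩)

theorem TV.hier {h : SkH n A U G} : (∀ r k (φ : lang.BoundedFormula Empty k), SigmaFm r k φ →
      (r ≤ n → TV h φ) ∧ SigmaFm r k φ) ∧
    (∀ r k (φ : lang.BoundedFormula Empty k), PiFm r k φ → (r ≤ n → TV h φ) ∧ PiFm r k φ) := by
  apply hier_ind
  · intro r k φ h; exact ⟨fun _ => TV.d0 h, .delta0 _ _ h⟩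
  · intro r k φ h; exact ⟨fun hr => h.1 (by omega), .ofPi _ _ h.2⟩
  · intro r k φ h
    refine ⟨fun hr => ?_, .ex _ _ h.2⟩
    refine TV.not (TV.all (h.1 hr).not ?_)
    refine (((SigR.of_fm (n := n)).1 _ _ _ h.2).mono hr).congr fun M _ v => ?_
    simp
  · intro r k φ h; exact ⟨fun _ => TV.d0 h, .delta0 _ _ h⟩
  · intro r k φ h; exact ⟨fun hr => h.1 (by omega), .ofSigma _ _ h.2⟩
  · intro r k φ h
    exact ⟨fun hr => TV.all (h.1 hr) (((SigR.of_fm (n := n)).2 _ _ _ h.2).mono hr), .all _ _ h.2⟩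

/-- Łoś for Σ_n formulas -/
theorem RU.los {h : SkH n A U G} {k : ℕ} {φ : lang.BoundedFormula Empty k} (hφ : SigmaFm n k φ)
    (f : Fin k → I → A) (hf : ∀ i, f i ∈ G) :
    φ.Realize (M := RU h) Empty.elim (fun i => RU.mk h (f i) (hf i)) ↔
      ∀ᶠ d in (U : Filter I), φ.Realize (M := A) Empty.elim (fun i => f i d) := by
  rw [(TV.hier.1 _ _ _ hφ).1 le_rfl, ← toUP_realize]
  rfl

end RU
end ArithFC

end

section
set_option linter.all false
open FirstOrder Language
namespace ArithFC

section RU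
variable {n : ℕ} {A : Mod} {I : Type} {U : Ultrafilter I} {G : Set (I → A)}

def RUT (h : SkH n A U G) : Type := RU h
instance (h : SkH n A U G) : lang.Structure (RUT h) := inferInstanceAs (lang.Structure (RU h))
def RUT.mk (h : SkH n A U G) (f : I → A) (hf : f ∈ G) : RUT h := RU.mk h f hf

def Rep {h : SkH n A U G} (x : RUT h) (f : I → A) : Prop := x.1 = toUP U f

variable {h : SkH n A U G} {x y : RUT h} {f g : I → A}

theorem RUT.rep (x : RUT h) : ∃ f ∈ G, Rep x f := by
  obtain ⟨x, f, hf, e⟩ := x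
  exact ⟨f, hf, e.symm⟩
theorem Rep.mk (hf : f ∈ G) : Rep (RUT.mk h f hf) f := rfl
theorem Rep.eq (hx : Rep x f) (hy : Rep y g) : x = y ↔ ∀ᶠ d in (U : Filter I), f d = g d := by
  rw [← toUP_eq, ← hx, ← hy]; exact Subtype.ext_iff
theorem Rep.lt (hx : Rep x f) (hy : Rep y g) : x < y ↔ ∀ᶠ d in (U : Filter I), f d < g d := by
  have : (x < y) ↔ Structure.RelMap (L := lang) (M := UP A U) Rel.lt ![x.1, y.1] := by
    have : (x < y) ↔ Structure.RelMap (L := lang) (M := RUT h) Rel.lt ![x, y] := Iff.rfl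
    rw [this]
    have e : ![x.1, y.1] = fun i => (![x, y] i).1 := by ext i; fin_cases i <;> rfl
    rw [e]; rfl
  rw [this, hx, hy]
  have e := toUP_realize (U := U) (A := A) (k := 2) (BoundedFormula.rel (L := lang) (Rel.lt : lang.Relations 2)
    ![Term.var (Sum.inr 0), Term.var (Sum.inr 1)]) ![f, g]
  simp only [BoundedFormula.Realize] at e
  have e1 : ∀ {N : Type} [lang.Structure N] (v : Fin 2 → N), (fun i => ((![Term.var (Sum.inr 0), Term.var (Sum.inr 1)] : Fin 2 → lang.Term (Empty ⊕ Fin 2)) i).realize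
      (Sum.elim (Empty.elim : Empty → N) v)) = ![v 0, v 1] := by
    intro N _ v; ext i; fin_cases i <;> rfl
  simp only [e1] at e
  exact e
theorem Rep.zero : Rep (0 : RUT h) (fun _ => 0) := by
  have := Ultraproduct.funMap_cast (u := U) (M := fun _ : I => (A : Type)) (L := lang) (Func.zero : lang.Functions 0) ![]
  refine Eq.trans ?_ (this.trans ?_)
  · show Structure.funMap (L := lang) (M := UP A U) (Func.zero : lang.Functions 0) _ = _
    congr 1; ext i; exact i.elim0
  · refine congrArg (toUP U) (funext fun d => ?_)
    show _ = Structure.funMap (L := lang) (M := A) (Func.zero : lang.Functions 0) _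
    congr 1; ext i; exact i.elim0
theorem Rep.one : Rep (1 : RUT h) (fun _ => 1) := by
  have := Ultraproduct.funMap_cast (u := U) (M := fun _ : I => (A : Type)) (L := lang) (Func.one : lang.Functions 0) ![]
  refine Eq.trans ?_ (this.trans ?_)
  · show Structure.funMap (L := lang) (M := UP A U) (Func.one : lang.Functions 0) _ = _
    congr 1; ext i; exact i.elim0
  · refine congrArg (toUP U) (funext fun d => ?_)
    show _ = Structure.funMap (L := lang) (M := A) (Func.one : lang.Functions 0) _
    congr 1; ext i; exact i.elim0
theorem Rep.add (hx : Rep x f) (hy : Rep y g) : Rep (x + y) (fun d => f d + g d) := by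
  have := Ultraproduct.funMap_cast (u := U) (M := fun _ : I => (A : Type)) (L := lang) (Func.add : lang.Functions 2) ![f, g]
  refine Eq.trans ?_ (this.trans ?_)
  · show Structure.funMap (L := lang) (M := UP A U) (Func.add : lang.Functions 2) _ = _
    congr 1; ext i; fin_cases i
    · exact hx
    · exact hy
  · refine congrArg (toUP U) (funext fun d => ?_)
    show _ = Structure.funMap (L := lang) (M := A) (Func.add : lang.Functions 2) _
    congr 1; ext i; fin_cases i <;> rfl
theorem Rep.mul (hx : Rep x f) (hy : Rep y g) : Rep (x * y) (fun d => f d * g d) := by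
  have := Ultraproduct.funMap_cast (u := U) (M := fun _ : I => (A : Type)) (L := lang) (Func.mul : lang.Functions 2) ![f, g]
  refine Eq.trans ?_ (this.trans ?_)
  · show Structure.funMap (L := lang) (M := UP A U) (Func.mul : lang.Functions 2) _ = _
    congr 1; ext i; fin_cases i
    · exact hx
    · exact hy
  · refine congrArg (toUP U) (funext fun d => ?_)
    show _ = Structure.funMap (L := lang) (M := A) (Func.mul : lang.Functions 2) _
    congr 1; ext i; fin_cases i <;> rfl
theorem Rep.le (hx : Rep x f) (hy : Rep y g) : x ≤ y ↔ ∀ᶠ d in (U : Filter I), f d ≤ g d := by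
  have e : (x ≤ y) ↔ (x < y ∨ x = y) := Iff.rfl
  rw [e, hx.lt hy, hx.eq hy, ← Ultrafilter.eventually_or]
  exact Iff.rfl

theorem RUT.pam (h : SkH n A U G) : PAm (RUT h) := by
  have P : PAm A := PAM.out
  have ev : ∀ {p : I → Prop}, (∀ d, p d) → ∀ᶠ d in (U : Filter I), p d := fun h => Filter.Eventually.of_forall h
  constructor
  · intro x y z
    obtain ⟨f, -, hx⟩ := x.rep; obtain ⟨g, -, hy⟩ := y.rep; obtain ⟨k, -, hz⟩ := z.rep
    exact (((hx.add hy).add hz).eq (hx.add (hy.add hz))).2 (ev fun d => P.add_assoc _ _ _)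
  · intro x y
    obtain ⟨f, -, hx⟩ := x.rep; obtain ⟨g, -, hy⟩ := y.rep
    exact ((hx.add hy).eq (hy.add hx)).2 (ev fun d => P.add_comm _ _)
  · intro x y z
    obtain ⟨f, -, hx⟩ := x.rep; obtain ⟨g, -, hy⟩ := y.rep; obtain ⟨k, -, hz⟩ := z.rep
    exact (((hx.mul hy).mul hz).eq (hx.mul (hy.mul hz))).2 (ev fun d => P.mul_assoc _ _ _)
  · intro x y
    obtain ⟨f, -, hx⟩ := x.rep; obtain ⟨g, -, hy⟩ := y.rep
    exact ((hx.mul hy).eq (hy.mul hx)).2 (ev fun d => P.mul_comm _ _)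
  · intro x y z
    obtain ⟨f, -, hx⟩ := x.rep; obtain ⟨g, -, hy⟩ := y.rep; obtain ⟨k, -, hz⟩ := z.rep
    exact ((hx.mul (hy.add hz)).eq ((hx.mul hy).add (hx.mul hz))).2 (ev fun d => P.ldistrib _ _ _)
  · intro x
    obtain ⟨f, -, hx⟩ := x.rep
    exact ((hx.add Rep.zero).eq hx).2 (ev fun d => P.add_zero _)
  · intro x
    obtain ⟨f, -, hx⟩ := x.rep
    exact ((hx.mul Rep.zero).eq Rep.zero).2 (ev fun d => P.mul_zero _)
  · intro x
    obtain ⟨f, -, hx⟩ := x.rep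
    exact ((hx.mul Rep.one).eq hx).2 (ev fun d => P.mul_one _)
  · intro x y z
    obtain ⟨f, -, hx⟩ := x.rep; obtain ⟨g, -, hy⟩ := y.rep; obtain ⟨k, -, hz⟩ := z.rep
    rw [hx.lt hy, hy.lt hz, hx.lt hz]
    exact fun h1 h2 => (h1.and h2).mono fun d hd => P.lt_trans _ _ _ hd.1 hd.2
  · intro x
    obtain ⟨f, -, hx⟩ := x.rep
    rw [hx.lt hx, ← Ultrafilter.eventually_not]
    exact ev fun d => P.lt_irrefl _
  · intro x y
    obtain ⟨f, -, hx⟩ := x.rep; obtain ⟨g, -, hy⟩ := y.rep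
    rw [hx.lt hy, hy.lt hx, hx.eq hy, ← Ultrafilter.eventually_or, ← Ultrafilter.eventually_or]
    exact ev fun d => P.lt_total _ _
  · intro x y z
    obtain ⟨f, -, hx⟩ := x.rep; obtain ⟨g, -, hy⟩ := y.rep; obtain ⟨k, -, hz⟩ := z.rep
    rw [hx.lt hy, (hx.add hz).lt (hy.add hz)]
    exact fun h1 => h1.mono fun d hd => P.add_lt_add _ _ _ hd
  · intro x y z
    obtain ⟨f, -, hx⟩ := x.rep; obtain ⟨g, -, hy⟩ := y.rep; obtain ⟨k, -, hz⟩ := z.rep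
    rw [hx.lt hy, Rep.zero.lt hz, (hx.mul hz).lt (hy.mul hz)]
    exact fun h1 h2 => (h1.and h2).mono fun d hd => P.mul_lt_mul _ _ _ hd.1 hd.2
  · intro x y
    obtain ⟨f, hf, hx⟩ := x.rep; obtain ⟨g, hg, hy⟩ := y.rep
    rw [hx.lt hy]
    intro h1
    obtain ⟨k, hk, h2⟩ := h.sk (k := 2) (fun M v => v 0 + v 2 = v 1) (SigR.d0 inferInstance) ![f, g]
      (by intro i; fin_cases i <;> assumption)
    refine ⟨RUT.mk h k hk, ((hx.add (Rep.mk hk)).eq hy).2 ((h1.and h2).mono fun d hd => ?_)⟩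
    obtain ⟨z, hz⟩ := P.sub_exists _ _ hd.1
    exact (hd.2 ⟨z, hz⟩).1
  · exact (Rep.zero.lt Rep.one).2 (ev fun d => P.zero_lt_one)
  · intro x
    obtain ⟨f, -, hx⟩ := x.rep
    rw [Rep.zero.lt hx, Rep.one.le hx]
    exact fun h1 => h1.mono fun d hd => P.discrete _ hd
  · intro x
    obtain ⟨f, -, hx⟩ := x.rep
    exact (Rep.zero.le hx).2 (ev fun d => P.zero_le _)

theorem RUT.losR {h : SkH n A U G} {k : ℕ} {φ : lang.BoundedFormula Empty k} (hφ : SigmaFm n k φ)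
    {v : Fin k → RUT h} {f : Fin k → I → A} (hv : ∀ i, Rep (v i) (f i)) :
    φ.Realize (M := RUT h) Empty.elim v ↔
      ∀ᶠ d in (U : Filter I), φ.Realize (M := A) Empty.elim (fun i => f i d) := by
  refine ((TV.hier.1 _ _ _ hφ).1 le_rfl v).trans ?_
  rw [← toUP_realize, ← funext hv]

theorem RUT.isig (h : SkH n A U G) (hn : 1 ≤ n) (hA : ISig n A) : ISig n (RUT h) := by
  intro B hB h0 hS x
  obtain ⟨k, φ, w, h1, h2⟩ := hB
  obtain ⟨φ', h3, h4⟩ := h1.subst (β := Empty) (m := k + 1)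
    (Sum.elim (Sum.elim (fun i => Term.var (Sum.inr (Fin.last k)))
      (fun i => Term.var (Sum.inr (Fin.castSucc i)))) finZeroElim)
  have key : ∀ x, x ∈ B ↔ φ'.Realize (M := RUT h) Empty.elim (Fin.snoc w x) := by
    intro x
    rw [h4]
    refine (h2 ![x]).trans ?_
    have e1 : Sum.elim ![x] w = fun a => Term.realize (Sum.elim Empty.elim (Fin.snoc w x : Fin (k+1) → RUT h))
        ((Sum.elim (Sum.elim (fun i => Term.var (Sum.inr (Fin.last k)))
      (fun i => Term.var (Sum.inr (Fin.castSucc i)))) finZeroElim : (Fin 1 ⊕ Fin k) ⊕ Fin 0 → lang.Term (Empty ⊕ Fin (k+1))) (Sum.inl a)) := by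
      ext (a | a)
      · simp [Fin.fin_one_eq_zero a]
      · simp
    rw [e1]
    exact iff_of_eq (congrArg _ (funext fun i => i.elim0))
  obtain ⟨f, hf, hw⟩ : ∃ f : Fin k → I → A, (∀ i, f i ∈ G) ∧ ∀ i, Rep (w i) (f i) := by
    choose f hf hw using fun i => (w i).rep
    exact ⟨f, hf, hw⟩
  have key2 : ∀ {x g}, Rep x g → (x ∈ B ↔ ∀ᶠ d in (U : Filter I), φ'.Realize (M := A) Empty.elim (Fin.snoc (fun i => f i d) (g d))) := by
    intro x g hx
    rw [key, RUT.losR h3 (f := Fin.snoc f g)]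
    · have e3 : ∀ d, (fun i => (Fin.snoc f g : Fin (k+1) → I → A) i d) = Fin.snoc (fun i => f i d) (g d) := by
        intro d; ext i
        refine Fin.lastCases ?_ (fun i => ?_) i <;> simp
      simp only [e3]
    · intro i
      refine Fin.lastCases ?_ (fun i => ?_) i
      · simpa using hx
      · simpa using hw i
  by_contra hx
  obtain ⟨g, hg, hxg⟩ := x.rep
  rw [key2 hxg, ← Ultrafilter.eventually_not] at hx
  rw [key2 Rep.zero] at h0
  let R : URel (k + 1) := fun M v => φ'.Realize (M := M) Empty.elim v
  have hR : Sg n n R := ⟨(SigR.of_fm (n := n)).1 _ _ _ h3⟩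
  have hR' : Sg n n (k := k + 1 + 1) (fun M v => ∃ y, y ≤ v (Fin.castSucc (Fin.last k)) ∧
      (y + v (Fin.last (k+1)) = v (Fin.castSucc (Fin.last k)) ∧ R M (Fin.snoc (fun i => v i.castSucc.castSucc) y))) :=
    inferInstance
  have mem : ∀ {g}, g ∈ G → ∀ i, (Fin.snoc f g : Fin (k+1) → I → A) i ∈ G := by
    intro g hg i
    refine Fin.lastCases ?_ (fun i => ?_) i
    · simpa using hg
    · simpa using hf i
  obtain ⟨u, hu, h5⟩ := h.sk _ hR'.out (Fin.snoc f g) (mem hg)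
  obtain ⟨y, hy, h6⟩ := h.sk (k := 2) (fun M v => v 2 + v 0 = v 1) (SigR.d0 inferInstance) ![u, g]
      (by intro i; fin_cases i <;> assumption)
  simp only [Fin.snoc_last, Fin.snoc_castSucc] at h5
  have main : ∀ᶠ d in (U : Filter I), R A (Fin.snoc (fun i => f i d) (y d)) ∧ ¬ R A (Fin.snoc (fun i => f i d) (y d + 1)) := by
    filter_upwards [hx, h0, h5, h6] with d hx h0 h5 h6
    obtain ⟨⟨z, hz, hz1, hz2⟩, h7⟩ := h5 ⟨g d, 0, _root_.zero_le, by simp, h0⟩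
    obtain ⟨h8, -⟩ := h6 ⟨z, hz1⟩
    have h8 : y d + u d = g d := h8
    have hzy : z = y d := by
      rw [← h8] at hz1; exact add_right_cancel hz1
    subst hzy
    refine ⟨hz2, fun h9 => ?_⟩
    rcases zero_or_succ (u d) with h10 | ⟨t, h10⟩
    · rw [h10, add_zero] at h8
      rw [h8] at hz2
      exact hx hz2
    · refine h7 t (by rw [h10]; exact ltS.2 le_rfl) ⟨y d + 1, ?_, ?_, h9⟩
      · rw [← h8, h10]; gcongr; exact le_add_self
      · rw [← h8, h10]; ring
  have m1 := (key2 (Rep.mk hy)).2 (main.mono fun d hd => hd.1)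
  have m2 := (key2 ((Rep.mk (h := h) hy).add Rep.one)).1 (hS _ m1)
  obtain ⟨d, h8, h9⟩ := (main.and m2).exists
  exact h8.2 h9

theorem RUT.ar (h : SkH n A U G) (hn : 1 ≤ n) (hA : ISig n A) : AR (RUT h) :=
  { out := RUT.pam h
    isig1 := fun B hB => by
      obtain ⟨k, φ, w, h1, h2⟩ := hB
      exact RUT.isig h hn hA B ⟨k, φ, w, h1.mono hn, h2⟩ }

/-- the restricted ultrapower as a model -/
def RUT.mod (h : SkH n A U G) (hn : 1 ≤ n) (hA : ISig n A) : Mod :=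
  ⟨RUT h, inferInstance, RUT.ar h hn hA⟩

theorem RUT.losS (h : SkH n A U G) (hn : 1 ≤ n) (hA : ISig n A) {k : ℕ} {R : URel k} (hR : SigR n n R)
    {v : Fin k → RUT h} {f : Fin k → I → A} (hv : ∀ i, Rep (v i) (f i)) :
    R (RUT.mod h hn hA) v ↔ ∀ᶠ d in (U : Filter I), R A (fun i => f i d) := by
  obtain ⟨φ, h1, h2⟩ := hR.to_fm
  simp only [h2 A hA]
  exact (h2 (RUT.mod h hn hA) (RUT.isig h hn hA) v).trans (RUT.losR h1 hv)

/-- the diagonal embedding -/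
def RUT.dia (h : SkH n A U G) (a : A) : RUT h := RUT.mk h (fun _ => a) (h.const a)


theorem Rep.dia (a : A) : Rep (RUT.dia h a) (fun _ => a) := rfl

theorem SkH.dia_elem (h : SkH n A U G) (hn : 1 ≤ n) (hA : ISig n A) : SigmaElem A (RUT h) (n + 1) (RUT.dia h) := by
  intro p φ hφ v
  obtain ⟨φ', h3, h4⟩ := hφ.subst (β := Empty) (m := p)
    (Sum.elim (fun i => Term.var (Sum.inr i)) finZeroElim)
  have e : ∀ (M : Type) [lang.Structure M] (v : Fin p → M),
      φ'.Realize Empty.elim v ↔ φ.Realize v finZeroElim := by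
    intro M _ v
    rw [h4]
    exact iff_of_eq (congrArg₂ _ (funext fun i => by simp) (funext fun i => i.elim0))
  rw [← e A, ← e (RUT h)]
  obtain ⟨S, h1, h2⟩ := (SigR.of_fm (n := n)).1 _ _ _ h3
  have h2N := h2 (RUT.mod h hn hA) (RUT.isig h hn hA) (RUT.dia h ∘ v)
  refine (h2 A hA v).trans (Iff.trans ?_ h2N.symm)
  have e3 : ∀ (g : I → A) d, (fun i => (Fin.snoc (fun i _ => v i) g : Fin (p+1) → I → A) i d) = Fin.snoc v (g d) := by
    intro g d; ext i
    refine Fin.lastCases ?_ (fun i => ?_) i <;> simp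
  have key : ∀ (x : RUT h) g, Rep x g → (S (RUT.mod h hn hA) (Fin.snoc (RUT.dia h ∘ v) x) ↔
      ∀ᶠ d in (U : Filter I), S A (Fin.snoc v (g d))) := by
    intro x g hx
    have := RUT.losS h hn hA h1 (v := Fin.snoc (RUT.dia h ∘ v) x) (f := Fin.snoc (fun i _ => v i) g) (by
      intro i
      refine Fin.lastCases ?_ (fun i => ?_) i
      · simpa using hx
      · simpa using Rep.dia (v i))
    simp only [e3] at this
    exact this
  constructor
  · rintro ⟨w, hw⟩
    refine ⟨RUT.dia h w, ?_⟩
    refine (not_congr (key (RUT.dia h w) _ (Rep.dia w))).2 ?_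
    rw [Filter.eventually_const]
    exact hw
  · rintro ⟨x, hx⟩
    obtain ⟨g, hg, hxg⟩ := RUT.rep x
    have hx := (not_congr (key x _ hxg)).1 hx
    rw [← Ultrafilter.eventually_not] at hx
    obtain ⟨d, hd⟩ := hx.exists
    exact ⟨_, hd⟩

theorem RUT.countable (h : SkH n A U G) {J : Type} [Countable J] (F : J → I → A)
    (hF : ∀ f ∈ G, ∃ j, ∀ᶠ d in (U : Filter I), f d = F j d) : Countable (RUT h) := by
  have : ∀ x : RUT h, ∃ j, Rep x (F j) := by
    intro x
    obtain ⟨f, hf, hx⟩ := x.rep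
    obtain ⟨j, hj⟩ := hF f hf
    exact ⟨j, hx.trans (toUP_eq.2 hj)⟩
  choose j hj using this
  refine Function.Injective.countable (f := j) fun x y hxy => ?_
  rw [(hj x).eq (hj y), hxy]
  exact Filter.Eventually.of_forall fun _ => rfl

end RU
end ArithFC

end

section
set_option linter.all false
open FirstOrder Language
set_option synthInstance.maxHeartbeats 400000
set_option synthInstance.maxSize 2000
set_option maxHeartbeats 1000000
namespace ArithFC

/-- good extensions -/
structure Ext (n : ℕ) (M N : Mod) (g : M → N) (a : M) : Prop where
  elem : SigmaElem M N (n + 1) g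
  cof : Cofinal M N g
  same : SameBelow M N g a
  isig : ISig n N
  ctb : Countable N

section
variable {n : ℕ} (M : Mod) (hM : ISig n M) (hn : 1 ≤ n)

/-- coded functions -/
def CodG (U : Ultrafilter M) : Set (M → M) := {f | ∃ s : M, ∀ᶠ d in (U : Filter M), f d = ev s d}

variable {U : Ultrafilter M} {V : M} (hV : ∀ᶠ d in (U : Filter M), d < V)

theorem ev_const (V a : M) : ∃ s : M, ∀ i, i < V → ev s i = a := by
  obtain ⟨w, hw⟩ := ex_bnd V (a + 1)
  obtain ⟨s, -, hs⟩ := codingL (fun i x : M => x = a) hw (fun i _ => ⟨a, ltS.2 le_rfl, rfl⟩)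
  exact ⟨s, fun i hi => (hs i hi).1⟩

theorem ev_id (V : M) : ∃ s : M, ∀ i, i < V → ev s i = i := by
  obtain ⟨w, hw⟩ := ex_bnd V V
  obtain ⟨s, -, hs⟩ := codingL (fun i x : M => x = i) hw (fun i hi => ⟨i, hi, rfl⟩)
  exact ⟨s, fun i hi => (hs i hi).1⟩

theorem CodG.skH (hM : ISig n M) (hn : 1 ≤ n) (hV : ∀ᶠ d in (U : Filter M), d < V) : SkH n M U (CodG M U) where
  const a := by
    obtain ⟨s, hs⟩ := ev_const M V a
    exact ⟨s, hV.mono fun d hd => (hs d hd).symm⟩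
  sk := by
    intro k R hR f hf
    choose p hp using hf
    have hR0 : Sg n n R := ⟨hR⟩
    have : DFv (k := k + 2) (fun M v => fun i : Fin k => ev (v i.castSucc.castSucc) (v (Fin.last k).castSucc)) :=
      ⟨fun i => inferInstance⟩
    have hR' : Sg n n (k := k + 2) (fun M v => R M (Fin.snoc (fun i => ev (v i.castSucc.castSucc) (v (Fin.last k).castSucc)) (v (Fin.last (k + 1))))) :=
      inferInstance
    obtain ⟨b, hb⟩ := strong_coll (h := hR') hn M hM p V
    have hL := hR'.toLD M hM
    let Q : M → M → Prop := fun d x => R M (Fin.snoc (fun i => ev (p i) d) x)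
    have hQ : LD2 Q := by
      constructor
      have := LD.substF (k := 2) (f := Fin.snoc (Fin.snoc (fun i _ => p i) (fun v => v 0)) (fun v => v 1)) hL (by
        intro i
        refine Fin.lastCases ?_ (fun i => ?_) i
        · simp only [Fin.snoc_last]; infer_instance
        · refine Fin.lastCases ?_ (fun i => ?_) i
          · simp only [Fin.snoc_last, Fin.snoc_castSucc]; infer_instance
          · simp only [Fin.snoc_castSucc]; exact LF.const _)
      refine this.congr fun v => ?_
      simp [Q]
    obtain ⟨w, hw⟩ := ex_bnd V (b + 1)
    obtain ⟨s, -, hs⟩ := codingL (fun d x : M => (Q d x ∧ ∀ y, y < x → ¬ Q d y) ∨ (x = 0 ∧ ∀ y, y < b → ¬ Q d y)) hw (fun d hd => by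
      by_cases hx : ∃ x, x < b ∧ Q d x
      · obtain ⟨x, hx, hxQ⟩ := hx
        obtain ⟨y, h1, h2, h3⟩ := LD.lnp (P := fun x => Q d x) inferInstance hxQ
        exact ⟨y, ltS.2 (h1.trans hx.le), Or.inl ⟨h2, h3⟩⟩
      · push Not at hx
        exact ⟨0, ltS.2 _root_.zero_le, Or.inr ⟨rfl, hx⟩⟩)
    refine ⟨fun d => ev s d, ⟨s, Filter.Eventually.of_forall fun _ => rfl⟩, ?_⟩
    have hp' := Filter.eventually_all.2 hp
    filter_upwards [hV, hp'] with d hd hpd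
    rintro ⟨x, hx⟩
    simp only [hpd] at hx ⊢
    rcases (hs d hd).1 with h | ⟨h1, h2⟩
    · exact h
    · obtain ⟨w, hw, hw2⟩ := hb d hd ⟨x, by simpa using hx⟩
      exact absurd (by simpa using hw2) (h2 w hw)

theorem ext_of_ultra (hM : ISig n M) (hn : 1 ≤ n) (hV : ∀ᶠ d in (U : Filter M), d < V) [Countable M] {a : M} (hom : ∀ s : M, ∃ c, ∀ᶠ d in (U : Filter M), ev s d = c ∨ a < ev s d) :
    ∃ (N : Mod) (g : M → N) (d : N), Ext n M N g a ∧ ∀ {k : ℕ} (R : URel (k + 1)), SigR n n R → ∀ p : Fin k → M,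
      (R N (Fin.snoc (fun i => g (p i)) d) ↔ ∀ᶠ d in (U : Filter M), R M (Fin.snoc p d)) := by
  have h := CodG.skH M hM hn hV
  have hid : (fun d : M => d) ∈ CodG M U := by
    obtain ⟨s, hs⟩ := ev_id M V
    exact ⟨s, hV.mono fun d hd => (hs d hd).symm⟩
  have cst : ∀ x : RUT h, ∃ s, Rep x (fun d => ev s d) := by
    intro x
    obtain ⟨f, ⟨s, hs⟩, hx⟩ := x.rep
    exact ⟨s, hx.trans (toUP_eq.2 hs)⟩
  refine ⟨RUT.mod h hn hM, RUT.dia h, RUT.mk h _ hid, ⟨h.dia_elem hn hM, ?_, ?_, RUT.isig h hn hM, ?_⟩, ?_⟩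
  · intro x
    obtain ⟨s, hs⟩ := cst x
    exact ⟨s, (hs.le (Rep.dia s)).2 (Filter.Eventually.of_forall fun d => ev_le _ _)⟩
  · intro x hx
    obtain ⟨s, hs⟩ := cst x
    have hx := (hs.le (Rep.dia a)).1 hx
    obtain ⟨c, hc⟩ := hom s
    refine ⟨c, ((Rep.dia c).eq hs).2 ?_⟩
    filter_upwards [hx, hc] with d h1 h2
    rcases h2 with h2 | h2
    · exact h2.symm
    · exact absurd h1 (not_le.2 h2)
  · exact RUT.countable h (fun s d => ev s d) (fun f hf => hf)
  · intro k R hR p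
    have e3 : ∀ d, (fun i => (Fin.snoc (fun i _ => p i) (fun d => d) : Fin (k+1) → M → M) i d) = Fin.snoc p d := by
      intro d; ext i
      refine Fin.lastCases ?_ (fun i => ?_) i <;> simp
    have := RUT.losS h hn hM hR (v := Fin.snoc (fun i => RUT.dia h (p i)) (RUT.mk h _ hid)) (f := Fin.snoc (fun i _ => p i) (fun d => d)) (by
      intro i
      refine Fin.lastCases ?_ (fun i => ?_) i
      · simpa using Rep.mk hid
      · simpa using Rep.dia (p i))
    simp only [e3] at this
    exact this

end
end ArithFC

end

section
set_option linter.all false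
open FirstOrder Language
set_option synthInstance.maxHeartbeats 400000
set_option synthInstance.maxSize 2000
set_option maxHeartbeats 1000000
namespace ArithFC

section
variable {n : ℕ}

/-- bounded version of a Σ_{n+1} colouring -/
def Sw (T : URel 4) (M : Mod) (P e s i w : M) : Prop := ∃ w', w' ≤ w ∧ ¬ T M ![P, pr e s, i, w']

/-- homogeneous set found -/
def Succ (T : URel 4) (M : Mod) (P e k x y : M) : Prop :=
  ∃ h i w, Inc h x ∧ (∀ j, j < x → ev h j < y) ∧ i < k ∧ ∀ s, Tup s e h x → Sw T M P e s i w

/-- uncoloured tuple found -/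
def Fail (T : URel 4) (M : Mod) (P e k y : M) : Prop :=
  ∃ d, Can e d ∧ Inc d e ∧ (∀ i, i < e → ev d i < y) ∧ ∀ i, i < k → ∀ w, ¬ Sw T M P e d i w

theorem Sw.mono {T : URel 4} {M : Mod} {P e s i w w' : M} (h : Sw T M P e s i w) (hw : w ≤ w') :
    Sw T M P e s i w' := by
  obtain ⟨u, h1, h2⟩ := h
  exact ⟨u, h1.trans hw, h2⟩

theorem Sw.pg {T : URel 4} (hT : SigR n n T) : Pg n n (k := 5) (fun M v => Sw T M (v 0) (v 1) (v 2) (v 3) (v 4)) := by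
  have : Sg n n T := ⟨hT⟩
  unfold Sw
  infer_instance

theorem Sw.ld {T : URel 4} (hT : SigR n n T) (M : Mod) (hM : ISig n M) : LD5 (Sw T M) :=
  ⟨(Sw.pg hT).toLD M hM⟩

variable {M : Mod}

theorem exists_sub_numM {b : M} (hb : Nonstd b) (t : ℕ) : ∃ r, b = r + numM M t := by
  obtain ⟨c, hc⟩ := exists_add_of_le (hb t).le
  exact ⟨c, by rw [hc, add_comm]⟩

theorem hom_seq {e K St b q0 : M} (hb : Nonstd b)
    (hSt : ∀ t, t < e * b → Big e K (ev St t) (ev St (t + 1))) (hq0 : Inc q0 (ev St (e * b)))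
    (col : ℕ → M) (hcol : ∀ t s, Tup s e q0 (ev St (e * b)) → ev (col t) s < K) :
    ∃ H L : ℕ → M, Sub (H 0) (L 0) q0 (ev St (e * b)) ∧ ∀ t, Inc (H t) (L t) ∧ Sub (H (t + 1)) (L (t + 1)) (H t) (L t) ∧
      ev St 0 ≤ L t ∧ ∀ s s', Tup s e (H (t+1)) (L (t+1)) → Tup s' e (H (t+1)) (L (t+1)) → ev (col t) s = ev (col t) s' := by
  choose r hr using exists_sub_numM hb
  have hr1 : ∀ t, r t = r (t + 1) + 1 := by
    intro t
    have h1 := hr t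
    have h2 := hr (t + 1)
    rw [h1] at h2
    change r t + numM M t = r (t + 1) + (numM M t + 1) at h2
    have : r t + numM M t = (r (t + 1) + 1) + numM M t := by rw [h2]; ring
    exact add_right_cancel this
  have hrb : ∀ t, r t ≤ b := fun t => by
    have := hr t
    calc r t ≤ r t + numM M t := le_self_add
      _ = b := this.symm
  let y := ev St (e * b)
  let L : ℕ → M := fun t => ev St (e * r t)
  have step : ∀ t (q : {q : M // Inc q (L t) ∧ Sub q (L t) q0 y}), ∃ q' : {q : M // Inc q (L (t+1)) ∧ Sub q (L (t+1)) q0 y},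
      Sub q'.1 (L (t+1)) q.1 (L t) ∧
      ∀ s s', Tup s e q'.1 (L (t+1)) → Tup s' e q'.1 (L (t+1)) → ev (col t) s = ev (col t) s' := by
    rintro t ⟨q, h1, h2⟩
    have e1 : e * r t = e * r (t + 1) + e := by rw [hr1 t]; ring
    have hL : L t = ev St (e * r (t + 1) + e) := by show ev St (e * r t) = _; rw [e1]
    have := ramsey (e := e) (K := K) (S := St) (a := e * r (t + 1)) (g := col t) (q := q) (by
      intro u hu
      apply hSt
      calc e * r (t+1) + u < e * r (t+1) + e := by gcongr
        _ = e * r t := e1.symm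
        _ ≤ e * b := by gcongr; exact hrb t) (by rwa [← hL]) (by
      intro s hs
      rw [← hL] at hs
      exact hcol t s (hs.sub h2))
    obtain ⟨q', h3, h4, h5⟩ := this
    rw [← hL] at h4
    exact ⟨⟨q', h3, h4.trans h2⟩, h4, h5⟩
  choose F hF using step
  have hr0 : r 0 = b := by
    have := hr 0
    rw [this]; exact (add_zero _).symm
  have hL0 : L 0 = y := by show ev St (e * r 0) = _; rw [hr0]
  let Q : ∀ t, {q : M // Inc q (L t) ∧ Sub q (L t) q0 y} := fun t => Nat.rec
    ⟨q0, by rw [hL0]; exact hq0, by rw [hL0]; exact fun i hi => ⟨i, hi, rfl⟩⟩ (fun t q => F t q) t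
  refine ⟨fun t => (Q t).1, L, (Q 0).2.2, fun t => ⟨(Q t).2.1, (hF t (Q t)).1, ?_, (hF t (Q t)).2⟩⟩
  have := big_mono (e := e) (K := K) (S := St) (a := 0) (b := e * b) (by intro t ht; simpa using hSt t ht) (t := 0) (t' := e * r t) (by positivity) (by gcongr; exact hrb t)
  simpa using this

theorem tup_exists {e q m : M} (hq : Inc q m) (hm : e ≤ m) : ∃ s, Tup s e q m := by
  obtain ⟨s, -, h1, h2⟩ := can_exists e q
  refine ⟨s, h1, fun j hj i hij => ?_, fun i hi => ⟨i, hi.trans_le hm, h2 i hi⟩⟩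
  rw [h2 j hj, h2 i (hij.trans hj)]
  exact hq j (hj.trans_le hm) i hij

/-- the colourings to be homogenised -/
theorem col1 (a V s : M) : ∃ g : M, ∀ d, d < V → (ev g d = ev s d ∧ ev s d ≤ a) ∨ (ev g d = a + 1 ∧ a < ev s d) := by
  obtain ⟨w, hw⟩ := ex_bnd V (a + 2)
  obtain ⟨g, -, hg⟩ := codingL (fun d x : M => (x = ev s d ∧ ev s d ≤ a) ∨ (x = a + 1 ∧ a < ev s d)) hw (fun d hd => by
    rcases le_or_gt (ev s d) a with h | h
    · exact ⟨_, h.trans_lt (lt_add_of_pos_right a zero_lt_two), Or.inl ⟨rfl, h⟩⟩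
    · exact ⟨a + 1, by gcongr; exact one_lt_two, Or.inr ⟨rfl, h⟩⟩)
  exact ⟨g, fun d hd => (hg d hd).1⟩

theorem col2 {T : URel 4} (hT : SigR n n T) (hM : ISig n M) (P e k V w : M) :
    ∃ g : M, ∀ d, d < V → (ev g d < k ∧ Sw T M P e d (ev g d) w) ∨ (ev g d = k ∧ ∀ i, i < k → ¬ Sw T M P e d i w) := by
  have := Sw.ld hT M hM
  obtain ⟨w', hw⟩ := ex_bnd V (k + 1)
  obtain ⟨g, -, hg⟩ := codingL (fun d x : M => (x < k ∧ Sw T M P e d x w) ∨ (x = k ∧ ∀ i, i < k → ¬ Sw T M P e d i w)) hw (fun d hd => by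
    by_cases h : ∃ i, i < k ∧ Sw T M P e d i w
    · obtain ⟨i, h1, h2⟩ := h
      exact ⟨i, ltS.2 h1.le, Or.inl ⟨h1, h2⟩⟩
    · push Not at h
      exact ⟨k, ltS.2 le_rfl, Or.inr ⟨rfl, h⟩⟩)
  exact ⟨g, fun d hd => (hg d hd).1⟩

theorem succ_of_hom {T : URel 4} {P e k x y q L q0 y0 i w : M} (hq : Inc q L) (hs : Sub q L q0 y0)
    (hq0 : ∀ i, i < y0 → ev q0 i < y) (hx : x ≤ L) (hi : i < k)
    (h : ∀ s, Tup s e q L → Sw T M P e s i w) : Succ T M P e k x y := by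
  refine ⟨q, i, w, fun j hj i hij => hq j (hj.trans_le hx) i hij, fun j hj => ?_, hi, fun s hs => h s (hs.sub fun i hi => ⟨i, hi.trans_le hx, rfl⟩)⟩
  obtain ⟨k, hk, e⟩ := hs j (hj.trans_le hx)
  rw [e]; exact hq0 k hk

theorem task_nonstd {T : URel 4} (hT : SigR n n T) (hM : ISig n M) (hn : 1 ≤ n) [Countable M] {a x e k P St b K y : M}
    (hb : Nonstd b) (hSt : ∀ t, t < e * b → Big e K (ev St t) (ev St (t + 1)))
    (hx : x ≤ ev St 0) (he : e ≤ ev St 0) (hK : a + 2 + k + 1 ≤ K) (hy : y = ev St (e * b)) :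
    Succ T M P e k x y ∨ ∃ (N : Mod) (g : M → N), Ext n M N g a ∧ Fail T N (g P) (g e) (g k) (g y) := by
  obtain ⟨q0, hq0⟩ := ev_id M y
  have hq0' : ∀ i, i < y → ev q0 i < y := fun i hi => by rw [hq0 i hi]; exact hi
  have hinc : Inc q0 y := fun j hj i hij => by rw [hq0 j hj, hq0 i (hij.trans hj)]; exact hij
  obtain ⟨V, hV⟩ := ex_bnd e y
  have hlt : ∀ s, Tup s e q0 y → s < V := fun s hs => hs.lt hq0' hV
  choose c1 hc1 using col1 (M := M) a V
  choose c2 hc2 using col2 hT hM P e k V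
  obtain ⟨ix, hix⟩ := exists_surjective_nat (M ⊕ M)
  let G : M ⊕ M → M := Sum.elim c1 c2
  have hG : ∀ z d, d < V → ev (G z) d < K := by
    rintro (s | w) d hd
    · refine lt_of_lt_of_le ?_ hK
      have h2 : a + 1 < a + 2 + k + 1 := by
        calc a + 1 < a + 2 := by gcongr; exact one_lt_two
          _ ≤ a + 2 + k := le_self_add
          _ ≤ _ := le_self_add
      rcases hc1 s d hd with h | h
      · show ev (c1 s) d < _
        rw [h.1]; exact (h.2.trans le_self_add).trans_lt h2
      · show ev (c1 s) d < _
        rw [h.1]; exact h2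
    · refine lt_of_le_of_lt ?_ (lt_of_lt_of_le (lt_add_one _) hK)
      have h2 : ev (c2 w) d ≤ k := by
        rcases hc2 w d hd with h | h
        · exact h.1.le
        · exact h.1.le
      exact h2.trans le_add_self
  obtain ⟨H, L, hH0, hH⟩ := hom_seq (q0 := q0) hb hSt (hy ▸ hinc) (fun t => G (ix t)) (fun t s hs => hG _ _ (hlt s (hy ▸ hs)))
  rw [← hy] at hH0
  have hHq : ∀ t, Sub (H t) (L t) q0 y := by
    intro t
    induction t with
    | zero => exact hH0
    | succ t ih => exact (hH t).2.1.trans ih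
  have hV' : ∀ t s, Tup s e (H t) (L t) → s < V := fun t s hs => hlt s (hs.sub (hHq t))
  by_cases hc : ∃ t w s, ix t = Sum.inr w ∧ Tup s e (H (t + 1)) (L (t + 1)) ∧ ev (c2 w) s < k
  · left
    obtain ⟨t, w, s, h1, h2, h3⟩ := hc
    refine succ_of_hom (w := w) (hH (t + 1)).1 (hHq (t + 1)) hq0' (hx.trans (hH (t + 1)).2.2.1) h3 fun s' hs' => ?_
    have h4 : ev (G (ix t)) s' = ev (G (ix t)) s := (hH t).2.2.2 s' s hs' h2
    rw [h1] at h4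
    change ev (c2 w) s' = ev (c2 w) s at h4
    rcases hc2 w s' (hV' _ _ hs') with h | h
    · rw [← h4]; exact h.2
    · exact absurd h3 (by rw [← h4, h.1]; exact lt_irrefl _)
  · right
    push Not at hc
    let A : ℕ → Set M := fun t => {s | Tup s e (H t) (L t)}
    have hA : Antitone A := antitone_nat_of_succ_le fun t s hs => Tup.sub hs (hH t).2.1
    have hne : (⨅ t, Filter.principal (A t)).NeBot := by
      refine Filter.iInf_neBot_of_directed ?_ ?_
      · intro i j
        exact ⟨max i j, Filter.principal_mono.2 (hA (le_max_left _ _)), Filter.principal_mono.2 (hA (le_max_right _ _))⟩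
      · intro t
        exact Filter.principal_neBot_iff.2 (tup_exists (hH t).1 (he.trans (hH t).2.2.1))
    let U := Ultrafilter.of (⨅ t, Filter.principal (A t))
    have hU : ∀ t, ∀ᶠ s in (U : Filter M), Tup s e (H t) (L t) := fun t =>
      (Ultrafilter.of_le _ : (U : Filter M) ≤ _) (Filter.mem_iInf_of_mem t (Filter.mem_principal_self _))
    obtain ⟨N, g, d, hE, hlos⟩ := ext_of_ultra M hM hn (U := U) (V := V) ((hU 0).mono fun s hs => hV' _ _ hs) (a := a) (by
      intro s
      obtain ⟨t, ht⟩ := hix (Sum.inl s)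
      obtain ⟨s0, hs0⟩ := tup_exists (hH (t + 1)).1 (he.trans (hH (t + 1)).2.2.1)
      refine ⟨ev (c1 s) s0, (hU (t + 1)).mono fun d hd => ?_⟩
      have h4 : ev (G (ix t)) d = ev (G (ix t)) s0 := (hH t).2.2.2 d s0 hd hs0
      rw [ht] at h4
      change ev (c1 s) d = ev (c1 s) s0 at h4
      rcases hc1 s d (hV' _ _ hd) with h | h
      · left; rw [← h4, h.1]
      · right; exact h.2)
    refine ⟨N, g, hE, d, ?_⟩
    have l1 := (hlos (k := 2) (fun M v => Can (v 0) (v 2) ∧ Inc (v 2) (v 0) ∧ ∀ i, i < v 0 → ev (v 2) i < v 1)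
      (SigR.d0 inferInstance) ![e, y]).2 ((hU 0).mono fun s hs => by
        refine ⟨hs.1, hs.2.1, fun i hi => ?_⟩
        obtain ⟨k, hk, h⟩ := (hs.sub (hHq 0)).2.2 i hi
        show ev s i < y
        rw [h]; exact hq0' k hk)
    have hpg := Sw.pg hT
    have hsg : Sg n n (k := 5) (fun M v => ∀ i, i < v 2 → ¬ Sw T M (v 0) (v 1) (v 4) i (v 3)) := by
      have : Pg n n (k := 6) (fun M v => Sw T M (v 0) (v 1) (v 4) (v 5) (v 3)) :=
        Pg.subst (h := hpg) (f := fun M v => ![v 0, v 1, v 4, v 5, v 3])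
      have : Sg n n (k := 6) (fun M v => ¬ Sw T M (v 0) (v 1) (v 4) (v 5) (v 3)) := inferInstance
      exact Sg.allLt (Q := fun M v i => ¬ Sw T M (v 0) (v 1) (v 4) i (v 3)) (h := this)
    have l2 : ∀ w : M, ∀ i, i < g k → ¬ Sw T N (g P) (g e) d i (g w) := by
      intro w
      refine (hlos (k := 4) _ hsg.out ![P, e, k, w]).2 ?_
      obtain ⟨t, ht⟩ := hix (Sum.inr w)
      refine (hU (t + 1)).mono fun s hs => ?_
      have h1 := hc t w s ht hs
      rcases hc2 w s (hV' _ _ hs) with h | h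
      · exact absurd h.1 (not_lt.2 h1)
      · exact h.2
    refine ⟨l1.1, l1.2.1, l1.2.2, fun i hi w hw => ?_⟩
    obtain ⟨w0, hw0⟩ := hE.cof w
    exact l2 w0 i hi (hw.mono hw0)

theorem task_std {T : URel 4} (hT : SigR n n T) (hM : ISig n M) [Countable M] {a x e k P St b K y : M}
    (hst : ∀ z : M, ∃ m, z = numM M m) (hb : b = 1) (hSt : ∀ t, t < e * b → Big e K (ev St t) (ev St (t + 1)))
    (hx : x ≤ ev St 0) (he : e ≤ ev St 0) (hK : a + 2 + k + 1 ≤ K) (hy : y = ev St (e * b)) :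
    Succ T M P e k x y ∨ Fail T M P e k y := by
  by_cases hF : Fail T M P e k y
  · exact Or.inr hF
  left
  have hF : ∀ d, Can e d → Inc d e → (∀ i, i < e → ev d i < y) → ∃ w, ∃ i, i < k ∧ Sw T M P e d i w := by
    intro d h1 h2 h3
    by_contra hc
    push Not at hc
    exact hF ⟨d, h1, h2, h3, fun i hi w => hc w i hi⟩
  have hV : ∀ m, ∃ w, ∀ d, d < numM M m → Can e d → Inc d e → (∀ i, i < e → ev d i < y) → ∃ i, i < k ∧ Sw T M P e d i w := by
    intro m
    induction m with
    | zero => exact ⟨0, fun d hd => absurd hd (not_lt_zero'' d)⟩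
    | succ m ih =>
      obtain ⟨w, hw⟩ := ih
      by_cases h : ∃ w', ∃ i, i < k ∧ Sw T M P e (numM M m) i w'
      · obtain ⟨w', i, h1, h2⟩ := h
        refine ⟨w + w', fun d hd a1 a2 a3 => ?_⟩
        rcases (ltS.1 hd).lt_or_eq with h | rfl
        · obtain ⟨i, h1, h2⟩ := hw d h a1 a2 a3
          exact ⟨i, h1, h2.mono le_self_add⟩
        · exact ⟨i, h1, h2.mono le_add_self⟩
      · refine ⟨w, fun d hd a1 a2 a3 => ?_⟩
        rcases (ltS.1 hd).lt_or_eq with h' | rfl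
        · exact hw d h' a1 a2 a3
        · exact absurd (hF _ a1 a2 a3) h
  obtain ⟨q0, hq0⟩ := ev_id M y
  have hq0' : ∀ i, i < y → ev q0 i < y := fun i hi => by rw [hq0 i hi]; exact hi
  have hinc : Inc q0 y := fun j hj i hij => by rw [hq0 j hj, hq0 i (hij.trans hj)]; exact hij
  obtain ⟨V, hVb⟩ := ex_bnd e y
  have hlt : ∀ s, Tup s e q0 y → s < V := fun s hs => hs.lt hq0' hVb
  obtain ⟨m, rfl⟩ := hst V
  obtain ⟨w, hw⟩ := hV m
  have hw : ∀ s, Tup s e q0 y → ∃ i, i < k ∧ Sw T M P e s i w := fun s hs => hw s (hlt s hs) hs.1 hs.2.1 (fun i hi => by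
    obtain ⟨k, hk, h⟩ := hs.2.2 i hi
    rw [h]; exact hq0' k hk)
  obtain ⟨g, hg⟩ := col2 hT hM P e k (numM M m) w
  have hg : ∀ s, Tup s e q0 y → ev g s < k ∧ Sw T M P e s (ev g s) w := by
    intro s hs
    rcases hg s (hlt s hs) with h | h
    · exact h
    · obtain ⟨i, h1, h2⟩ := hw s hs
      exact absurd h2 (h.2 i h1)
  subst hb
  have hy' : y = ev St (0 + e) := by rw [hy, mul_one, zero_add]
  have hkK : k ≤ K := (le_add_self.trans le_self_add : k ≤ a + 2 + k + 1).trans hK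
  obtain ⟨q, h1, h2, h3⟩ := ramsey (e := e) (K := K) (S := St) (a := 0) (g := g) (q := q0) (by
    intro t ht
    simpa using hSt t (by simpa using ht)) (hy' ▸ hinc) (fun s hs => (hg s (hy' ▸ hs)).1.trans_le hkK)
  rw [← hy'] at h2
  obtain ⟨s0, hs0⟩ := tup_exists h1 he
  refine succ_of_hom (i := ev g s0) (w := w) h1 h2 hq0' hx (hg s0 (hs0.sub h2)).1 fun s hs => ?_
  rw [← h3 s s0 hs hs0]
  exact (hg s (hs.sub h2)).2

end
end ArithFC

end

section
set_option linter.all false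
open FirstOrder Language
set_option synthInstance.maxHeartbeats 400000
set_option synthInstance.maxSize 2000
set_option maxHeartbeats 1000000
namespace ArithFC

section
variable {n m : ℕ}

/-- Σ-elementarity via open formulas -/
theorem sigmaElem_iff {M N : Type} [lang.Structure M] [lang.Structure N] {g : M → N} :
    SigmaElem M N m g ↔ ∀ k (φ : lang.BoundedFormula Empty k), SigmaFm m k φ → ∀ v : Fin k → M,
      (φ.Realize Empty.elim v ↔ φ.Realize Empty.elim (g ∘ v)) := by
  constructor
  · intro h k φ h1 v
    obtain ⟨φ', h3, h4⟩ := h1.subst (β := Fin k) (m := 0)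
      (Sum.elim Empty.elim (fun i => Term.var (Sum.inl i)))
    have e : ∀ (M : Type) [lang.Structure M] (v : Fin k → M),
        φ'.Realize v finZeroElim ↔ φ.Realize Empty.elim v := by
      intro M _ v
      rw [h4]
      have : (Empty.elim : Empty → M) = (fun a => Term.realize (Sum.elim v finZeroElim)
        ((Sum.elim Empty.elim (fun i => Term.var (Sum.inl i)) : Empty ⊕ Fin k →
        lang.Term (Fin k ⊕ Fin 0)) (Sum.inl a))) := by ext a; exact a.elim
      rw [← this]
      rfl
    rw [← e, ← e]
    exact h k φ' h3 v
  · intro h p φ hφ v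
    obtain ⟨φ', h3, h4⟩ := hφ.subst (β := Empty) (m := p)
      (Sum.elim (fun i => Term.var (Sum.inr i)) finZeroElim)
    have e : ∀ (M : Type) [lang.Structure M] (v : Fin p → M),
        φ'.Realize Empty.elim v ↔ φ.Realize v finZeroElim := by
      intro M _ v
      rw [h4]
      exact iff_of_eq (congrArg₂ _ (funext fun i => by simp) (funext fun i => i.elim0))
    rw [← e M, ← e N]
    exact h _ _ h3 v

theorem SigmaElem.pi {M N : Type} [lang.Structure M] [lang.Structure N] {g : M → N} (h : SigmaElem M N m g)
    {k} {φ : lang.BoundedFormula Empty k} (hφ : PiFm m k φ) (v : Fin k → M) :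
    φ.Realize Empty.elim v ↔ φ.Realize Empty.elim (g ∘ v) := by
  obtain ⟨φ', h1, h2⟩ := hier_neg.2 _ _ _ hφ
  have := sigmaElem_iff.1 h _ φ' h1 v
  rw [h2, h2] at this
  exact not_iff_not.1 this

theorem SigmaElem.id {M : Type} [lang.Structure M] : SigmaElem M M m id := fun p φ _ v => Iff.rfl

theorem SigmaElem.comp {M N K : Type} [lang.Structure M] [lang.Structure N] [lang.Structure K] {g : M → N} {g' : N → K}
    (h : SigmaElem M N m g) (h' : SigmaElem N K m g') : SigmaElem M K m (g' ∘ g) := fun p φ hφ v =>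
  (h p φ hφ v).trans (h' p φ hφ _)

/-- a Σ-elementary map is an embedding -/
noncomputable def SigmaElem.emb {M N : Type} [lang.Structure M] [lang.Structure N] {g : M → N} (h : SigmaElem M N m g) : M ↪[lang] N where
  toFun := g
  inj' := by
    intro x y hxy
    have := (sigmaElem_iff.1 h 2 (BoundedFormula.equal (Term.var (Sum.inr 0)) (Term.var (Sum.inr 1))) (.delta0 _ _ (.equal _ _ _)) ![x, y]).2
      (by simpa [BoundedFormula.Realize] using hxy)
    simpa [BoundedFormula.Realize] using this
  map_fun' := by
    intro k F v
    have := (sigmaElem_iff.1 h (k + 1) (BoundedFormula.equal (Term.var (Sum.inr (Fin.last k))) (Term.func F (fun i => Term.var (Sum.inr i.castSucc)))) (.delta0 _ _ (.equal _ _ _)) (Fin.snoc v (Structure.funMap F v))).1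
      (by simp [BoundedFormula.Realize])
    simpa [BoundedFormula.Realize, Function.comp_def] using this
  map_rel' := by
    intro k R v
    have := (sigmaElem_iff.1 h k (BoundedFormula.rel R (fun i => Term.var (Sum.inr i))) (.delta0 _ _ (.rel _ _ _ _)) v)
    simpa [BoundedFormula.Realize, Function.comp_def] using this.symm

theorem comp_two {M N : Type} (g : M → N) (x y : M) : g ∘ ![x, y] = ![g x, g y] := by
  ext i; fin_cases i <;> rfl

theorem Embedding.hom_lemmas {M N : Type} [lang.Structure M] [lang.Structure N] (g : M ↪[lang] N) :
    g 0 = 0 ∧ g 1 = 1 ∧ (∀ x y, g (x + y) = g x + g y) ∧ (∀ x y, g (x * y) = g x * g y) ∧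
    (∀ x y, g x < g y ↔ x < y) ∧ (∀ x y, g x ≤ g y ↔ x ≤ y) := by
  have hlt : (∀ x y, g x < g y ↔ x < y) := by
    intro x y
    have := g.map_rel (Rel.lt : lang.Relations 2) ![x, y]
    rw [comp_two] at this
    exact this
  refine ⟨?_, ?_, fun x y => ?_, fun x y => ?_, hlt, ?_⟩
  · exact (g.map_fun (Func.zero : lang.Functions 0) ![]).trans (congrArg _ (Subsingleton.elim _ _))
  · exact (g.map_fun (Func.one : lang.Functions 0) ![]).trans (congrArg _ (Subsingleton.elim _ _))
  · exact (g.map_fun (Func.add : lang.Functions 2) ![x, y]).trans (by rw [comp_two]; rfl)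
  · exact (g.map_fun (Func.mul : lang.Functions 2) ![x, y]).trans (by rw [comp_two]; rfl)
  · intro x y
    exact or_congr (hlt x y) g.injective.eq_iff

theorem limit_pam {G : ℕ → Mod} {N : Type} [lang.Structure N] (o : ∀ i, G i ↪[lang] N)
    (hc : ∀ x y z : N, ∃ i x' y' z', o i x' = x ∧ o i y' = y ∧ o i z' = z) : PAm N := by
  have H := fun i => Embedding.hom_lemmas (o i)
  have A : ∀ i, PAm (G i) := fun i => (G i).ar.out
  constructor
  · intro x y z
    obtain ⟨i, x, y, z, rfl, rfl, rfl⟩ := hc x y z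
    simp only [← (H i).2.2.1, (A i).add_assoc]
  · intro x y
    obtain ⟨i, x, y, z, rfl, rfl, -⟩ := hc x y y
    simp only [← (H i).2.2.1, (A i).add_comm x y]
  · intro x y z
    obtain ⟨i, x, y, z, rfl, rfl, rfl⟩ := hc x y z
    simp only [← (H i).2.2.2.1, (A i).mul_assoc]
  · intro x y
    obtain ⟨i, x, y, z, rfl, rfl, -⟩ := hc x y y
    simp only [← (H i).2.2.2.1, (A i).mul_comm x y]
  · intro x y z
    obtain ⟨i, x, y, z, rfl, rfl, rfl⟩ := hc x y z
    simp only [← (H i).2.2.2.1, ← (H i).2.2.1, (A i).ldistrib]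
  · intro x
    obtain ⟨i, x, -, -, rfl, -, -⟩ := hc x x x
    rw [← (H i).1, ← (H i).2.2.1, (A i).add_zero]
  · intro x
    obtain ⟨i, x, -, -, rfl, -, -⟩ := hc x x x
    rw [← (H i).1, ← (H i).2.2.2.1, (A i).mul_zero]
  · intro x
    obtain ⟨i, x, -, -, rfl, -, -⟩ := hc x x x
    rw [← (H i).2.1, ← (H i).2.2.2.1, (A i).mul_one]
  · intro x y z
    obtain ⟨i, x, y, z, rfl, rfl, rfl⟩ := hc x y z
    simp only [(H i).2.2.2.2.1]
    exact (A i).lt_trans x y z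
  · intro x
    obtain ⟨i, x, -, -, rfl, -, -⟩ := hc x x x
    rw [(H i).2.2.2.2.1]
    exact (A i).lt_irrefl x
  · intro x y
    obtain ⟨i, x, y, z, rfl, rfl, -⟩ := hc x y y
    simp only [(H i).2.2.2.2.1, (o i).injective.eq_iff]
    exact (A i).lt_total x y
  · intro x y z
    obtain ⟨i, x, y, z, rfl, rfl, rfl⟩ := hc x y z
    simp only [← (H i).2.2.1, (H i).2.2.2.2.1]
    exact (A i).add_lt_add x y z
  · intro x y z
    obtain ⟨i, x, y, z, rfl, rfl, rfl⟩ := hc x y z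
    simp only [← (H i).2.2.2.1, ← (H i).1, (H i).2.2.2.2.1]
    exact (A i).mul_lt_mul x y z
  · intro x y
    obtain ⟨i, x, y, z, rfl, rfl, -⟩ := hc x y y
    rw [(H i).2.2.2.2.1]
    intro h
    obtain ⟨z, hz⟩ := (A i).sub_exists x y h
    exact ⟨o i z, by rw [← (H i).2.2.1, hz]⟩
  · obtain ⟨i, -⟩ := hc 0 0 0
    rw [← (H i).1, ← (H i).2.1, (H i).2.2.2.2.1]
    exact (A i).zero_lt_one
  · intro x
    obtain ⟨i, x, -, -, rfl, -, -⟩ := hc x x x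
    rw [← (H i).1, ← (H i).2.1, (H i).2.2.2.2.1, (H i).2.2.2.2.2]
    exact (A i).discrete x
  · intro x
    obtain ⟨i, x, -, -, rfl, -, -⟩ := hc x x x
    rw [← (H i).1, (H i).2.2.2.2.2]
    exact (A i).zero_le x

section
variable {G : ℕ → Mod} {N : Type} [lang.Structure N] (o : ∀ i, G i ↪[lang] N)
  (F : ∀ i j, i ≤ j → G i → G j) (hF : ∀ i j h, SigmaElem (G i) (G j) m (F i j h))
  (hoF : ∀ i j h x, o j (F i j h x) = o i x) (hc : ∀ (i : ℕ) (x : N), ∃ j, i ≤ j ∧ ∃ x', o j x' = x)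

theorem limit_all (hoF : ∀ i j h x, o j (F i j h x) = o i x) (hc : ∀ (i : ℕ) (x : N), ∃ j, i ≤ j ∧ ∃ x', o j x' = x) {k} {φ : lang.BoundedFormula Empty (k + 1)}
    (h : ∀ i (v : Fin (k + 1) → G i), φ.Realize Empty.elim v ↔ φ.Realize Empty.elim (o i ∘ v))
    (h' : ∀ i j hij (v : Fin k → G i), φ.all.Realize Empty.elim v ↔ φ.all.Realize Empty.elim (F i j hij ∘ v))
    (i) (v : Fin k → G i) : φ.all.Realize Empty.elim v ↔ φ.all.Realize Empty.elim (o i ∘ v) := by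
  constructor
  · intro hv
    rw [BoundedFormula.realize_all]
    intro x
    obtain ⟨j, hij, x, rfl⟩ := hc i x
    have := (h' i j hij v).1 hv
    rw [BoundedFormula.realize_all] at this
    have := (h j _).1 (this x)
    rw [Fin.comp_snoc] at this
    convert this using 2
    ext i; simp [hoF]
  · intro hv
    rw [BoundedFormula.realize_all] at hv ⊢
    intro x
    rw [h, Fin.comp_snoc]
    exact hv _

theorem limit_elem (hF : ∀ i j h, SigmaElem (G i) (G j) m (F i j h)) (hoF : ∀ i j h x, o j (F i j h x) = o i x) (hc : ∀ (i : ℕ) (x : N), ∃ j, i ≤ j ∧ ∃ x', o j x' = x) : ∀ i, SigmaElem (G i) N m (o i) := by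
  have hD : ∀ {k} (φ : lang.BoundedFormula Empty k), IsDelta0 k φ → ∀ i (v : Fin k → G i), φ.Realize Empty.elim v ↔ φ.Realize Empty.elim (o i ∘ v) := by
    have eE : ∀ i, (Empty.elim : Empty → N) = o i ∘ Empty.elim := fun i => by ext a; exact a.elim
    intro k φ h
    induction h with
    | falsum => intro i v; exact Iff.rfl
    | equal k t u =>
      intro i v
      rw [eE i]
      simp only [BoundedFormula.Realize]
      rw [← Sum.comp_elim, HomClass.realize_term, HomClass.realize_term, (o i).injective.eq_iff]
    | rel k l R ts =>
      intro i v
      rw [eE i]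
      simp only [BoundedFormula.Realize]
      rw [← Sum.comp_elim]
      simp only [HomClass.realize_term]
      exact ((o i).map_rel R _).symm
    | imp k h1 h2 ih1 ih2 =>
      intro i v
      simp only [BoundedFormula.realize_imp, ih1 i v, ih2 i v]
    | bdAll k t h ih =>
      intro i v
      refine limit_all o F hoF hc (φ := (ltFm _ _).imp _) ?_ ?_ i v
      · intro i v
        simp only [BoundedFormula.realize_imp, ih i v]
        refine imp_congr ?_ Iff.rfl
        simp only [ltFm]
        rw [eE i]
        simp only [BoundedFormula.Realize]
        rw [← Sum.comp_elim]
        simp only [HomClass.realize_term]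
        exact ((o i).map_rel _ _).symm
      · intro i j hij v
        exact sigmaElem_iff.1 (hF i j hij) _ _ (.delta0 _ _ (.bdAll k t h)) v
  have key := hier_ind (α := Empty) (P := fun r k φ => SigmaFm r k φ ∧ (r ≤ m → ∀ i (v : Fin k → G i), φ.Realize Empty.elim v ↔ φ.Realize Empty.elim (o i ∘ v)))
    (Q := fun r k φ => PiFm r k φ ∧ (r ≤ m → ∀ i (v : Fin k → G i), φ.Realize Empty.elim v ↔ φ.Realize Empty.elim (o i ∘ v)))
    (fun r k φ h => ⟨.delta0 _ _ h, fun _ => hD φ h⟩)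
    (fun r k φ h => ⟨.ofPi _ _ h.1, fun hr => h.2 (by omega)⟩)
    (fun r k φ h => ⟨.ex _ _ h.1, fun hr i v => by
      have h1 := limit_all o F hoF hc (φ := φ.not) (fun i v => by
        simp only [BoundedFormula.realize_not, h.2 hr i v]) (fun i j hij v => by
        have := sigmaElem_iff.1 (hF i j hij) _ _ ((SigmaFm.ex _ _ h.1).mono hr) v
        simpa only [BoundedFormula.ex, BoundedFormula.realize_not, not_iff_not] using this) i v
      simp only [BoundedFormula.ex, BoundedFormula.realize_not, not_iff_not]
      exact h1⟩)
    (fun r k φ h => ⟨.delta0 _ _ h, fun _ => hD φ h⟩)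
    (fun r k φ h => ⟨.ofSigma _ _ h.1, fun hr => h.2 (by omega)⟩)
    (fun r k φ h => ⟨.all _ _ h.1, fun hr i v => by
      refine limit_all o F hoF hc (h.2 hr) (fun i j hij v => ?_) i v
      obtain ⟨φ', h1, h2⟩ := hier_neg.2 _ _ _ (PiFm.all _ _ h.1)
      have := sigmaElem_iff.1 (hF i j hij) _ φ' (h1.mono hr) v
      rw [h2, h2] at this
      exact not_iff_not.1 this⟩)
  intro i
  rw [sigmaElem_iff]
  intro k φ h v
  exact (key.1 _ _ _ h).2 le_rfl i v
end

theorem limit_isig {G : ℕ → Mod} {N : Type} [lang.Structure N] (o : ∀ i, G i ↪[lang] N)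
    (hG : ∀ i, ISig m (G i)) (ho : ∀ i, SigmaElem (G i) N m (o i))
    (hc : ∀ k (v : Fin k → N), ∃ i v', o i ∘ v' = v) : ISig m N := by
  rintro A ⟨p, φ, w, h1, h2⟩ h0 hs x
  obtain ⟨φ', h3, h4⟩ := h1.subst (β := Empty) (m := 1 + p)
    (Sum.elim (Sum.elim (fun i => Term.var (Sum.inr (Fin.castAdd p i)))
      (fun i => Term.var (Sum.inr (Fin.natAdd 1 i)))) finZeroElim)
  have e : ∀ (M : Type) [lang.Structure M] (v : Fin 1 → M) (w : Fin p → M),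
      φ'.Realize Empty.elim (Fin.append v w) ↔ φ.Realize (Sum.elim v w) finZeroElim := by
    intro M _ v w
    rw [h4]
    refine iff_of_eq (congrArg₂ _ (funext fun i => ?_) (funext fun i => i.elim0))
    rcases i with i | i <;> simp
  obtain ⟨i, v, hv⟩ := hc (p + 1) (Fin.snoc w x)
  have hw : o i ∘ (fun j => v (Fin.castSucc j)) = w := by
    ext j; have := congrFun hv (Fin.castSucc j); simpa using this
  have hx : o i (v (Fin.last p)) = x := by
    have := congrFun hv (Fin.last p); simpa using this
  let w' := (fun j => v (Fin.castSucc j))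
  have hA : ∀ z : G i, φ.Realize (Sum.elim ![z] w') finZeroElim ↔ o i z ∈ A := by
    intro z
    have := h2 ![o i z]
    rw [← e] at this ⊢
    refine (sigmaElem_iff.1 (ho i) _ φ' h3 _).trans (Iff.trans ?_ this.symm)
    have : o i ∘ Fin.append ![z] w' = Fin.append ![o i z] w := by
      rw [← hw]
      ext j
      refine Fin.addCases (fun j => ?_) (fun j => ?_) j
      · fin_cases j; simp
      · simp [w']
    rw [this]
  have H := Embedding.hom_lemmas (o i)
  have := hG i {z | o i z ∈ A} ⟨p, φ, w', h1, fun v => by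
    rw [show v = ![v 0] by ext j; fin_cases j; rfl]
    exact (hA _).symm⟩ (by show o i 0 ∈ A; rw [H.1]; exact h0) (by
      intro z hz
      show o i (z + 1) ∈ A
      rw [H.2.2.1, H.2.1]; exact hs _ hz) (v (Fin.last p))
  rw [← hx]; exact this

end
end ArithFC

end

section
set_option linter.all false
open FirstOrder Language
set_option synthInstance.maxHeartbeats 400000
set_option synthInstance.maxSize 2000
set_option maxHeartbeats 1000000
namespace ArithFC

theorem ISig.mono {m m' : ℕ} {M : Type} [lang.Structure M] (h : ISig m' M) (hm : m ≤ m') : ISig m M := by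
  rintro A ⟨p, φ, w, h1, h2⟩
  exact h A ⟨p, φ, w, h1.mono hm, h2⟩

theorem chain_limit {n : ℕ} (hn : 1 ≤ n) (G : ℕ → Mod) (hG : ∀ i, ISig n (G i)) (f : ∀ i, G i → G (i + 1))
    (hf : ∀ i, SigmaElem (G i) (G (i + 1)) (n + 1) (f i)) :
    ∃ (N : Mod) (o : ∀ i, G i → N), ISig n N ∧ (∀ i, SigmaElem (G i) N (n + 1) (o i)) ∧
      (∀ i x, o (i + 1) (f i x) = o i x) ∧ ∀ k (v : Fin k → N), ∃ i v', o i ∘ v' = v := by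
  let f' : ∀ i, G i ↪[lang] G (i + 1) := fun i => (hf i).emb
  let F := fun i j (h : i ≤ j) => DirectedSystem.natLERec f' i j h
  let N := Language.DirectLimit (fun i => (G i).carrier) F
  let o : ∀ i, G i ↪[lang] N := fun i => Language.DirectLimit.of lang ℕ (fun i => (G i).carrier) F i
  have hoF : ∀ i j h x, o j (F i j h x) = o i x := fun i j h x => Language.DirectLimit.of_f
  have hex : ∀ z : N, ∃ i x, o i x = z := Language.DirectLimit.exists_of
  have hF : ∀ i j h, SigmaElem (G i) (G j) (n + 1) (F i j h) := by
    intro i j h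
    induction h with
    | refl =>
      have : (F i i (Nat.le_refl i) : G i → G i) = id := by
        ext x; simp only [F, DirectedSystem.coe_natLERec]; exact Nat.leRecOn_self (C := fun i => (G i).carrier) x
      rw [this]; exact SigmaElem.id
    | step h ih =>
      rename_i j
      have : (F i (j + 1) (Nat.le_succ_of_le h) : G i → G (j + 1)) = f j ∘ F i j h := by
        ext x; simp only [F, DirectedSystem.coe_natLERec, Function.comp]
        rw [Nat.leRecOn_succ h]; rfl
      show SigmaElem _ _ _ (F i (j + 1) (Nat.le_succ_of_le h) : G i → G (j + 1))
      rw [this]; exact ih.comp (hf j)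
  have hof : ∀ i x, o (i + 1) (f i x) = o i x := by
    intro i x
    have : f i x = F i (i + 1) (Nat.le_succ i) x := by
      simp only [F, DirectedSystem.coe_natLERec]
      rw [Nat.leRecOn_succ le_rfl, Nat.leRecOn_self]; rfl
    rw [this, hoF]
  have hall : ∀ k (v : Fin k → N), ∃ i v', o i ∘ v' = v := by
    intro k v
    choose i x hx using fun j => hex (v j)
    let B := Finset.univ.sup i
    have hB : ∀ j, i j ≤ B := fun j => Finset.le_sup (Finset.mem_univ j)
    exact ⟨B, fun j => F (i j) B (hB j) (x j), by ext j; simp only [Function.comp, hoF, hx]⟩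
  have he := limit_elem o (fun i j h => F i j h) hF hoF (by
    intro i x
    obtain ⟨j, x, rfl⟩ := hex x
    exact ⟨max i j, le_max_left _ _, F j _ (le_max_right _ _) x, hoF _ _ _ _⟩)
  have hi : ISig n N := limit_isig o hG (fun i => by
    rw [sigmaElem_iff]
    intro k φ h v
    exact sigmaElem_iff.1 (he i) k φ (h.mono (Nat.le_succ n)) v) hall
  have hp : PAm N := limit_pam o (by
    intro x y z
    obtain ⟨i, v, hv⟩ := hall 3 ![x, y, z]
    exact ⟨i, v 0, v 1, v 2, congrFun hv 0, congrFun hv 1, congrFun hv 2⟩)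
  exact ⟨⟨N, inferInstance, { out := hp, isig1 := hi.mono hn }⟩, fun i => o i, hi, he, hof, hall⟩

end ArithFC

end

section
set_option linter.all false
open FirstOrder Language
set_option synthInstance.maxHeartbeats 400000
set_option synthInstance.maxSize 2000
set_option maxHeartbeats 1000000
namespace ArithFC

theorem Ext.refl {n : ℕ} {M : Mod} (a : M) (h : ISig n M) [Countable M] : Ext n M M id a :=
  ⟨SigmaElem.id, fun z => ⟨z, le_rfl⟩, fun z _ => ⟨z, rfl⟩, h, inferInstance⟩

/-- relation given by a formula -/
def FmR {k : ℕ} (φ : lang.BoundedFormula Empty k) : URel k := fun M v => φ.Realize Empty.elim v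

/-- failure for a packed task -/
def FailZ (T : URel 4) (M : Mod) (z : M) : Prop :=
  Fail T M (p1 z) (p1 (p2 z)) (p1 (p2 (p2 z))) (p1 (p2 (p2 (p2 z))))

/-- states of the construction -/
structure CSt (n : ℕ) where
  M : Mod
  ctb : Countable M
  isig : ISig n M
  a : M
  en : ℕ → ℕ → M

/-- one step -/
def CStep {n : ℕ} (Φ : ℕ → lang.BoundedFormula Empty 4) (l : ℕ) (s s' : CSt n) (g : s.M → s'.M) : Prop :=
  Ext n s.M s'.M g s.a ∧ s'.a = g s.a ∧ (∀ i r, i ≤ l → s'.en i r = g (s.en i r)) ∧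
  (∀ i, l < i → Function.Surjective (s'.en i)) ∧
  ∀ i r c, l = Nat.pair i (Nat.pair r c) →
    (∃ (N : Mod) (g' : s.M → N), Ext n s.M N g' s.a ∧ FailZ (FmR (Φ c)) N (g' (s.en i r))) →
    FailZ (FmR (Φ c)) s'.M (g (s.en i r))

theorem cstep_exists {n : ℕ} (Φ : ℕ → lang.BoundedFormula Empty 4) (l : ℕ) (s : CSt n) :
    ∃ (s' : CSt n) (g : s.M → s'.M), CStep Φ l s s' g := by
  have := s.ctb
  let i := l.unpair.1
  let r := l.unpair.2.unpair.1
  let c := l.unpair.2.unpair.2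
  have key : ∃ (N : Mod) (g' : s.M → N), Ext n s.M N g' s.a ∧
     ((∃ (N : Mod) (g' : s.M → N), Ext n s.M N g' s.a ∧ FailZ (FmR (Φ c)) N (g' (s.en i r))) → FailZ (FmR (Φ c)) N (g' (s.en i r))) := by
    by_cases h : ∃ (N : Mod) (g' : s.M → N), Ext n s.M N g' s.a ∧ FailZ (FmR (Φ c)) N (g' (s.en i r))
    · obtain ⟨N, g', h1, h2⟩ := h
      exact ⟨N, g', h1, fun _ => h2⟩
    · exact ⟨s.M, id, Ext.refl _ s.isig, fun h' => absurd h' h⟩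
  obtain ⟨N, g, h1, h2⟩ := key
  have := h1.ctb
  obtain ⟨en, hen⟩ := exists_surjective_nat N
  refine ⟨⟨N, h1.ctb, h1.isig, g s.a, fun i r => if i ≤ l then g (s.en i r) else en r⟩, g, h1, rfl, ?_, ?_, ?_⟩
  · intro i r hi; simp [hi]
  · intro i hi
    have : ¬ i ≤ l := by omega
    simpa [this] using hen
  · intro i' r' c' hl
    have e1 : i' = i := by simp [i, hl]
    have e2 : r' = r := by simp [r, hl]
    have e3 : c' = c := by simp [c, hl]
    rw [e1, e2, e3]
    exact h2

theorem fm_enum : ∃ Φ : ℕ → lang.BoundedFormula Empty 4, Function.Surjective Φ := by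
  have h1 : Countable lang.Symbols := by
    have a1 : Countable (Σ l, lang.Functions l) := by
      refine Function.Injective.countable (f := fun x : (Σ l, Func l) => match x with
        | ⟨_, .zero⟩ => 0 | ⟨_, .one⟩ => 1 | ⟨_, .add⟩ => 2 | ⟨_, .mul⟩ => (3 : ℕ)) ?_
      rintro ⟨_, x⟩ ⟨_, y⟩ h
      cases x <;> cases y <;> simp_all
    have a2 : Countable (Σ l, lang.Relations l) := by
      refine Function.Injective.countable (f := fun x : (Σ l, Rel l) => (0 : ℕ)) ?_
      rintro ⟨_, x⟩ ⟨_, y⟩ h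
      cases x; cases y; rfl
    exact inferInstanceAs (Countable ((Σ l, lang.Functions l) ⊕ (Σ l, lang.Relations l)))
  have h2 : Countable (Σ k, lang.BoundedFormula Empty k) := by
    rw [← Cardinal.mk_le_aleph0_iff]
    refine (BoundedFormula.card_le (L := lang) (α := Empty)).trans ?_
    have : lang.card ≤ Cardinal.aleph0 := Cardinal.mk_le_aleph0_iff.2 h1
    simpa using this
  have h3 : Countable (lang.BoundedFormula Empty 4) :=
    Function.Injective.countable (f := fun φ => (⟨4, φ⟩ : Σ k, lang.BoundedFormula Empty k)) (fun x y h => by simpa using h)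
  have : Nonempty (lang.BoundedFormula Empty 4) := ⟨⊥⟩
  exact exists_surjective_nat _

theorem Fail.congr {n : ℕ} {T T' : URel 4} {M : Mod} (h : ∀ v, T M v ↔ T' M v) {P e k y : M} : Fail T M P e k y ↔ Fail T' M P e k y := by
  unfold Fail Sw
  simp only [h]

theorem saturate {n : ℕ} (hn : 1 ≤ n) (M : Mod) [Countable M] (hM : ISig n M) (a : M) :
    ∃ (N : Mod) (g : M → N), SigmaElem M N (n + 1) g ∧ Cofinal M N g ∧ SameBelow M N g a ∧ ISig n N ∧
      ∀ T, SigR n n T → ∀ z : N, ∃ (L : Mod) (o : L → N) (z' a' : L), Countable L ∧ ISig n L ∧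
        SigmaElem L N (n + 1) o ∧ o z' = z ∧ o a' = g a ∧
        ((∃ (N' : Mod) (g' : L → N'), Ext n L N' g' a' ∧ FailZ T N' (g' z')) →
          ∃ (L' : Mod) (o' : L' → N) (z'' : L'), ISig n L' ∧ SigmaElem L' N (n + 1) o' ∧ o' z'' = z ∧ FailZ T L' z'') := by
  obtain ⟨Φ, hΦ⟩ := fm_enum
  choose nxt gg hgg using cstep_exists (n := n) Φ
  obtain ⟨en, hen⟩ := exists_surjective_nat M
  let S : ℕ → CSt n := fun l => Nat.rec ⟨M, inferInstance, hM, a, fun _ => en⟩ (fun l s => nxt l s) l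
  let G : ℕ → Mod := fun l => (S l).M
  let f : ∀ l, G l → G (l + 1) := fun l => gg l (S l)
  have hS : ∀ l, CStep Φ l (S l) (S (l + 1)) (f l) := fun l => hgg l (S l)
  obtain ⟨N, o, h1, h2, h3, h4⟩ := chain_limit hn G (fun i => (S i).isig) f (fun i => (hS i).1.elem)
  have h4 : ∀ z : N, ∃ i x, o i x = z := by
    intro z
    obtain ⟨i, v, hv⟩ := h4 1 ![z]
    exact ⟨i, v 0, congrFun hv 0⟩
  have hle : ∀ i x y, o i x ≤ o i y ↔ x ≤ y := fun i => (Embedding.hom_lemmas (h2 i).emb).2.2.2.2.2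
  have hcof : ∀ i x, ∃ y : M, o i x ≤ o 0 y := by
    intro i
    induction i with
    | zero => exact fun x => ⟨x, le_rfl⟩
    | succ i ih =>
      intro x
      obtain ⟨y, hy⟩ := (hS i).1.cof x
      obtain ⟨z, hz⟩ := ih y
      refine ⟨z, le_trans ?_ hz⟩
      rw [← h3 i y]; exact (hle _ _ _).2 hy
  have ha : ∀ i, o i (S i).a = o 0 a := by
    intro i
    induction i with
    | zero => rfl
    | succ i ih => rw [← ih, (hS i).2.1, h3]
  have hsame : ∀ i (x : G i), x ≤ (S i).a → ∃ y : M, o 0 y = o i x := by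
    intro i
    induction i with
    | zero => exact fun x _ => ⟨x, rfl⟩
    | succ i ih =>
      intro x hx
      rw [(hS i).2.1] at hx
      obtain ⟨y, rfl⟩ := (hS i).1.same x hx
      obtain ⟨z, hz⟩ := ih y ((hle i _ _).1 (by
        have := (hle (i + 1) _ _).2 hx
        rw [h3, h3] at this; exact this))
      exact ⟨z, by rw [hz, h3]⟩
  refine ⟨N, o 0, h2 0, ?_, ?_, h1, ?_⟩
  · intro z
    obtain ⟨i, x, rfl⟩ := h4 z
    exact hcof i x
  · intro z hz
    obtain ⟨i, x, rfl⟩ := h4 z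
    rw [← ha i] at hz
    exact hsame i x ((hle i _ _).1 hz)
  · intro T hT z
    obtain ⟨φ, h5, h6⟩ := hT.to_fm
    obtain ⟨c, rfl⟩ := hΦ φ
    have hTc : ∀ (M : Mod), ISig n M → ∀ z : M, FailZ T M z ↔ FailZ (FmR (Φ c)) M z := fun M hM z => Fail.congr (n := n) (h6 M hM)
    obtain ⟨i, x, hx⟩ := h4 z
    have hsur : Function.Surjective ((S i).en i) := by
      cases i with
      | zero => exact hen
      | succ i => exact (hS i).2.2.2.1 (i + 1) (Nat.lt_succ_self i)
    obtain ⟨r, hr⟩ := hsur x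
    have hpush : ∀ l, i ≤ l → o l ((S l).en i r) = z := by
      intro l hl
      induction l, hl using Nat.le_induction with
      | base => rw [hr, hx]
      | succ l hl ih => rw [(hS l).2.2.1 i r hl, h3, ih]
    let l := Nat.pair i (Nat.pair r c)
    have hil : i ≤ l := Nat.left_le_pair _ _
    refine ⟨G l, o l, (S l).en i r, (S l).a, (S l).ctb, (S l).isig, h2 l, hpush l hil, ha l, ?_⟩
    rintro ⟨N', g', hE, hF⟩
    have := (hS l).2.2.2.2 i r c rfl ⟨N', g', hE, (hTc N' hE.isig _).1 hF⟩
    exact ⟨G (l + 1), o (l + 1), f l ((S l).en i r), (S (l + 1)).isig, h2 (l + 1), by rw [h3]; exact hpush l hil, (hTc _ (S (l + 1)).isig _).2 this⟩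

end ArithFC

end

section
set_option linter.all false
open FirstOrder Language
set_option synthInstance.maxHeartbeats 400000
set_option synthInstance.maxSize 2000
set_option maxHeartbeats 1000000
namespace ArithFC

section
variable {M : Type} [lang.Structure M] [AR M]

theorem codes_iff (c : M) (X : Set M) (m : M) :
    CodesFinset c X m ↔ ∃ s, c = pr m s ∧ Inc s m ∧ ∀ x, x ∈ X ↔ ∃ i, i < m ∧ x = ev s i := by
  unfold CodesFinset Inc
  simp only [isPairC_iff, seqAt_iff]
  refine exists_congr fun s => and_congr Iff.rfl ?_
  constructor
  · rintro ⟨-, h2, h3⟩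
    exact ⟨fun j hj i hij => h2 i j _ _ hij hj rfl rfl, h3⟩
  · rintro ⟨h1, h2⟩
    refine ⟨fun i hi => ⟨_, (h2 _).2 ⟨i, hi, rfl⟩, rfl⟩, ?_, h2⟩
    rintro i j x y hij hj rfl rfl
    exact h1 j hj i hij

/-- decode a parameter vector -/
noncomputable def dcd : ∀ k : ℕ, M → Fin k → M
  | 0, _ => Fin.elim0
  | k + 1, c => Fin.snoc (dcd k (p1 c)) (p2 c)

theorem dcd_surj : ∀ (k : ℕ) (v : Fin k → M), ∃ c, dcd k c = v
  | 0, v => ⟨0, by ext i; exact i.elim0⟩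
  | k + 1, v => by
    obtain ⟨c, hc⟩ := dcd_surj k (fun i => v i.castSucc)
    refine ⟨pr c (v (Fin.last k)), ?_⟩
    simp only [dcd, p1_pr, p2_pr, hc]
    ext i
    refine Fin.lastCases ?_ (fun i => ?_) i <;> simp
end

theorem dcd_df {k : ℕ} : ∀ (l : ℕ) (t : UFun k) [DF t], DFv (fun M v => dcd l (t M v))
  | 0, t, _ => ⟨fun i => i.elim0⟩
  | l + 1, t, _ => by
    have := dcd_df l (fun M v => p1 (t M v))
    simp only [dcd]
    infer_instance

theorem color_norm {n : ℕ} {N : Mod} (hN : ISig n N) {C : N → N → Prop} (hC : SigmaDef2 (n + 1) N C) :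
    ∃ (T : URel 4) (P : N), SigR n n T ∧ ∀ d i, C d i ↔ ∃ w, ¬ T N ![P, d, i, w] := by
  obtain ⟨k, R, p, ⟨T0, h1, h2⟩, h3⟩ := SigR.of_def hC n
  obtain ⟨P, rfl⟩ := dcd_surj k p
  have hdf : DFv (k := 4) (fun M v => (Fin.append ![v 1, v 2] (dcd k (v 0)) : Fin (2 + k) → M)) := by
    have := dcd_df k (fun M (v : Fin 4 → M) => v 0)
    constructor
    intro i
    refine Fin.addCases (fun i => ?_) (fun i => ?_) i
    · simp only [Fin.append_left]; fin_cases i <;> (simp; infer_instance)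
    · simp only [Fin.append_right]; exact this.out i
  refine ⟨fun M v => T0 M (Fin.snoc (Fin.append ![v 1, v 2] (dcd k (v 0))) (v 3)), P, h1.substF _, fun d i => ?_⟩
  have := h3 ![d, i]
  rw [h2 N hN] at this
  exact this

section
variable {n : ℕ} {M N : Mod}

theorem numM_map {g : M → N} (h : SigmaElem M N (n + 1) g) (m : ℕ) : g (numM M m) = numM N m := by
  have H := Embedding.hom_lemmas h.emb
  induction m with
  | zero => exact H.1
  | succ m ih =>
    have := H.2.2.1 (numM M m) 1
    refine this.trans ?_
    rw [H.2.1]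
    exact congrArg (· + 1) ih

theorem Succ.sg {T : URel 4} (hT : SigR n n T) (hn : 1 ≤ n) : Sg n (n + 1) (k := 5) (fun M v => Succ T M (v 0) (v 1) (v 2) (v 3) (v 4)) := by
  obtain ⟨m, rfl⟩ : ∃ m, n = m + 1 := ⟨n - 1, by omega⟩
  have hpg := Sw.pg hT
  have h0 : Pg (m + 1) (m + 1) (k := 9) (fun M v => Sw T M (v 0) (v 1) (v 8) (v 6) (v 7)) :=
        Pg.subst (h := hpg) (f := fun M v => ![v 0, v 1, v 8, v 6, v 7])
  have h1 : Pg (m + 1) (m + 1) (k := 9) (fun M v => Tup (v 8) (v 1) (v 5) (v 3) → Sw T M (v 0) (v 1) (v 8) (v 6) (v 7)) := inferInstance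
  have h2 : Pg (m + 1) (m + 1) (k := 8) (fun M v => ∀ s, Tup s (v 1) (v 5) (v 3) → Sw T M (v 0) (v 1) s (v 6) (v 7)) :=
    Pg.all (Q := fun M v s => Tup s (v 1) (v 5) (v 3) → Sw T M (v 0) (v 1) s (v 6) (v 7)) (h := h1)
  have h3 : Sg (m + 1) (m + 1 + 1) (k := 8) (fun M v => Inc (v 5) (v 3) ∧ (∀ j, j < v 3 → ev (v 5) j < v 4) ∧ v 6 < v 2 ∧ ∀ s, Tup s (v 1) (v 5) (v 3) → Sw T M (v 0) (v 1) s (v 6) (v 7)) := inferInstance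
  have h4 : Sg (m + 1) (m + 1 + 1) (k := 7) (fun M v => ∃ w, Inc (v 5) (v 3) ∧ (∀ j, j < v 3 → ev (v 5) j < v 4) ∧ v 6 < v 2 ∧ ∀ s, Tup s (v 1) (v 5) (v 3) → Sw T M (v 0) (v 1) s (v 6) w) :=
    Sg.ex (Q := fun M v w => Inc (v 5) (v 3) ∧ (∀ j, j < v 3 → ev (v 5) j < v 4) ∧ v 6 < v 2 ∧ ∀ s, Tup s (v 1) (v 5) (v 3) → Sw T M (v 0) (v 1) s (v 6) w) (h := h3)
  have h5 : Sg (m + 1) (m + 1 + 1) (k := 6) (fun M v => ∃ i w, Inc (v 5) (v 3) ∧ (∀ j, j < v 3 → ev (v 5) j < v 4) ∧ i < v 2 ∧ ∀ s, Tup s (v 1) (v 5) (v 3) → Sw T M (v 0) (v 1) s i w) :=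
    Sg.ex (Q := fun M v i => ∃ w, Inc (v 5) (v 3) ∧ (∀ j, j < v 3 → ev (v 5) j < v 4) ∧ i < v 2 ∧ ∀ s, Tup s (v 1) (v 5) (v 3) → Sw T M (v 0) (v 1) s i w) (h := h4)
  exact Sg.ex (Q := fun M v h => ∃ i w, Inc h (v 3) ∧ (∀ j, j < v 3 → ev h j < v 4) ∧ i < v 2 ∧ ∀ s, Tup s (v 1) h (v 3) → Sw T M (v 0) (v 1) s i w) (h := h5)

theorem tot_sg {T : URel 4} (hT : SigR n n T) : Sg n (n + 1) (k := 4) (fun M v => ∃ i w, i < v 2 ∧ ¬ T M ![v 0, pr (v 1) (v 3), i, w]) := by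
  have : Sg n n T := ⟨hT⟩
  have : Pg n n (k := 6) (fun M v => ¬ T M ![v 0, pr (v 1) (v 3), v 4, v 5]) := inferInstance
  have : Sg n (n + 1) (k := 6) (fun M v => ¬ T M ![v 0, pr (v 1) (v 3), v 4, v 5]) := inferInstance
  have : Sg n (n + 1) (k := 6) (fun M v => v 4 < v 2 ∧ ¬ T M ![v 0, pr (v 1) (v 3), v 4, v 5]) := inferInstance
  have : Sg n (n + 1) (k := 5) (fun M v => ∃ w, v 4 < v 2 ∧ ¬ T M ![v 0, pr (v 1) (v 3), v 4, w]) :=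
    Sg.ex (Q := fun M v w => v 4 < v 2 ∧ ¬ T M ![v 0, pr (v 1) (v 3), v 4, w]) (h := this)
  exact Sg.ex (Q := fun M v i => ∃ w, i < v 2 ∧ ¬ T M ![v 0, pr (v 1) (v 3), i, w]) (h := this)
end

/-- part one, bundled -/
theorem part1 {n : ℕ} (hn : 1 ≤ n) (M : Mod) [Countable M] (hM : ISig n M) (a : M) :
    ∃ (N : Mod) (g : M → N), SigmaElem M N (n + 1) g ∧ Cofinal M N g ∧ SameBelow M N g a ∧ ISig n N ∧
      ∀ e k : N, FRT N (n + 1) e k := by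
  obtain ⟨N, g, h1, h2, h3, hN, hsat⟩ := saturate hn M hM a
  refine ⟨N, g, h1, h2, h3, hN, ?_⟩
  intro e k x
  obtain ⟨b, hb⟩ : ∃ b : N, Nonstd b ∨ (b = 1 ∧ ∀ z : N, ∃ m, z = numM N m) := by
    by_cases h : ∃ b : N, Nonstd b
    · obtain ⟨b, hb⟩ := h; exact ⟨b, Or.inl hb⟩
    · refine ⟨1, Or.inr ⟨rfl, fun z => ?_⟩⟩
      by_contra hc
      push Not at hc
      refine h ⟨z, fun m => ?_⟩
      induction m with
      | zero => exact lt_of_le_of_ne _root_.zero_le (hc 0).symm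
      | succ m ih => exact lt_of_le_of_ne (Sle.2 ih) (hc (m + 1)).symm
  obtain ⟨St, hSt0, hSt⟩ := tower e (g a + 2 + k + 1) (x + e) (e * b)
  let y := ev St (e * b)
  refine ⟨y, fun C hC => ?_⟩
  obtain ⟨hC1, hC2, hC3⟩ := hC
  obtain ⟨T, P, hT, hTC⟩ := color_norm hN hC1
  let z := pr P (pr e (pr k (pr y (pr x (pr St b)))))
  obtain ⟨L, o, z', a', hctb, hL, ho, hz, ha, hfail⟩ := hsat T hT z
  have H := Embedding.hom_lemmas ho.emb
  have hob : o (p2 (p2 (p2 (p2 (p2 (p2 z')))))) = b := by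
    have := (SigR.elem (n := n) (m := n + 1) (R := fun M (v : Fin 2 → M) => v 1 = p2 (p2 (p2 (p2 (p2 (p2 (v 0))))))) (SigR.d0 inferInstance) hL hN ho ![z', p2 (p2 (p2 (p2 (p2 (p2 z')))))]).1 rfl
    change o _ = p2 (p2 (p2 (p2 (p2 (p2 (o z')))))) at this
    rw [hz] at this
    simpa [z] using this
  have D : D0 (k := 2) (fun M v => (∀ t, t < (p1 (p2 (v 0))) * (p2 (p2 (p2 (p2 (p2 (p2 (v 0))))))) → Big (p1 (p2 (v 0))) (v 1 + (1 + 1) + p1 (p2 (p2 (v 0))) + 1) (ev (p1 (p2 (p2 (p2 (p2 (p2 (v 0))))))) t) (ev (p1 (p2 (p2 (p2 (p2 (p2 (v 0))))))) (t + 1)))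
      ∧ p1 (p2 (p2 (p2 (p2 (v 0))))) ≤ ev (p1 (p2 (p2 (p2 (p2 (p2 (v 0))))))) 0 ∧ p1 (p2 (v 0)) ≤ ev (p1 (p2 (p2 (p2 (p2 (p2 (v 0))))))) 0
      ∧ p1 (p2 (p2 (p2 (v 0)))) = ev (p1 (p2 (p2 (p2 (p2 (p2 (v 0))))))) (p1 (p2 (v 0)) * p2 (p2 (p2 (p2 (p2 (p2 (v 0)))))))) := inferInstance
  have hL1 := (SigR.elem (n := n) (m := n + 1) (SigR.d0 D) hL hN ho ![z', a']).2 (by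
    rw [comp_two, hz, ha]
    simp only [Matrix.cons_val_zero, Matrix.cons_val_one]
    simp only [z, p1_pr, p2_pr]
    rw [one_add_one_eq_two]
    refine ⟨hSt, ?_, ?_, rfl⟩
    · rw [hSt0]; exact le_self_add
    · rw [hSt0]; exact le_add_self)
  simp only [Matrix.cons_val_zero, Matrix.cons_val_one] at hL1
  rw [one_add_one_eq_two] at hL1
  obtain ⟨b1, b2, b3, b4⟩ := hL1
  have main : Succ T L (p1 z') (p1 (p2 z')) (p1 (p2 (p2 z'))) (p1 (p2 (p2 (p2 (p2 z'))))) (p1 (p2 (p2 (p2 z')))) ∨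
      (∃ (N' : Mod) (g' : L → N'), Ext n L N' g' a' ∧ FailZ T N' (g' z')) := by
    rcases hb with hb | ⟨hb, hst⟩
    · have := task_nonstd (P := p1 z') (a := a') hT hL hn (b := p2 (p2 (p2 (p2 (p2 (p2 z')))))) (by
        intro m
        refine (H.2.2.2.2.1 _ _).1 ?_
        show o _ < o _
        rw [hob, numM_map ho]; exact hb m) b1 b2 b3 le_rfl b4
      refine this.imp id ?_
      rintro ⟨N', g', hE, hF⟩
      refine ⟨N', g', hE, ?_⟩
      have e1 := (SigR.elem (n := n) (m := n + 1) (R := fun M (v : Fin 5 → M) => v 1 = p1 (v 0) ∧ v 2 = p1 (p2 (v 0)) ∧ v 3 = p1 (p2 (p2 (v 0))) ∧ v 4 = p1 (p2 (p2 (p2 (v 0))))) (SigR.d0 inferInstance) hL hE.isig hE.elem ![z', p1 z', p1 (p2 z'), p1 (p2 (p2 z')), p1 (p2 (p2 (p2 z')))]).1 ⟨rfl, rfl, rfl, rfl⟩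
      obtain ⟨e1, e2, e3, e4⟩ := e1
      change g' _ = p1 (g' z') at e1
      change g' _ = p1 (p2 (g' z')) at e2
      change g' _ = p1 (p2 (p2 (g' z'))) at e3
      change g' _ = p1 (p2 (p2 (p2 (g' z')))) at e4
      unfold FailZ
      rw [← e1, ← e2, ← e3, ← e4]
      exact hF
    · have := task_std (P := p1 z') (a := a') hT hL (b := p2 (p2 (p2 (p2 (p2 (p2 z')))))) (by
        intro z
        obtain ⟨m, hm⟩ := hst (o z)
        rw [← numM_map ho] at hm
        exact ⟨m, ho.emb.injective hm⟩) (by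
        refine ho.emb.injective ?_
        rw [H.2.1]
        exact hob.trans hb) b1 b2 b3 le_rfl b4
      exact this.imp id fun h => ⟨L, id, Ext.refl _ hL, h⟩
  have hnoF : ¬ ∃ (L' : Mod) (o' : L' → N) (z'' : L'), ISig n L' ∧ SigmaElem L' N (n + 1) o' ∧ o' z'' = z ∧ FailZ T L' z'' := by
    rintro ⟨L', o', z'', hL', ho', hz'', d, c1, c2, c3, c4⟩
    have e1 := (SigR.elem (n := n) (m := n + 1) (R := fun M (v : Fin 2 → M) => Can (p1 (p2 (v 0))) (v 1) ∧ Inc (v 1) (p1 (p2 (v 0))) ∧ ∀ i, i < p1 (p2 (v 0)) → ev (v 1) i < p1 (p2 (p2 (p2 (v 0))))) (SigR.d0 inferInstance) hL' hN ho' ![z'', d]).1 ⟨c1, c2, c3⟩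
    rw [comp_two, hz''] at e1
    simp only [Matrix.cons_val_zero, Matrix.cons_val_one] at e1
    simp only [z, p1_pr, p2_pr] at e1
    obtain ⟨i, hi, hCi⟩ := hC2 (pr e (o' d)) {x | ∃ i, i < e ∧ x = ev (o' d) i} ⟨(codes_iff _ _ _).2 ⟨_, rfl, e1.2.1, fun x => Iff.rfl⟩, by
      rintro z ⟨i, hi, rfl⟩
      exact e1.2.2 i hi⟩
    obtain ⟨w, hw⟩ := (hTC _ _).1 hCi
    have hsg := tot_sg hT
    have e2 := (SigR.elem (n := n) (m := n + 1) ((hsg.subst (k := 2) (f := fun M v => ![p1 (v 0), p1 (p2 (v 0)), p1 (p2 (p2 (v 0))), v 1])).out) hL' hN ho' ![z'', d]).2 (by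
      rw [comp_two, hz'']
      simp only [Matrix.cons_val_zero, Matrix.cons_val_one]
      simp only [z, p1_pr, p2_pr]
      exact ⟨i, w, hi, hw⟩)
    obtain ⟨i, w, hi, hw⟩ := e2
    exact c4 i hi w ⟨w, le_rfl, hw⟩
  have main' := main.resolve_right fun h => hnoF (hfail h)
  have hS : Succ T N P e k x y := by
    have hsg := Succ.sg hT hn
    have e2 := (SigR.elem (n := n) (m := n + 1) ((hsg.subst (k := 1) (f := fun M v => ![p1 (v 0), p1 (p2 (v 0)), p1 (p2 (p2 (v 0))), p1 (p2 (p2 (p2 (p2 (v 0))))), p1 (p2 (p2 (p2 (v 0))))])).out) hL hN ho ![z']).1 main'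
    have : o ∘ ![z'] = ![z] := by ext i; fin_cases i; exact hz
    rw [this] at e2
    change Succ T N (p1 z) (p1 (p2 z)) (p1 (p2 (p2 z))) (p1 (p2 (p2 (p2 (p2 z))))) (p1 (p2 (p2 (p2 z)))) at e2
    simpa only [z, p1_pr, p2_pr] using e2
  obtain ⟨h, i, w, s1, s2, s3, s4⟩ := hS
  refine ⟨pr x h, {u | ∃ i, i < x ∧ u = ev h i}, (codes_iff _ _ _).2 ⟨_, rfl, s1, fun x => Iff.rfl⟩, ?_, i, ?_⟩
  · rintro z ⟨i, hi, rfl⟩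
    exact s2 i hi
  · intro d D hD hDH
    have hDy : ∀ z ∈ D, z < y := by
      intro z hz
      obtain ⟨i, hi, rfl⟩ := hDH hz
      exact s2 i hi
    obtain ⟨i', hi', hCi'⟩ := hC2 d D ⟨hD, hDy⟩
    obtain ⟨s, rfl, t1, t2⟩ := (codes_iff _ _ _).1 hD
    obtain ⟨s', -, u1, u2⟩ := can_exists e s
    have hinc : Inc s' e := fun j hj i hij => by
      rw [u2 j hj, u2 i (hij.trans hj)]; exact t1 j hj i hij
    have htup : Tup s' e h x := ⟨u1, hinc, fun i hi => by
      rw [u2 i hi]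
      obtain ⟨k, hk, e⟩ := hDH ((t2 (ev s i)).2 ⟨i, hi, rfl⟩)
      exact ⟨k, hk, e⟩⟩
    obtain ⟨w', -, hw'⟩ := s4 s' htup
    have hCi : C (pr e s') i := (hTC _ _).2 ⟨w', hw'⟩
    have := hC3 (pr e s) (pr e s') D i' i ⟨hD, hDy⟩ ⟨(codes_iff _ _ _).2 ⟨s', rfl, hinc, fun x => by
      rw [t2]
      constructor
      · rintro ⟨i, hi, rfl⟩; exact ⟨i, hi, (u2 i hi).symm⟩
      · rintro ⟨i, hi, rfl⟩; exact ⟨i, hi, u2 i hi⟩⟩, hDy⟩ hCi' hCi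
    rwa [← this]

end ArithFC

end

section
set_option linter.all false
open FirstOrder Language
set_option synthInstance.maxHeartbeats 400000
set_option synthInstance.maxSize 2000
set_option maxHeartbeats 1000000
namespace ArithFC

/-- the standard structure -/
@[reducible] def natStr : lang.Structure ℕ where
  funMap := fun {k} f => match k, f with
    | _, Func.zero => fun _ => 0
    | _, Func.one => fun _ => 1
    | _, Func.add => fun v => v 0 + v 1
    | _, Func.mul => fun v => v 0 * v 1
  RelMap := fun {k} r => match k, r with
    | _, Rel.lt => fun v => v 0 < v 1

theorem nat_pam : @PAm ℕ natStr :=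
  letI := natStr
  { add_assoc := Nat.add_assoc
    add_comm := Nat.add_comm
    mul_assoc := Nat.mul_assoc
    mul_comm := Nat.mul_comm
    ldistrib := Nat.mul_add
    add_zero := Nat.add_zero
    mul_zero := Nat.mul_zero
    mul_one := Nat.mul_one
    lt_trans := fun _ _ _ => Nat.lt_trans
    lt_irrefl := Nat.lt_irrefl
    lt_total := Nat.lt_trichotomy
    add_lt_add := fun _ _ z h => Nat.add_lt_add_right h z
    mul_lt_mul := fun _ _ _ h h' => Nat.mul_lt_mul_of_pos_right h h'
    sub_exists := fun x y h => ⟨Nat.sub y x, Nat.add_sub_of_le (Nat.le_of_lt h)⟩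
    zero_lt_one := Nat.zero_lt_one
    discrete := fun x h => (Nat.lt_or_eq_of_le (Nat.succ_le_of_lt h))
    zero_le := fun x => (Nat.lt_or_eq_of_le (Nat.zero_le x)) }

theorem nat_isig (n : ℕ) : @ISig n ℕ natStr := by
  intro A _ h0 hS x
  exact Nat.rec (motive := fun x => x ∈ A) h0 hS x

/-- the standard model -/
def Nst : Mod := ⟨ℕ, natStr, @AR.mk _ natStr (@PAM.mk _ natStr nat_pam) (nat_isig 1)⟩

theorem Nst_isig (n : ℕ) : ISig n Nst := nat_isig n

/-- a natural number as an element of the standard model -/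
def tn (x : ℕ) : Nst := x
def fn (x : Nst) : ℕ := x

@[simp] theorem tn_fn (x : Nst) : tn (fn x) = x := rfl
@[simp] theorem fn_tn (x : ℕ) : fn (tn x) = x := rfl
theorem tn_lt {x y : ℕ} : tn x < tn y ↔ x < y := Iff.rfl
theorem tn_le {x y : ℕ} : tn x ≤ tn y ↔ x ≤ y := Nat.le_iff_lt_or_eq.symm
theorem tn_add (x y : ℕ) : tn (x + y) = tn x + tn y := rfl
theorem tn_mul (x y : ℕ) : tn (x * y) = tn x * tn y := rfl
theorem tn_zero : tn 0 = 0 := rfl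
theorem tn_one : tn 1 = 1 := rfl
theorem tn_inj {x y : ℕ} : tn x = tn y ↔ x = y := Iff.rfl
theorem tn_forall {P : Nst → Prop} : (∀ x, P x) ↔ ∀ x : ℕ, P (tn x) := Iff.rfl
theorem tn_exists {P : Nst → Prop} : (∃ x, P x) ↔ ∃ x : ℕ, P (tn x) := Iff.rfl

/-- Mathlib's pairing as a relation -/
def NP {M : Type} [lang.Structure M] (z x y : M) : Prop :=
  (x < y ∧ z = y * y + x) ∨ (y ≤ x ∧ z = x * x + x + y)

instance : D03 (fun M (z x y : M) => NP z x y) := by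
  unfold NP; constructor; infer_instance

theorem NP_iff {z x y : ℕ} : NP (tn z) (tn x) (tn y) ↔ z = Nat.pair x y := by
  unfold NP Nat.pair
  simp only [← tn_mul, ← tn_add, tn_lt, tn_le, tn_inj]
  split <;> omega

theorem Nst_seq (h : ℕ → ℕ) (m : ℕ) : ∃ s : Nst, ∀ i < m, ev s (tn i) = tn (h i) := by
  induction m with
  | zero => exact ⟨0, by simp⟩
  | succ m ih =>
    obtain ⟨s, hs⟩ := ih
    obtain ⟨w, hw⟩ := ex_bnd (tn (m + 1)) (s + tn (h m) + 1)
    obtain ⟨s', -, hs'⟩ := codingL (fun i x : Nst => (i < tn m ∧ x = ev s i) ∨ (i = tn m ∧ x = tn (h m))) hw (fun i hi => by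
      rcases (ltS.1 hi).lt_or_eq with h' | h'
      · exact ⟨ev s i, ltS.2 ((ev_le _ _).trans le_self_add), Or.inl ⟨h', rfl⟩⟩
      · exact ⟨tn (h m), ltS.2 le_add_self, Or.inr ⟨h', rfl⟩⟩)
    refine ⟨s', fun i hi => ?_⟩
    rcases (hs' (tn i) hi).1 with ⟨h1, h2⟩ | ⟨h1, h2⟩
    · rw [h2, hs i h1]
    · rw [h2, tn_inj.1 h1]

/-- graph of a function is uniformly Σ₁ -/
def GrS (n : ℕ) (f : ℕ → ℕ) : Prop :=
  ∃ R : URel 2, Sg n 1 R ∧ ∀ x y, R Nst ![tn x, tn y] ↔ y = f x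

theorem primrec_gr {n : ℕ} (hn : 1 ≤ n) {f : ℕ → ℕ} (hf : Nat.Primrec f) : GrS n f := by
  haveI : Fact (1 ≤ n) := ⟨hn⟩
  induction hf with
  | zero => exact ⟨fun M v => v 1 = 0, inferInstance, fun x y => Iff.rfl⟩
  | succ => exact ⟨fun M v => v 1 = v 0 + 1, inferInstance, fun x y => Iff.rfl⟩
  | left =>
    refine ⟨fun M v => ∃ z, NP (v 0) (v 1) z, inferInstance, fun x y => ?_⟩
    simp only [tn_exists, Matrix.cons_val_zero, Matrix.cons_val_one, NP_iff]
    constructor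
    · rintro ⟨z, rfl⟩; simp
    · rintro rfl; exact ⟨x.unpair.2, by simp⟩
  | right =>
    refine ⟨fun M v => ∃ z, NP (v 0) z (v 1), inferInstance, fun x y => ?_⟩
    simp only [tn_exists, Matrix.cons_val_zero, Matrix.cons_val_one, NP_iff]
    constructor
    · rintro ⟨z, rfl⟩; simp
    · rintro rfl; exact ⟨x.unpair.1, by simp⟩
  | pair _ _ h1 h2 =>
    obtain ⟨R, hR, e⟩ := h1
    obtain ⟨S, hS, e'⟩ := h2
    have := Sg.ex (n := n) (m := 0) (k := 3) (Q := fun M v b => R M ![v 0, v 2] ∧ S M ![v 0, b] ∧ NP (v 1) (v 2) b)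
      (h := by infer_instance)
    have := Sg.ex (n := n) (m := 0) (k := 2) (Q := fun M v a => ∃ b, R M ![v 0, a] ∧ S M ![v 0, b] ∧ NP (v 1) a b) (h := this)
    refine ⟨_, this, fun x y => ?_⟩
    simp only [tn_exists, Matrix.cons_val_zero, Matrix.cons_val_one, NP_iff, e, e']
    simp
  | comp _ _ h1 h2 =>
    obtain ⟨R, hR, e⟩ := h1
    obtain ⟨S, hS, e'⟩ := h2
    have := Sg.ex (n := n) (m := 0) (k := 2) (Q := fun M v a => S M ![v 0, a] ∧ R M ![a, v 1]) (h := by infer_instance)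
    refine ⟨_, this, fun x y => ?_⟩
    simp only [tn_exists, Matrix.cons_val_zero, Matrix.cons_val_one, e, e']
    simp
  | @prec f g _ _ h1 h2 =>
    obtain ⟨R, hR, e⟩ := h1
    obtain ⟨S, hS, e'⟩ := h2
    -- variables: x y z m s i q q'
    have a1 := Sg.ex (n := n) (m := 0) (k := 7) (Q := fun M v q' => NP (v 6) (v 5) (ev (v 4) (v 5)) ∧ NP q' (v 2) (v 6) ∧ S M ![q', ev (v 4) (v 5 + 1)]) (h := by infer_instance)
    have a2 := Sg.ex (n := n) (m := 0) (k := 6) (Q := fun M v q => ∃ q', NP q (v 5) (ev (v 4) (v 5)) ∧ NP q' (v 2) q ∧ S M ![q', ev (v 4) (v 5 + 1)]) (h := a1)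
    have a3 : Sg n 1 (k := 5) (fun M v => ∀ i, i < v 3 → ∃ q, ∃ q', NP q i (ev (v 4) i) ∧ NP q' (v 2) q ∧ S M ![q', ev (v 4) (i + 1)]) :=
      Sg.allLt (t := fun M v => v 3) (Q := fun M v i => ∃ q, ∃ q', NP q i (ev (v 4) i) ∧ NP q' (v 2) q ∧ S M ![q', ev (v 4) (i + 1)]) (h := a2)
    have a4 : Sg n 1 (k := 5) (fun M v => (NP (v 0) (v 2) (v 3) ∧ R M ![v 2, ev (v 4) 0] ∧ ev (v 4) (v 3) = v 1) ∧
      ∀ i, i < v 3 → ∃ q, ∃ q', NP q i (ev (v 4) i) ∧ NP q' (v 2) q ∧ S M ![q', ev (v 4) (i + 1)]) := inferInstance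
    have a5 := Sg.ex (n := n) (m := 0) (k := 4) (Q := fun M v s => (NP (v 0) (v 2) (v 3) ∧ R M ![v 2, ev s 0] ∧ ev s (v 3) = v 1) ∧
      ∀ i, i < v 3 → ∃ q, ∃ q', NP q i (ev s i) ∧ NP q' (v 2) q ∧ S M ![q', ev s (i + 1)]) (h := a4)
    have a6 := Sg.ex (n := n) (m := 0) (k := 3) (Q := fun M v m => ∃ s, (NP (v 0) (v 2) m ∧ R M ![v 2, ev s 0] ∧ ev s m = v 1) ∧
      ∀ i, i < m → ∃ q, ∃ q', NP q i (ev s i) ∧ NP q' (v 2) q ∧ S M ![q', ev s (i + 1)]) (h := a5)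
    have a7 := Sg.ex (n := n) (m := 0) (k := 2) (Q := fun M v z => ∃ m s, (NP (v 0) z m ∧ R M ![z, ev s 0] ∧ ev s m = v 1) ∧
      ∀ i, i < m → ∃ q, ∃ q', NP q i (ev s i) ∧ NP q' z q ∧ S M ![q', ev s (i + 1)]) (h := a6)
    refine ⟨_, a7, fun x y => ?_⟩
    let F : ℕ → ℕ → ℕ := fun z m => Nat.rec (f z) (fun y IH => g (Nat.pair z (Nat.pair y IH))) m
    have hF0 : ∀ z, F z 0 = f z := fun z => rfl
    have hFS : ∀ z m, F z (m + 1) = g (Nat.pair z (Nat.pair m (F z m))) := fun z m => rfl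
    have hR' : ∀ z y, R Nst ![tn z, y] ↔ y = tn (f z) := fun z y => e z y
    have hS' : ∀ z y, S Nst ![tn z, y] ↔ y = tn (g z) := fun z y => e' z y
    have key : ∀ z m (s : Nst), (R Nst ![tn z, ev s 0] ∧ ∀ i, i < tn m → ∃ q, ∃ q', NP q i (ev s i) ∧ NP q' (tn z) q ∧ S Nst ![q', ev s (i + 1)]) ↔
        ∀ i < m + 1, ev s (tn i) = tn (F z i) := by
      intro z m s
      have st : ∀ i, (∃ q, ∃ q', NP q (tn i) (ev s (tn i)) ∧ NP q' (tn z) q ∧ S Nst ![q', ev s (tn i + 1)]) ↔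
          ev s (tn (i + 1)) = tn (g (Nat.pair z (Nat.pair i (fn (ev s (tn i)))))) := by
        intro i
        rw [← tn_fn (ev s (tn i))]
        simp only [tn_exists, NP_iff, hS', tn_add, tn_one]
        simp
      simp only [tn_forall, tn_lt, st, hR']
      constructor
      · rintro ⟨h0, h⟩ i
        induction i with
        | zero => intro _; exact h0
        | succ i ih =>
          intro hi
          rw [h i (by omega), ih (by omega), hFS]; rfl
      · intro h
        refine ⟨h 0 (by omega), fun i hi => ?_⟩
        rw [h (i + 1) (by omega), h i (by omega), hFS]; rfl
    show _ ↔ y = F x.unpair.1 x.unpair.2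
    constructor
    · rintro ⟨z, m, s, ⟨h1, h2, h3⟩, h4⟩
      obtain ⟨z, rfl⟩ : ∃ z', tn z' = z := ⟨z, rfl⟩
      obtain ⟨m, rfl⟩ : ∃ z', tn z' = m := ⟨m, rfl⟩
      have h1 := NP_iff.1 (show NP (tn x) (tn z) (tn m) from h1)
      have := (key z m s).1 ⟨h2, h4⟩ m (by omega)
      subst h1
      simp only [Nat.unpair_pair]
      exact tn_inj.1 (h3.symm.trans this)
    · rintro rfl
      obtain ⟨s, hs⟩ := Nst_seq (F x.unpair.1) (x.unpair.2 + 1)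
      obtain ⟨h1, h2⟩ := (key _ _ s).2 hs
      refine ⟨tn x.unpair.1, tn x.unpair.2, s, ⟨NP_iff.2 (Nat.pair_unpair x).symm, h1, hs _ (by omega)⟩, h2⟩

end ArithFC

end

section
set_option linter.all false
open FirstOrder Language
set_option synthInstance.maxHeartbeats 400000
set_option synthInstance.maxSize 2000
set_option maxHeartbeats 1000000
namespace ArithFC

open Nat.Partrec in
/-- universal relations -/
def uu : ℕ → ℕ → ℕ → Prop
  | 0, e, x => ∃ k, (Code.evaln k (Denumerable.ofNat Code e) x).isSome = true
  | m + 1, e, x => ∃ y, ¬ uu m e (Nat.pair x y)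

open Nat.Partrec in
theorem uu_def {n : ℕ} (hn : 1 ≤ n) (m : ℕ) : ∃ R : URel 2, SigR n (m + 1) R ∧ ∀ e x, R Nst ![tn e, tn x] ↔ uu m e x := by
  induction m with
  | zero =>
    have hP : Primrec (fun z : ℕ => Encodable.encode (Code.evaln z.unpair.1 (Denumerable.ofNat Code z.unpair.2.unpair.1) z.unpair.2.unpair.2).isSome) := by
      refine Primrec.encode.comp (Primrec.option_isSome.comp ?_)
      have h1 : Primrec fun z : ℕ => z.unpair.1 := Primrec.fst.comp Primrec.unpair
      have h2 : Primrec fun z : ℕ => z.unpair.2 := Primrec.snd.comp Primrec.unpair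
      exact Code.primrec_evaln.comp (Primrec.pair (Primrec.pair h1 ((Primrec.ofNat Code).comp (h1.comp h2))) (h2.comp h2))
    obtain ⟨R, hR, e⟩ := primrec_gr hn (Primrec.nat_iff.1 hP)
    have a1 := Sg.ex (n := n) (m := 0) (k := 4) (Q := fun M v z => NP (v 3) (v 0) (v 1) ∧ NP z (v 2) (v 3) ∧ R M ![z, 1]) (h := by infer_instance)
    have a2 := Sg.ex (n := n) (m := 0) (k := 3) (Q := fun M v q => ∃ z, NP q (v 0) (v 1) ∧ NP z (v 2) q ∧ R M ![z, 1]) (h := a1)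
    have a3 := Sg.ex (n := n) (m := 0) (k := 2) (Q := fun M v k => ∃ q z, NP q (v 0) (v 1) ∧ NP z k q ∧ R M ![z, 1]) (h := a2)
    refine ⟨_, a3.out, fun c x => ?_⟩
    have e1 : ∀ z, R Nst ![tn z, 1] ↔ _ := fun z => e z 1
    simp only [tn_exists, Matrix.cons_val_zero, Matrix.cons_val_one, NP_iff, e1, uu]
    refine exists_congr fun k => ?_
    simp only [exists_eq_left, Nat.unpair_pair, exists_and_left]
    cases (Code.evaln k (Denumerable.ofNat Code c) x).isSome <;> simp
  | succ m ih =>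
    obtain ⟨R, hR, e⟩ := ih
    have : Sg n (m + 1) R := ⟨hR⟩
    have a1 : Sg n (m + 1 + 1) (k := 4) (fun M v => NP (v 3) (v 1) (v 2) ∧ ¬ R M ![v 0, v 3]) := inferInstance
    have a2 := Sg.ex (n := n) (m := m + 1) (k := 3) (Q := fun M v q => NP q (v 1) (v 2) ∧ ¬ R M ![v 0, q]) (h := a1)
    have a3 := Sg.ex (n := n) (m := m + 1) (k := 2) (Q := fun M v y => ∃ q, NP q (v 1) y ∧ ¬ R M ![v 0, q]) (h := a2)
    refine ⟨_, a3.out, fun c x => ?_⟩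
    simp only [tn_exists, Matrix.cons_val_zero, Matrix.cons_val_one, NP_iff, e, uu]
    simp

theorem term_prim {α : Type} {n : ℕ} (t : lang.Term (α ⊕ Fin n)) (a : α → ℕ → ℕ) (b : Fin n → ℕ → ℕ)
    (ha : ∀ i, Primrec (a i)) (hb : ∀ i, Primrec (b i)) :
    Primrec (fun x => fn (t.realize (M := Nst) (Sum.elim (fun i => tn (a i x)) (fun i => tn (b i x))))) := by
  induction t with
  | var i =>
    rcases i with i | i
    · exact ha i
    · exact hb i
  | func f ts ih =>
    change Func _ at f
    cases f with
    | zero => exact Primrec.const 0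
    | one => exact Primrec.const 1
    | add => exact Primrec.nat_add.comp (ih 0) (ih 1)
    | mul => exact Primrec.nat_mul.comp (ih 0) (ih 1)

theorem delta0_prim {α : Type} {n : ℕ} {φ : lang.BoundedFormula α n} (h : IsDelta0 n φ) :
    ∀ (a : α → ℕ → ℕ) (b : Fin n → ℕ → ℕ) (ha : ∀ i, Primrec (a i)) (hb : ∀ i, Primrec (b i)),
    PrimrecPred (fun x => φ.Realize (M := Nst) (fun i => tn (a i x)) (fun i => tn (b i x))) := by
  induction h with
  | falsum n => intro a b ha hb; exact ⟨fun _ => isFalse id, Primrec.const false⟩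
  | equal n t u =>
    intro a b ha hb
    exact PrimrecRel.comp (β := ℕ) (γ := ℕ) Primrec.eq (term_prim t a b ha hb) (term_prim u a b ha hb)
  | rel n l R ts =>
    intro a b ha hb
    change Rel _ at R
    cases R with
    | lt =>
      exact Primrec.nat_lt.comp (term_prim (ts 0) a b ha hb) (term_prim (ts 1) a b ha hb)
  | imp n _ _ h1 h2 =>
    intro a b ha hb
    refine ((h1 a b ha hb).not.or (h2 a b ha hb)).of_eq fun x => ?_
    rw [BoundedFormula.realize_imp]; tauto
  | @bdAll n t φ _ ih =>
    intro a b ha hb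
    have h1 : Primrec fun z : ℕ => z.unpair.1 := Primrec.fst.comp Primrec.unpair
    have h2 : Primrec fun z : ℕ => z.unpair.2 := Primrec.snd.comp Primrec.unpair
    have H := ih (fun i x => a i x.unpair.1) (Fin.snoc (fun i x => b i x.unpair.1) (fun x => x.unpair.2))
      (fun i => (ha i).comp h1) (fun i => by
        refine Fin.lastCases ?_ (fun i => ?_) i
        · simpa using h2
        · simpa using (hb i).comp h1)
    have hq : Primrec (fun q : ℕ × ℕ => Nat.pair q.2 q.1) := Primrec₂.natPair.comp Primrec.snd Primrec.fst
    have H' := H.comp hq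
    have H' : PrimrecRel fun (y x : ℕ) => φ.Realize (M := Nst) (fun i => tn (a i (Nat.unpair (Nat.pair x y)).1)) fun i =>
      tn ((Fin.snoc (fun i x => b i (Nat.unpair x).1) (fun x => (Nat.unpair x).2) : Fin (n + 1) → ℕ → ℕ) i (Nat.pair x y)) := H'
    refine (H'.forall_lt.comp (term_prim t a b ha hb) Primrec.id).of_eq fun x => ?_
    rw [realize_bdAll]
    rw [tn_forall]
    refine forall_congr' fun y => ?_
    have e : (fun i => tn ((Fin.snoc (fun i x => b i x.unpair.1) (fun x => x.unpair.2) : Fin (n + 1) → ℕ → ℕ) i (Nat.pair x y)))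
        = Fin.snoc (fun i => tn (b i x)) (tn y) := by
      ext i
      refine Fin.lastCases ?_ (fun i => ?_) i <;> simp
    simp only [Nat.unpair_pair, id] at e ⊢
    rw [e]
    exact Iff.rfl

/-- coding of tuples by iterated pairing -/
def cod : ∀ k : ℕ, (Fin k → ℕ) → ℕ
  | 0, _ => 0
  | k + 1, v => Nat.pair (cod k (fun i => v i.castSucc)) (v (Fin.last k))

def ndec : ∀ k : ℕ, Fin k → ℕ → ℕ
  | 0 => Fin.elim0
  | k + 1 => Fin.snoc (fun i x => ndec k i x.unpair.1) (fun x => x.unpair.2)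

theorem ndec_prim : ∀ k i, Primrec (ndec k i)
  | 0, i => i.elim0
  | k + 1, i => by
    have h1 : Primrec fun z : ℕ => z.unpair.1 := Primrec.fst.comp Primrec.unpair
    have h2 : Primrec fun z : ℕ => z.unpair.2 := Primrec.snd.comp Primrec.unpair
    unfold ndec
    refine Fin.lastCases ?_ (fun i => ?_) i
    · simpa using h2
    · simpa using (ndec_prim k i).comp h1

theorem ndec_cod : ∀ k i v, ndec k i (cod k v) = v i
  | 0, i, v => i.elim0
  | k + 1, i, v => by
    unfold ndec cod
    refine Fin.lastCases ?_ (fun i => ?_) i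
    · simp
    · simp [ndec_cod k]

theorem cod_snoc (k : ℕ) (v : Fin k → ℕ) (w : ℕ) : cod (k + 1) (Fin.snoc v w : Fin (k+1) → ℕ) = Nat.pair (cod k v) w := by
  simp [cod]

open Nat.Partrec in
theorem uu_univ {n : ℕ} (m : ℕ) : ∀ {k : ℕ} {R : URel k}, SigR n (m + 1) R →
    ∃ e, ∀ v : Fin k → ℕ, R Nst (fun i => tn (v i)) ↔ uu m e (cod k v) := by
  have sn : ∀ {k : ℕ} (v : Fin k → ℕ) (w : ℕ), (Fin.snoc (fun i => tn (v i)) (tn w) : Fin (k + 1) → Nst) = fun i => tn ((Fin.snoc v w : Fin (k+1) → ℕ) i) := by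
    intro k v w
    ext i
    refine Fin.lastCases ?_ (fun i => ?_) i <;> simp
  induction m with
  | zero =>
    intro k R hR
    obtain ⟨S, hS, e⟩ := hR
    obtain ⟨S', ⟨φ, h1, h2⟩, h3⟩ := hS
    have hP : PrimrecPred (fun x => φ.Realize (M := Nst) Empty.elim (fun i => tn (ndec (k + 1) i x))) := by
      refine (delta0_prim h1 (fun i => i.elim) (ndec (k + 1)) (fun i => i.elim) (ndec_prim _)).of_eq fun x => ?_
      have : (fun i : Empty => tn ((i.elim : ℕ → ℕ) x)) = Empty.elim := by ext i; exact i.elim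
      rw [this]
    have hT : ∀ v w, (Fin.snoc (fun i => tn (v i)) (tn w) : Fin (k + 1) → Nst) = fun i => tn (ndec (k + 1) i (Nat.pair (cod k v) w)) := by
      intro v w
      rw [sn]
      ext i
      rw [← cod_snoc, ndec_cod]
    classical
    have hN := hP.not.decide
    obtain ⟨p, hp⟩ : ∃ p : ℕ → Bool, p = fun x => decide (¬ φ.Realize (M := Nst) Empty.elim (fun i => tn (ndec (k + 1) i x))) := ⟨_, rfl⟩
    rw [← hp] at hN
    have hcomp : Computable₂ (fun x w : ℕ => p (Nat.pair x w)) := hN.to_comp.comp Primrec₂.natPair.to_comp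
    have hpart : Partrec (fun x : ℕ => Nat.rfind (fun w => Part.some (p (Nat.pair x w)))) :=
      Partrec.rfind hcomp.partrec₂
    obtain ⟨c, hc⟩ := Code.exists_code.1 (Partrec.nat_iff.1 hpart)
    refine ⟨Encodable.encode c, fun v => ?_⟩
    have : uu 0 (Encodable.encode c) (cod k v) ↔ (c.eval (cod k v)).Dom := by
      unfold uu
      rw [Denumerable.ofNat_encode, Part.dom_iff_mem]
      simp only [Code.evaln_complete, Option.isSome_iff_exists]
      exact exists_comm
    rw [this, hc, e Nst (Nst_isig n), tn_exists]
    refine Iff.trans ?_ (Nat.rfind_dom (p := fun w => Part.some (p (Nat.pair (cod k v) w)))).symm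
    refine exists_congr fun w => ?_
    rw [hT, h3 Nst (Nst_isig n), h2]
    simp [hp]
  | succ m ih =>
    intro k R hR
    obtain ⟨S, hS, e⟩ := hR
    obtain ⟨c, hc⟩ := ih hS
    refine ⟨c, fun v => ?_⟩
    rw [e Nst (Nst_isig n), tn_exists]
    refine exists_congr fun w => ?_
    rw [sn, hc, cod_snoc]

end ArithFC

end

section
set_option linter.all false
open FirstOrder Language
set_option synthInstance.maxHeartbeats 400000
set_option synthInstance.maxSize 2000
set_option maxHeartbeats 1000000
namespace ArithFC

theorem pair_zero (x : ℕ) : Nat.pair 0 x = x * x := by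
  unfold Nat.pair
  split
  · omega
  · have : x = 0 := by omega
    subst this; rfl

theorem univ4 (m : ℕ) : ∃ Z : URel 4, SigR (m + 1) m Z ∧ ∀ S : URel 2, SigR (m + 1) (m + 1) S →
    ∃ e : Nst, ∀ d p : Nst, S Nst ![d, p] ↔ ∃ w, ¬ Z Nst ![e, d, p, w] := by
  obtain ⟨U, ⟨Z, hZ, hUZ⟩, hU⟩ := uu_def (n := m + 1) (by omega) m
  have hZ' : Sg (m + 1) m Z := ⟨hZ⟩
  have h1 : Sg (m + 1) m (k := 4) (fun M v => Z M ![v 0, pr (v 1) (v 2) * pr (v 1) (v 2), v 3]) := inferInstance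
  refine ⟨_, h1.out, fun S hS => ?_⟩
  have hS' : Sg (m + 1) (m + 1) S := ⟨hS⟩
  have h2 : Sg (m + 1) (m + 1) (k := 1) (fun M v => S M ![p1 (v 0), p2 (v 0)]) := inferInstance
  obtain ⟨e, he⟩ := uu_univ m h2.out
  refine ⟨tn e, fun d p => ?_⟩
  have := he (fun _ => fn (pr d p))
  simp only [tn_fn, p1_pr, p2_pr] at this
  rw [this]
  unfold cod cod
  rw [pair_zero, ← hU, hUZ Nst (Nst_isig _)]
  refine exists_congr fun w => ?_
  have : (Fin.snoc ![tn e, tn (fn (pr d p) * fn (pr d p))] w : Fin 3 → Nst) = ![tn e, pr d p * pr d p, w] := by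
    ext i; fin_cases i <;> rfl
  rw [this]
  rfl

section
variable (Z : URel 4)

/-- Π_n-uniformized relation -/
def Un (M : Mod) (e d q : M) : Prop :=
  (∀ w, Z M ![e, d, p1 q, w]) ∧ (∀ p, p < p1 q → ∃ w, w < p2 q ∧ ¬ Z M ![e, d, p, w]) ∧
    ∀ b, b < p2 q → ∃ p, p < p1 q ∧ ∀ w, w < b → Z M ![e, d, p, w]

variable {Z} {m : ℕ}

theorem Un.pg (hZ : SigR (m + 1) m Z) : Pg (m + 1) (m + 1) (k := 3) (fun M v => Un Z M (v 0) (v 1) (v 2)) := by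
  haveI : Fact (m ≤ m + 1) := ⟨by omega⟩
  have hZ' : Sg (m + 1) m Z := ⟨hZ⟩
  have a1 : Pg (m + 1) (m + 1) (k := 4) (fun M v => Z M ![v 0, v 1, p1 (v 2), v 3]) := inferInstance
  have a2 := Pg.all (n := m + 1) (m := m) (k := 3) (Q := fun M v w => Z M ![v 0, v 1, p1 (v 2), w]) (h := a1)
  have b1 : Pg (m + 1) m (k := 5) (fun M v => ¬ Z M ![v 0, v 1, v 3, v 4]) := inferInstance
  have b2 : Pg (m + 1) m (k := 4) (fun M v => ∃ w, w < p2 (v 2) ∧ ¬ Z M ![v 0, v 1, v 3, w]) :=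
    Pg.exLt (t := fun M v => p2 (v 2)) (Q := fun M v w => ¬ Z M ![v 0, v 1, v 3, w]) (h := b1)
  have b3 : Pg (m + 1) m (k := 3) (fun M v => ∀ p, p < p1 (v 2) → ∃ w, w < p2 (v 2) ∧ ¬ Z M ![v 0, v 1, p, w]) :=
    Pg.allLt (t := fun M v => p1 (v 2)) (Q := fun M v p => ∃ w, w < p2 (v 2) ∧ ¬ Z M ![v 0, v 1, p, w]) (h := b2)
  have c1 : Sg (m + 1) m (k := 6) (fun M v => Z M ![v 0, v 1, v 4, v 5]) := inferInstance
  have c2 : Sg (m + 1) m (k := 5) (fun M v => ∀ w, w < v 3 → Z M ![v 0, v 1, v 4, w]) :=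
    Sg.allLt (t := fun M v => v 3) (Q := fun M v w => Z M ![v 0, v 1, v 4, w]) (h := c1)
  have c3 : Sg (m + 1) m (k := 4) (fun M v => ∃ p, p < p1 (v 2) ∧ ∀ w, w < v 3 → Z M ![v 0, v 1, p, w]) :=
    Sg.exLt (t := fun M v => p1 (v 2)) (Q := fun M v p => ∀ w, w < v 3 → Z M ![v 0, v 1, p, w]) (h := c2)
  have c4 : Sg (m + 1) m (k := 3) (fun M v => ∀ b, b < p2 (v 2) → ∃ p, p < p1 (v 2) ∧ ∀ w, w < b → Z M ![v 0, v 1, p, w]) :=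
    Sg.allLt (t := fun M v => p2 (v 2)) (Q := fun M v b => ∃ p, p < p1 (v 2) ∧ ∀ w, w < b → Z M ![v 0, v 1, p, w]) (h := c3)
  unfold Un
  infer_instance

theorem Un.unique {M : Mod} {e d q q' : M} (h : Un Z M e d q) (h' : Un Z M e d q') : q = q' := by
  obtain ⟨a1, a2, a3⟩ := h
  obtain ⟨b1, b2, b3⟩ := h'
  have e1 : p1 q = p1 q' := by
    rcases lt_trichotomy (p1 q) (p1 q') with h | h | h
    · obtain ⟨w, -, hw⟩ := b2 _ h; exact absurd (a1 w) hw
    · exact h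
    · obtain ⟨w, -, hw⟩ := a2 _ h; exact absurd (b1 w) hw
  have e2 : p2 q = p2 q' := by
    rcases lt_trichotomy (p2 q) (p2 q') with h | h | h
    · obtain ⟨p, hp, hw⟩ := b3 _ h
      obtain ⟨w, h1, h2⟩ := a2 p (e1 ▸ hp); exact absurd (hw w h1) h2
    · exact h
    · obtain ⟨p, hp, hw⟩ := a3 _ h
      obtain ⟨w, h1, h2⟩ := b2 p (e1 ▸ hp); exact absurd (hw w h1) h2
  rw [← pr_p12 q, ← pr_p12 q', e1, e2]

theorem Nst_least {P : Nst → Prop} (h : ∃ x, P x) : ∃ x, P x ∧ ∀ y, y < x → ¬ P y := by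
  classical
  exact ⟨tn (Nat.find (p := fun x => P (tn x)) h), Nat.find_spec (p := fun x => P (tn x)) h,
    fun y hy => Nat.find_min (p := fun x => P (tn x)) h (m := fn y) hy⟩

theorem Un.ex {e d : Nst} (h : ∃ p, ∀ w, Z Nst ![e, d, p, w]) : ∃ q, Un Z Nst e d q := by
  obtain ⟨p, hp, hp'⟩ := Nst_least h
  have hb : ∀ r : ℕ, tn r ≤ p → ∃ b, ∀ p', p' < tn r → ∃ w, w < b ∧ ¬ Z Nst ![e, d, p', w] := by
    intro r
    induction r with
    | zero => intro _; exact ⟨0, fun p' h => absurd h (not_lt.2 _root_.zero_le)⟩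
    | succ r ih =>
      intro hr
      obtain ⟨b, hb⟩ := ih (hr.trans' (ltS.2 le_rfl : tn r < tn r + 1).le)
      have := hp' (tn r) (lt_of_lt_of_le (ltS.2 le_rfl : tn r < tn r + 1) hr)
      push Not at this
      obtain ⟨w, hw⟩ := this
      refine ⟨b + (w + 1), fun p' h => ?_⟩
      rcases (ltS.1 (h : p' < tn r + 1)).lt_or_eq with h | h
      · obtain ⟨w', h1, h2⟩ := hb p' h
        exact ⟨w', lt_of_lt_of_le h1 le_self_add, h2⟩
      · subst h
        exact ⟨w, lt_of_lt_of_le (ltS.2 le_rfl) le_add_self, hw⟩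
  obtain ⟨b, h1, h2⟩ := Nst_least (hb (fn p) le_rfl)
  refine ⟨pr p b, ?_⟩
  unfold Un
  simp only [p1_pr, p2_pr]
  refine ⟨hp, h1, fun b' hb' => ?_⟩
  have := h2 b' hb'
  push Not at this
  exact this

/-- Σ_{n+1}-definable functions of the standard model -/
def SG (n : ℕ) : Set (Nst → Nst) := {f | ∃ R : URel 2, SigR n (n + 1) R ∧ ∀ d y, R Nst ![d, y] ↔ y = f d}

theorem num_df {k : ℕ} (a : ℕ) : DF (k := k) (fun M v => numM M a) := by
  induction a with
  | zero => exact DF.zero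
  | succ a ih => exact DF.addI (f := fun M _ => numM M a) (g := fun M _ => 1)

theorem numM_tn (a : ℕ) : numM Nst a = tn a := by
  induction a with
  | zero => rfl
  | succ a ih => show numM Nst a + 1 = _; rw [ih]; rfl

theorem Sg.fin {n m k : ℕ} : ∀ {l : ℕ} {P : Fin l → URel k} (h : ∀ i, Sg n m (P i)), Sg n m (fun M v => ∀ i, P i M v)
  | 0, P, h => by
    have : Sg n m (k := k) (fun M v => (0 : M) = 0) := inferInstance
    exact ⟨this.out.congr fun M _ v => by simp⟩
  | l + 1, P, h => by
    have h1 := Sg.fin (fun i : Fin l => h i.succ)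
    have h0 := h 0
    have : Sg n m (k := k) (fun M v => P 0 M v ∧ ∀ i : Fin l, P i.succ M v) := inferInstance
    exact ⟨this.out.congr fun M _ v => by rw [Fin.forall_fin_succ]⟩

theorem SG.skH (m : ℕ) (U : Ultrafilter Nst) : SkH (m + 1) Nst U (SG (m + 1)) where
  const a := by
    haveI := num_df (k := 2) (fn a)
    have : Sg (m + 1) (m + 1 + 1) (k := 2) (fun M v => v 1 = numM M (fn a)) := inferInstance
    exact ⟨_, this.out, fun d y => by rw [numM_tn]; rfl⟩
  sk := by
    classical
    intro k R hR f hf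
    choose S hS hSf using hf
    have hR0 : Sg (m + 1) (m + 1) R := ⟨hR⟩
    have hS0 : ∀ i, Sg (m + 1) (m + 1 + 1) (S i) := fun i => ⟨hS i⟩
    have d1 := dcd_df k (k := 3) (fun M v => v 2)
    have d2 := dcd_df k (k := 4) (fun M v => v 2)
    have s1 : ∀ i, Sg (m + 1) (m + 1 + 1) (k := 3) (fun M v => S i M ![v 0, dcd k (v 2) i]) := by
      intro i
      haveI := d1.out i
      infer_instance
    have s2 := Sg.fin s1
    have r1 : Sg (m + 1) (m + 1) (k := 4) (fun M v => R M (Fin.snoc (dcd k (v 2)) (v 3))) := inferInstance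
    have r0 : Sg (m + 1) (m + 1) (k := 3) (fun M v => R M (Fin.snoc (dcd k (v 2)) (v 1))) := inferInstance
    have r2 : Pg (m + 1) (m + 1) (k := 4) (fun M v => ¬ R M (Fin.snoc (dcd k (v 2)) (v 3))) := inferInstance
    have r3 : Pg (m + 1) (m + 1) (k := 3) (fun M v => ∀ x, x < v 1 → ¬ R M (Fin.snoc (dcd k (v 2)) x)) :=
      Pg.allLt (t := fun M v => v 1) (Q := fun M v x => ¬ R M (Fin.snoc (dcd k (v 2)) x)) (h := r2)
    have r4 := Pg.all (n := m + 1) (m := m) (k := 3) (Q := fun M v x => ¬ R M (Fin.snoc (dcd k (v 2)) x)) (h := r2)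
    have t1 : Sg (m + 1) (m + 1 + 1) (k := 3) (fun M v => (∀ i, S i M ![v 0, dcd k (v 2) i]) ∧
      ((R M (Fin.snoc (dcd k (v 2)) (v 1)) ∧ ∀ x, x < v 1 → ¬ R M (Fin.snoc (dcd k (v 2)) x)) ∨
        (v 1 = 0 ∧ ∀ x, ¬ R M (Fin.snoc (dcd k (v 2)) x)))) := inferInstance
    have t2 := Sg.ex (n := m + 1) (m := m + 1) (k := 2) (Q := fun M v c => (∀ i, S i M ![v 0, dcd k c i]) ∧
      ((R M (Fin.snoc (dcd k c) (v 1)) ∧ ∀ x, x < v 1 → ¬ R M (Fin.snoc (dcd k c) x)) ∨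
        (v 1 = 0 ∧ ∀ x, ¬ R M (Fin.snoc (dcd k c) x)))) (h := t1)
    have hg : ∀ d, ∃ y, (R Nst (Fin.snoc (fun i => f i d) y) ∧ ∀ x, x < y → ¬ R Nst (Fin.snoc (fun i => f i d) x)) ∨
        (y = 0 ∧ ∀ x, ¬ R Nst (Fin.snoc (fun i => f i d) x)) := by
      intro d
      by_cases h : ∃ x, R Nst (Fin.snoc (fun i => f i d) x)
      · obtain ⟨x, h1, h2⟩ := Nst_least h; exact ⟨x, Or.inl ⟨h1, h2⟩⟩
      · push Not at h; exact ⟨0, Or.inr ⟨rfl, h⟩⟩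
    choose g hg using hg
    refine ⟨g, ⟨_, t2.out, fun d y => ?_⟩, Filter.Eventually.of_forall fun d => ?_⟩
    · have e1 : ∀ c, (∀ i, S i Nst ![d, dcd k c i]) ↔ dcd k c = fun i => f i d := by
        intro c; rw [funext_iff]; exact forall_congr' fun i => hSf i _ _
      simp only [Matrix.cons_val_zero, Matrix.cons_val_one, e1]
      constructor
      · rintro ⟨c, hc, h⟩
        rw [hc] at h
        rcases h with ⟨h1, h2⟩ | ⟨h1, h2⟩
        · rcases hg d with ⟨h3, h4⟩ | ⟨h3, h4⟩
          · rcases lt_trichotomy y (g d) with h | h | h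
            · exact absurd h1 (h4 _ h)
            · exact h
            · exact absurd h3 (h2 _ h)
          · exact absurd h1 (h4 _)
        · rcases hg d with ⟨h3, h4⟩ | ⟨h3, h4⟩
          · exact absurd h3 (h2 _)
          · rw [h1, h3]
      · rintro rfl
        obtain ⟨c, hc⟩ := dcd_surj k (fun i => f i d)
        exact ⟨c, hc, by rw [hc]; exact hg d⟩
    · rintro ⟨x, hx⟩
      rcases hg d with h | ⟨h3, h4⟩
      · exact h
      · exact absurd hx (h4 _)

theorem SG.key (hZ : SigR (m + 1) m Z)
    (hu : ∀ S : URel 2, SigR (m + 1) (m + 1) S → ∃ e : Nst, ∀ d p : Nst, S Nst ![d, p] ↔ ∃ w, ¬ Z Nst ![e, d, p, w])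
    {f : Nst → Nst} (hf : f ∈ SG (m + 1)) : ∃ (e : Nst) (q : Nst → Nst), q ∈ SG (m + 1) ∧ ∀ d, Un Z Nst e d (q d) ∧ p1 (p1 (q d)) = f d := by
  obtain ⟨R, ⟨S, hS, hRS⟩, hR⟩ := hf
  have hS0 : Sg (m + 1) (m + 1) S := ⟨hS⟩
  have h2 : Sg (m + 1) (m + 1) (k := 2) (fun M v => S M ![v 0, p1 (v 1), p2 (v 1)]) := inferInstance
  have sn : ∀ d y w : Nst, (Fin.snoc ![d, y] w : Fin 3 → Nst) = ![d, y, w] := by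
    intro d y w; ext i; fin_cases i <;> rfl
  obtain ⟨e, he⟩ := hu _ h2.out
  have he' : ∀ d p : Nst, S Nst ![d, p1 p, p2 p] ↔ ∃ w, ¬ Z Nst ![e, d, p, w] := fun d p => he d p
  have : ∀ d, ∃ q, Un Z Nst e d q := by
    intro d
    obtain ⟨w, hw⟩ := (hRS Nst (Nst_isig _) _).1 ((hR d (f d)).2 rfl)
    rw [sn] at hw
    refine Un.ex ⟨pr (f d) w, ?_⟩
    have := he' d (pr (f d) w)
    rw [p1_pr, p2_pr] at this
    by_contra hc
    push Not at hc
    exact hw (this.2 hc)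
  choose q hq using this
  refine ⟨e, q, ?_, fun d => ⟨hq d, ?_⟩⟩
  · haveI := num_df (k := 2) (fn e)
    have hpg := Un.pg hZ
    have h3 : Pg (m + 1) (m + 1) (k := 2) (fun M v => Un Z M (numM M (fn e)) (v 0) (v 1)) :=
      hpg.subst (k := 2) (f := fun M v => ![numM M (fn e), v 0, v 1])
    have h4 : Sg (m + 1) (m + 1 + 1) (k := 2) (fun M v => Un Z M (numM M (fn e)) (v 0) (v 1)) := inferInstance
    refine ⟨_, h4.out, fun d y => ?_⟩
    rw [numM_tn]
    exact ⟨fun h => Un.unique h (hq d), fun h => by subst h; exact hq d⟩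
  · refine (hR d _).1 ((hRS Nst (Nst_isig _) _).2 ⟨p2 (p1 (q d)), ?_⟩)
    rw [sn, he']
    push Not
    exact (hq d).1

/-- the model in which everything is indexed below c -/
theorem exists_K (m : ℕ) : ∃ (Z : URel 4) (K : Mod) (c : K), SigR (m + 1) m Z ∧ Countable K ∧ ISig (m + 1) K ∧
    ∀ x : K, ∃ v, v < c ∧ ∃ q, Un Z K v c q ∧ p1 (p1 q) = x := by
  classical
  obtain ⟨Z, hZ, hu⟩ := univ4 m
  haveI : Infinite Nst := inferInstanceAs (Infinite ℕ)
  haveI : Countable Nst := inferInstanceAs (Countable ℕ)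
  let U : Ultrafilter Nst := Filter.hyperfilter Nst
  have hn : 1 ≤ m + 1 := by omega
  have h := SG.skH m U
  have hid : (fun d : Nst => d) ∈ SG (m + 1) := by
    have : Sg (m + 1) (m + 1 + 1) (k := 2) (fun M v => v 1 = v 0) := inferInstance
    exact ⟨_, this.out, fun d y => Iff.rfl⟩
  refine ⟨Z, RUT.mod h hn (Nst_isig _), RUT.mk h _ hid, hZ, ?_, RUT.isig h hn (Nst_isig _), ?_⟩
  · refine RUT.countable h (J := Nst) (fun e d => if hq : ∃ q, Un Z Nst e d q then p1 (p1 hq.choose) else 0) ?_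
    intro f hf
    obtain ⟨e, q, -, hq⟩ := SG.key hZ hu hf
    refine ⟨e, Filter.Eventually.of_forall fun d => ?_⟩
    have hx : ∃ q, Un Z Nst e d q := ⟨_, (hq d).1⟩
    beta_reduce
    rw [dif_pos hx, ← (hq d).2, Un.unique (hq d).1 hx.choose_spec]
  · intro x
    obtain ⟨f, hf, hx⟩ := RUT.rep (h := h) x
    obtain ⟨e, q, hqG, hq⟩ := SG.key hZ hu hf
    refine ⟨RUT.dia h e, ?_, RUT.mk h q hqG, ?_, ?_⟩
    · refine ((Rep.dia e).lt (Rep.mk hid)).2 ?_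
      have : {d : Nst | ¬ e < d}.Finite := by
        refine (Set.finite_le_nat (fn e)).subset fun d hd => ?_
        exact Nat.le_of_not_lt hd
      have := this.compl_mem_hyperfilter
      refine Filter.mem_of_superset this fun d hd => ?_
      simpa using hd
    · by_contra hc
      have hpg := (Un.pg hZ).out
      have := (RUT.losS h hn (Nst_isig _) hpg (v := ![RUT.dia h e, RUT.mk h _ hid, RUT.mk h q hqG]) (f := ![fun _ => e, fun d => d, q]) (by
        intro i
        fin_cases i
        · exact Rep.dia e
        · exact Rep.mk hid
        · exact Rep.mk hqG)).1 hc
      obtain ⟨d, hd⟩ := this.exists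
      exact hd (hq d).1
    · have D : SigR (m + 1) (m + 1) (k := 2) (fun M v => p1 (p1 (v 0)) = v 1) := SigR.d0 inferInstance
      exact (RUT.losS h hn (Nst_isig _) D (v := ![RUT.mk h q hqG, x]) (f := ![q, f]) (by
        intro i
        fin_cases i
        · exact Rep.mk hqG
        · exact hx)).2 (Filter.Eventually.of_forall fun d => (hq d).2)

/-- the injection -/
def Fr (Z : URel 4) (M : Mod) (u v c : M) : Prop :=
  ∃ q, (v < c ∧ p1 (p1 q) = u ∧ Un Z M v c q) ∧ (∀ q', q' < q → ∀ v', v' < c → p1 (p1 q') = u → ¬ Un Z M v' c q') ∧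
    ∀ v', v' < v → ¬ Un Z M v' c q

theorem Fr.sg (hZ : SigR (m + 1) m Z) : Sg (m + 1) (m + 1 + 1) (k := 3) (fun M v => Fr Z M (v 0) (v 1) (v 2)) := by
  have hpg := Un.pg hZ
  have a1 : Pg (m + 1) (m + 1) (k := 4) (fun M v => Un Z M (v 1) (v 2) (v 3)) :=
    hpg.subst (k := 4) (f := fun M v => ![v 1, v 2, v 3])
  have b0 : Pg (m + 1) (m + 1) (k := 6) (fun M v => Un Z M (v 5) (v 2) (v 4)) :=
    hpg.subst (k := 6) (f := fun M v => ![v 5, v 2, v 4])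
  have b1 : Sg (m + 1) (m + 1) (k := 6) (fun M v => p1 (p1 (v 4)) = v 0 → ¬ Un Z M (v 5) (v 2) (v 4)) := inferInstance
  have b2 : Sg (m + 1) (m + 1) (k := 5) (fun M v => ∀ v', v' < v 2 → p1 (p1 (v 4)) = v 0 → ¬ Un Z M v' (v 2) (v 4)) :=
    Sg.allLt (t := fun M v => v 2) (Q := fun M v v' => p1 (p1 (v 4)) = v 0 → ¬ Un Z M v' (v 2) (v 4)) (h := b1)
  have b3 : Sg (m + 1) (m + 1) (k := 4) (fun M v => ∀ q', q' < v 3 → ∀ v', v' < v 2 → p1 (p1 q') = v 0 → ¬ Un Z M v' (v 2) q') :=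
    Sg.allLt (t := fun M v => v 3) (Q := fun M v q' => ∀ v', v' < v 2 → p1 (p1 q') = v 0 → ¬ Un Z M v' (v 2) q') (h := b2)
  have c0 : Pg (m + 1) (m + 1) (k := 5) (fun M v => Un Z M (v 4) (v 2) (v 3)) :=
    hpg.subst (k := 5) (f := fun M v => ![v 4, v 2, v 3])
  have c1 : Sg (m + 1) (m + 1) (k := 5) (fun M v => ¬ Un Z M (v 4) (v 2) (v 3)) := inferInstance
  have c2 : Sg (m + 1) (m + 1) (k := 4) (fun M v => ∀ v', v' < v 1 → ¬ Un Z M v' (v 2) (v 3)) :=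
    Sg.allLt (t := fun M v => v 1) (Q := fun M v v' => ¬ Un Z M v' (v 2) (v 3)) (h := c1)
  have d1 : Sg (m + 1) (m + 1 + 1) (k := 4) (fun M v => (v 1 < v 2 ∧ p1 (p1 (v 3)) = v 0 ∧ Un Z M (v 1) (v 2) (v 3)) ∧
    (∀ q', q' < v 3 → ∀ v', v' < v 2 → p1 (p1 q') = v 0 → ¬ Un Z M v' (v 2) q') ∧ ∀ v', v' < v 1 → ¬ Un Z M v' (v 2) (v 3)) := inferInstance
  exact Sg.ex (n := m + 1) (m := m + 1) (k := 3) (Q := fun M v q => (v 1 < v 2 ∧ p1 (p1 q) = v 0 ∧ Un Z M (v 1) (v 2) q) ∧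
    (∀ q', q' < q → ∀ v', v' < v 2 → p1 (p1 q') = v 0 → ¬ Un Z M v' (v 2) q') ∧ ∀ v', v' < v 1 → ¬ Un Z M v' (v 2) q) (h := d1)

theorem Fr.fun {M : Mod} {u v v' c : M} (h : Fr Z M u v c) (h' : Fr Z M u v' c) : v = v' := by
  obtain ⟨q, ⟨a1, a2, a3⟩, a4, a5⟩ := h
  obtain ⟨q', ⟨b1, b2, b3⟩, b4, b5⟩ := h'
  have e : q = q' := by
    rcases lt_trichotomy q q' with h | h | h
    · exact absurd a3 (b4 _ h _ a1 a2)
    · exact h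
    · exact absurd b3 (a4 _ h _ b1 b2)
  subst e
  rcases lt_trichotomy v v' with h | h | h
  · exact absurd a3 (b5 _ h)
  · exact h
  · exact absurd b3 (a5 _ h)

theorem Fr.inj {M : Mod} {u u' v c : M} (h : Fr Z M u v c) (h' : Fr Z M u' v c) : u = u' := by
  obtain ⟨q, ⟨a1, a2, a3⟩, a4, a5⟩ := h
  obtain ⟨q', ⟨b1, b2, b3⟩, b4, b5⟩ := h'
  rw [← a2, ← b2, Un.unique a3 b3]

theorem Fr.ex (hZ : SigR (m + 1) m Z) {M : Mod} (hM : ISig (m + 1) M) {u c : M}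
    (h : ∃ v, v < c ∧ ∃ q, Un Z M v c q ∧ p1 (p1 q) = u) : ∃ v, v < c ∧ Fr Z M u v c := by
  have hpg := Un.pg hZ
  obtain ⟨v, hv, q, hq, hqu⟩ := h
  have b0 : Pg (m + 1) (m + 1) (k := 4) (fun M v => Un Z M (v 3) (v 1) (v 2)) :=
    hpg.subst (k := 4) (f := fun M v => ![v 3, v 1, v 2])
  have b1 : Pg (m + 1) (m + 1) (k := 4) (fun M v => p1 (p1 (v 2)) = v 0 ∧ Un Z M (v 3) (v 1) (v 2)) := inferInstance
  have b2 : Pg (m + 1) (m + 1) (k := 3) (fun M v => ∃ v', v' < v 1 ∧ p1 (p1 (v 2)) = v 0 ∧ Un Z M v' (v 1) (v 2)) :=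
    Pg.exLt (t := fun M v => v 1) (Q := fun M v v' => p1 (p1 (v 2)) = v 0 ∧ Un Z M v' (v 1) (v 2)) (h := b1)
  obtain ⟨q, ⟨v, hv, hqu, hq⟩, hmin⟩ := Pg.lnp (k := 2) (Q := fun M v q => ∃ v', v' < v 1 ∧ p1 (p1 q) = v 0 ∧ Un Z M v' (v 1) q) (h := b2) M hM ![u, c] (x := q) ⟨v, hv, hqu, hq⟩
  have c1 : Pg (m + 1) (m + 1) (k := 3) (fun M v => Un Z M (v 2) (v 1) (v 0)) :=
    hpg.subst (k := 3) (f := fun M v => ![v 2, v 1, v 0])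
  obtain ⟨v', hq', hmin'⟩ := Pg.lnp (k := 2) (Q := fun M v v' => Un Z M v' (v 1) (v 0)) (h := c1) M hM ![q, c] (x := v) hq
  have hvv : v' ≤ v := not_lt.1 fun h => hmin' v h hq
  have hv' : v' < c := lt_of_le_of_lt hvv hv
  exact ⟨v', hv', q, ⟨hv', hqu, hq'⟩, fun q' hq' v' hv' e h => hmin q' hq' ⟨v', hv', e, h⟩, hmin'⟩

end

theorem part2 {n : ℕ} (hn : 1 ≤ n) : ∃ N : Mod, ISig n N ∧ (∀ e k : N, FRT N (n + 1) e k) ∧ ¬ WPHP N (n + 1) := by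
  obtain ⟨m, rfl⟩ : ∃ m, n = m + 1 := ⟨n - 1, by omega⟩
  obtain ⟨Z, K, c, hZ, hcK, hK, hKx⟩ := exists_K m
  obtain ⟨N, g, h1, -, h3, hN, hF⟩ := part1 hn K hK (c + c)
  have H := Embedding.hom_lemmas h1.emb
  refine ⟨N, hN, hF, fun hW => hW (g c) ?_ ?_⟩
  · obtain ⟨v, hv, -⟩ := hKx 0
    have : (0 : K) < c := lt_of_le_of_lt _root_.zero_le hv
    have := (H.2.2.2.2.1 _ _).2 this
    rw [H.1] at this
    exact this
  · refine ⟨fun u v => Fr Z N u v (g c), ?_, ?_, fun u v v' _ h h' => h.fun h', fun u u' v _ _ h h' => h.inj h'⟩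
    · exact SigR.def (j := 2) (k := 1) (Fr.sg hZ).out N hN ![g c]
    · intro u hu
      obtain ⟨u, rfl⟩ := h3 u (by
        have := H.2.2.1 c c
        change g (c + c) = g c + g c at this
        rw [this]; exact le_of_lt hu)
      obtain ⟨v, hv, hFr⟩ := Fr.ex hZ hK (hKx u)
      refine ⟨g v, (H.2.2.2.2.1 _ _).2 hv, ?_⟩
      exact (SigR.elem (Fr.sg hZ).out hK hN h1 ![u, v, c]).1 hFr

end ArithFC

end

section
set_option linter.all false
open FirstOrder Language
namespace ArithFC

/-- For every `n ≥ 1` and countable `M ⊨ PA⁻ + IΣn` and `a ∈ M`,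
there is a Σ_{n+1}-elementary cofinal extension `N` of `M` with `[0,a]^M = [0,a]^N`
satisfying PA⁻ + IΣn + FRT(Σ_{n+1}). Consequently, PA⁻ + IΣn + FRT(Σ_{n+1}) does
not prove WPHP(Σ_{n+1}). -/
theorem statement_14 (n : ℕ) (hn : 1 ≤ n) :
    (∀ (M : Type) (_ : lang.Structure M), Countable M → PAm M → ISig n M → ∀ a : M,
      ∃ (N : Type) (_ : lang.Structure N) (g : M → N),
        SigmaElem M N (n + 1) g ∧ Cofinal M N g ∧ SameBelow M N g a ∧
          PAm N ∧ ISig n N ∧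
          (∀ e k : N, (1 : N) ≤ e → (1 : N) ≤ k → FRT N (n + 1) e k)) ∧
      ∃ (N : Type) (_ : lang.Structure N), PAm N ∧ ISig n N ∧
        (∀ e k : N, (1 : N) ≤ e → (1 : N) ≤ k → FRT N (n + 1) e k) ∧
        ¬WPHP N (n + 1) := by
  refine ⟨?_, ?_⟩
  · intro M str hc hp hi a
    let K : Mod := ⟨M, str, @AR.mk _ str (@PAM.mk _ str hp) (hi.mono hn)⟩
    haveI : Countable K := hc
    obtain ⟨N, g, h1, h2, h3, hN, hF⟩ := part1 hn K hi a
    exact ⟨N.carrier, N.str, g, h1, h2, h3, N.ar.toPAM.out, hN, fun e k _ _ => hF e k⟩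
  · obtain ⟨N, hN, hF, hW⟩ := part2 hn
    exact ⟨N.carrier, N.str, N.ar.toPAM.out, hN, fun e k _ _ => hF e k, hW⟩

end ArithFC

end
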